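/- Let k ≥ 1 and A ≥ 2 be integers with A > binom(2k,k)/(2k), and let f:ℝ→ℝ be supported on (−∞,1] with f ∈ C^A(ℝ) and f, f′, …, f^{(A)} all uniformly bounded. Then there is a constant C(k,f) > 0 such that for all x ≥ R ≥ 2 and all η with log 2/log R ≤ η ≤ 1, Σ_{n ≤ x : n has a prime factor p ≤ R^η} M_f(n;R)^{2k} ≤ C(k,f)·η·x/log R. -/

import Mathlib

open scoped Classical

/-- `M_f(n;R) := Σ_{d | n} μ(d) f(log d / log R)`. -/
noncomputable def Mf (f : ℝ → ℝ) (n : ℕ) (R : ℝ) : ℝ :=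
  ∑ d ∈ n.divisors,
    ((ArithmeticFunction.moebius d : ℤ) : ℝ) * f (Real.log d / Real.log R)

theorem sum_Ico_rpow_neg_three_halves_le {N : ℕ} (hN : 1 ≤ N) (M : ℕ) (hM : N ≤ M) :
    ∑ i ∈ Finset.Ico N M, (1 / ((i : ℝ) * √i)) ≤ 4 / √N - 4 / √M := by
  induction M, hM using Nat.le_induction with
  | base => simp
  | succ M hM ih =>
    rw [Finset.sum_Ico_succ_top hM]
    have hM1 : (1 : ℝ) ≤ M := by exact_mod_cast hN.trans hM
    have ha : 1 ≤ √(M : ℝ) := by rw [Real.one_le_sqrt]; exact hM1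
    have hb : √(M : ℝ) ≤ √((M + 1 : ℕ) : ℝ) := Real.sqrt_le_sqrt (by push_cast; linarith)
    have ha2 : (M : ℝ) = √(M : ℝ) ^ 2 := (Real.sq_sqrt (by positivity)).symm
    have hb2 : √((M + 1 : ℕ) : ℝ) ^ 2 = √(M : ℝ) ^ 2 + 1 := by
      rw [Real.sq_sqrt (by positivity), Real.sq_sqrt (by positivity)]; push_cast; ring
    have key : 1 / ((M : ℝ) * √M) ≤ 4 / √M - 4 / √((M + 1 : ℕ) : ℝ) := by
      nth_rewrite 1 [ha2]
      generalize √((M + 1 : ℕ) : ℝ) = b at *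
      generalize √(M : ℝ) = a at *
      have ha0 : 0 < a := by linarith
      have hb0 : 0 < b := by linarith
      have h1 : (b - a) * (b + a) = 1 := by nlinarith
      have h2 : b * (b + a) ≤ 4 * a ^ 2 := by
        nlinarith [sq_nonneg (b - 2 * a), sq_nonneg (3 * a - 2 * b)]
      rw [div_sub_div _ _ ha0.ne' hb0.ne', div_le_div_iff₀ (by positivity) (by positivity)]
      have h3 : b ≤ 4 * a ^ 2 * (b - a) := by
        have : b * 1 ≤ 4 * a ^ 2 * (b - a) := by
          rw [← h1]
          have := mul_le_mul_of_nonneg_left h2 (sub_nonneg.2 hb)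
          linarith
        linarith
      have := mul_le_mul_of_nonneg_left h3 ha0.le
      nlinarith
    linarith

theorem norm_sum_Ico_sub_integral_le {h h' : ℝ → ℂ} {B : ℝ} {N M : ℕ} (hN : 1 ≤ N) (hM : N ≤ M)
    (hB : 0 ≤ B) (hd : ∀ x : ℝ, 1 ≤ x → HasDerivAt h (h' x) x)
    (hb : ∀ x : ℝ, 1 ≤ x → ‖h' x‖ ≤ B * (1 / (x * √x))) :
    ‖∑ i ∈ Finset.Ico N M, h i - ∫ x in (N : ℝ)..M, h x‖ ≤ 4 * B / √N := by
  have hcont : ContinuousOn h (Set.Ici 1) := fun x hx => (hd x hx).continuousAt.continuousWithinAt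
  have hintegrable : ∀ i j : ℕ, 1 ≤ i → 1 ≤ j →
      IntervalIntegrable h MeasureTheory.volume (i : ℝ) (j : ℝ) := fun i j hi hj =>
    (hcont.mono (fun x hx => by
      have h1 : (1 : ℝ) ≤ i := by exact_mod_cast hi
      have h2 : (1 : ℝ) ≤ j := by exact_mod_cast hj
      have := hx.1
      exact le_trans (le_min h1 h2) this)).intervalIntegrable
  have hsplit : ∑ i ∈ Finset.Ico N M, ∫ x in (i : ℝ)..((i + 1 : ℕ) : ℝ), h x
      = ∫ x in (N : ℝ)..M, h x := by
    refine intervalIntegral.sum_integral_adjacent_intervals_Ico (a := fun i : ℕ => (i : ℝ)) hM ?_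
    intro k hk
    have := hk.1
    exact hintegrable _ _ (by omega) (by omega)
  rw [← hsplit, ← Finset.sum_sub_distrib]
  have hterm : ∀ i ∈ Finset.Ico N M, ‖h i - ∫ x in (i : ℝ)..((i + 1 : ℕ) : ℝ), h x‖
      ≤ B * (1 / ((i : ℝ) * √i)) := by
    intro i hi
    have hi1 : 1 ≤ i := hN.trans (Finset.mem_Ico.1 hi).1
    have hi1' : (1 : ℝ) ≤ i := by exact_mod_cast hi1
    have e : h i - ∫ x in (i : ℝ)..((i + 1 : ℕ) : ℝ), h x
        = ∫ x in (i : ℝ)..((i + 1 : ℕ) : ℝ), (h i - h x) := by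
      rw [intervalIntegral.integral_sub (by simp) (hintegrable _ _ hi1 (by omega))]
      simp
    rw [e]
    have := intervalIntegral.norm_integral_le_of_norm_le_const (a := (i : ℝ))
      (b := ((i + 1 : ℕ) : ℝ)) (f := fun x => h i - h x) (C := B * (1 / ((i : ℝ) * √i))) ?_
    · simpa using this
    · intro x hx
      rw [Set.uIoc_of_le (by push_cast; linarith)] at hx
      rw [norm_sub_rev]
      have := (convex_Icc (i : ℝ) ((i + 1 : ℕ) : ℝ)).norm_image_sub_le_of_norm_hasDerivWithin_le
        (f := h) (f' := h') (x := (i : ℝ)) (y := x) (C := B * (1 / ((i : ℝ) * √i)))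
        (fun y hy => (hd y (hi1'.trans hy.1)).hasDerivWithinAt)
        (fun y hy => (hb y (hi1'.trans hy.1)).trans ?_)
        ⟨le_rfl, by push_cast; linarith⟩ ⟨hx.1.le, hx.2⟩
      · refine this.trans ?_
        have h2 := hx.2
        push_cast at h2
        have h3 : ‖x - (i : ℝ)‖ ≤ 1 := by
          rw [Real.norm_eq_abs, abs_le]; constructor <;> linarith [hx.1]
        have : 0 ≤ B * (1 / ((i : ℝ) * √i)) := by positivity
        nlinarith
      · have hy1 := hy.1
        have hy0 : 0 ≤ y := by linarith
        gcongr
  refine (norm_sum_le_of_le _ hterm).trans ?_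
  rw [← Finset.mul_sum]
  have := mul_le_mul_of_nonneg_left (sum_Ico_rpow_neg_three_halves_le hN M hM) hB
  have h0 : 0 ≤ 4 * B / √(M : ℝ) := by positivity
  have e : B * (4 / √(N : ℝ) - 4 / √(M : ℝ)) = 4 * B / √(N : ℝ) - 4 * B / √(M : ℝ) := by ring
  linarith

theorem norm_ofReal_cpow_neg_sub_le {x : ℝ} (hx : 1 ≤ x) {c : ℝ} {s₁ s₂ : ℂ} (h₁ : c ≤ s₁.re)
    (h₂ : c ≤ s₂.re) :
    ‖(x : ℂ) ^ (-s₁) - (x : ℂ) ^ (-s₂)‖ ≤ Real.log x * x ^ (-c) * ‖s₁ - s₂‖ := by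
  have hx0 : (x : ℂ) ≠ 0 := by exact_mod_cast (by linarith : x ≠ 0)
  refine (convex_halfSpace_re_ge c).norm_image_sub_le_of_norm_hasDerivWithin_le
    (f := fun z : ℂ => (x : ℂ) ^ (-z)) (f' := fun z => (x : ℂ) ^ (-z) * Complex.log x * (-1))
    (fun z _ => ?_) (fun z hz => ?_) h₂ h₁
  · exact ((hasDerivAt_neg z).const_cpow (Or.inl hx0)).hasDerivWithinAt
  · rw [norm_mul, norm_mul, Complex.norm_cpow_eq_rpow_re_of_pos (by linarith),
        ← Complex.ofReal_log (by linarith)]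
    simp only [Complex.neg_re, norm_neg, norm_one, mul_one, Complex.norm_real, Real.norm_eq_abs]
    rw [abs_of_nonneg (Real.log_nonneg hx), mul_comm]
    gcongr
    · exact Real.log_nonneg hx
    · exact hz

theorem hasDerivAt_ofReal_cpow_neg {x : ℝ} (hx : 1 ≤ x) (s : ℂ) :
    HasDerivAt (fun y : ℝ => (y : ℂ) ^ (-s)) (-s * (x : ℂ) ^ (-(s + 1))) x := by
  by_cases hs : s = 0
  · subst hs; simpa using hasDerivAt_const x (1 : ℂ)
  · convert hasDerivAt_ofReal_cpow_const (x := x) (r := -s) (by linarith) (neg_ne_zero.2 hs) using 3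
    ring

theorem norm_hasDerivAt_cpow_sub_bound {x : ℝ} (hx : 1 ≤ x) {s₁ s₂ : ℂ} (h₁ : 1 < s₁.re)
    (h₂ : 1 < s₂.re) :
    ‖-s₁ * (x : ℂ) ^ (-(s₁ + 1)) - -s₂ * (x : ℂ) ^ (-(s₂ + 1))‖ ≤
      ‖s₁ - s₂‖ * (1 + 2 * ‖s₂‖) * (1 / (x * √x)) := by
  have hx0 : 0 < x := by linarith
  have hs1 : 1 ≤ √x := by rw [Real.one_le_sqrt]; exact hx
  have e : -s₁ * (x : ℂ) ^ (-(s₁ + 1)) - -s₂ * (x : ℂ) ^ (-(s₂ + 1)) =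
      -((s₁ - s₂) * (x : ℂ) ^ (-(s₁ + 1))) - s₂ * ((x : ℂ) ^ (-(s₁ + 1)) -
        (x : ℂ) ^ (-(s₂ + 1))) := by
    ring
  have hx2 : x ^ (-2 : ℝ) = 1 / (x * √x * √x) := by
    rw [mul_assoc, Real.mul_self_sqrt hx0.le, Real.rpow_neg hx0.le]
    norm_num; ring
  have hA : ‖(x : ℂ) ^ (-(s₁ + 1))‖ ≤ 1 / (x * √x) := by
    rw [Complex.norm_cpow_eq_rpow_re_of_pos hx0]
    calc x ^ (-(s₁ + 1)).re ≤ x ^ (-2 : ℝ) := by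
          apply Real.rpow_le_rpow_of_exponent_le hx; simp; linarith
      _ = 1 / (x * √x * √x) := hx2
      _ ≤ 1 / (x * √x) := by
          apply one_div_le_one_div_of_le (by positivity)
          nlinarith [mul_pos hx0 (by linarith : 0 < √x)]
  have hlog : Real.log x ≤ 2 * √x := by
    have := Real.log_le_sub_one_of_pos (x := √x) (by linarith)
    rw [Real.log_sqrt hx0.le] at this
    linarith
  have hB : ‖(x : ℂ) ^ (-(s₁ + 1)) - (x : ℂ) ^ (-(s₂ + 1))‖ ≤ 2 * (1 / (x * √x)) * ‖s₁ - s₂‖ := by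
    refine (norm_ofReal_cpow_neg_sub_le hx (c := 2) (s₁ := s₁ + 1) (s₂ := s₂ + 1)
      (by simp; linarith) (by simp; linarith)).trans ?_
    rw [add_sub_add_right_eq_sub]
    rw [hx2]
    refine mul_le_mul_of_nonneg_right ?_ (norm_nonneg _)
    calc Real.log x * (1 / (x * √x * √x)) ≤ 2 * √x * (1 / (x * √x * √x)) := by gcongr
      _ = 2 * (1 / (x * √x)) := by field_simp
  rw [e]
  refine (norm_sub_le _ _).trans ?_
  rw [norm_neg, norm_mul, norm_mul]
  have h1 := mul_le_mul_of_nonneg_left hA (norm_nonneg (s₁ - s₂))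
  have h2 := mul_le_mul_of_nonneg_left hB (norm_nonneg s₂)
  linarith

/-- The main terms of the truncated Dirichlet series of `ζ`. -/
noncomputable def zetaApprox (N : ℕ) (s : ℂ) : ℂ :=
  ∑ i ∈ Finset.Ico 1 N, ((i : ℝ) : ℂ) ^ (-s) + ((N : ℝ) : ℂ) ^ (1 - s) / (s - 1)

theorem tendsto_sum_Ico_sub_integral {N : ℕ} (hN : 1 ≤ N) {s : ℂ} (hs : 1 < s.re) :
    Filter.Tendsto (fun M : ℕ => ∑ i ∈ Finset.Ico N M, ((i : ℝ) : ℂ) ^ (-s)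
      - ∫ x in (N : ℝ)..M, (x : ℂ) ^ (-s)) Filter.atTop
      (nhds (riemannZeta s - zetaApprox N s)) := by
  have hs1 : s - 1 ≠ 0 := by
    intro h; rw [sub_eq_zero] at h; rw [h] at hs; simp at hs
  have hintegrable : ∀ M : ℕ, N ≤ M → ∫ x in (N : ℝ)..M, (x : ℂ) ^ (-s)
      = ((N : ℝ) : ℂ) ^ (1 - s) / (s - 1) - ((M : ℝ) : ℂ) ^ (1 - s) / (s - 1) := by
    intro M hM
    rw [integral_cpow]
    · have e1 : -s + 1 = 1 - s := by ring
      rw [e1, ← neg_sub s 1]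
      field_simp
      ring
    · right
      refine ⟨fun h => hs1 (by linear_combination -h), ?_⟩
      rw [Set.uIcc_of_le (by exact_mod_cast hM)]
      intro h
      have h1 : (N : ℝ) ≤ 0 := h.1
      have : (1 : ℝ) ≤ N := by exact_mod_cast hN
      linarith
  have hz : Filter.Tendsto (fun M : ℕ => ∑ i ∈ Finset.Ico 1 M, ((i : ℝ) : ℂ) ^ (-s)) Filter.atTop
      (nhds (riemannZeta s)) := by
    have hsum := (Complex.summable_one_div_nat_cpow (p := s)).2 hs
    have := hsum.hasSum.tendsto_sum_nat
    rw [← zeta_eq_tsum_one_div_nat_cpow hs] at this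
    refine this.congr' ?_
    filter_upwards [Filter.eventually_ge_atTop 1] with M hM
    rw [Finset.range_eq_Ico, Finset.sum_eq_sum_Ico_succ_bot (by omega)]
    have h0 : (0 : ℂ) ^ s = 0 := Complex.zero_cpow (by intro h; rw [h] at hs; simp at hs; linarith)
    simp [h0, Complex.cpow_neg]
  have h0 : Filter.Tendsto (fun M : ℕ => ((M : ℝ) : ℂ) ^ (1 - s) / (s - 1)) Filter.atTop (nhds 0) :=
      by
    rw [tendsto_zero_iff_norm_tendsto_zero]
    have h1 : Filter.Tendsto (fun M : ℕ => (M : ℝ) ^ (-(s.re - 1)) / ‖s - 1‖)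
        Filter.atTop (nhds (0 / ‖s - 1‖)) :=
      ((tendsto_rpow_neg_atTop (by linarith)).comp tendsto_natCast_atTop_atTop).div_const _
    rw [zero_div] at h1
    refine h1.congr' ?_
    filter_upwards [Filter.eventually_ge_atTop 1] with M hM
    rw [norm_div, Complex.norm_cpow_eq_rpow_re_of_pos (by exact_mod_cast hM)]
    simp
  have := ((hz.sub_const (zetaApprox N s)).add h0)
  rw [add_zero] at this
  refine this.congr' ?_
  filter_upwards [Filter.eventually_ge_atTop N] with M hM
  rw [hintegrable M hM, zetaApprox, ← Finset.sum_Ico_consecutive _ hN hM]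
  ring

theorem norm_riemannZeta_sub_zetaApprox_le {N : ℕ} (hN : 1 ≤ N) {s : ℂ} (hs : 1 < s.re) :
    ‖riemannZeta s - zetaApprox N s‖ ≤ 4 * ‖s‖ / √N := by
  refine le_of_tendsto (tendsto_sum_Ico_sub_integral hN hs).norm ?_
  filter_upwards [Filter.eventually_ge_atTop N] with M hM
  refine norm_sum_Ico_sub_integral_le (h := fun x : ℝ => (x : ℂ) ^ (-s)) hN hM (norm_nonneg s)
    (fun x hx => hasDerivAt_ofReal_cpow_neg hx s) (fun x hx => ?_)
  have hx0 : 0 < x := by linarith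
  have hs1 : √x ≤ x := by rw [Real.sqrt_le_left hx0.le]; nlinarith
  rw [norm_mul, norm_neg, Complex.norm_cpow_eq_rpow_re_of_pos hx0]
  gcongr
  calc x ^ (-(s + 1)).re ≤ x ^ (-2 : ℝ) := by
        apply Real.rpow_le_rpow_of_exponent_le hx; simp; linarith
    _ = 1 / (x * x) := by rw [Real.rpow_neg hx0.le]; norm_num; ring
    _ ≤ 1 / (x * √x) := by
        have : 0 < √x := Real.sqrt_pos.2 hx0
        gcongr

theorem norm_riemannZeta_sub_zetaApprox_sub_le {N : ℕ} (hN : 1 ≤ N) {s₁ s₂ : ℂ} (h₁ : 1 < s₁.re)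
    (h₂ : 1 < s₂.re) :
    ‖(riemannZeta s₁ - zetaApprox N s₁) - (riemannZeta s₂ - zetaApprox N s₂)‖ ≤
      4 * (‖s₁ - s₂‖ * (1 + 2 * ‖s₂‖)) / √N := by
  refine le_of_tendsto ((tendsto_sum_Ico_sub_integral hN h₁).sub
    (tendsto_sum_Ico_sub_integral hN h₂)).norm ?_
  filter_upwards [Filter.eventually_ge_atTop N] with M hM
  have hi : ∀ s : ℂ,
      IntervalIntegrable (fun x : ℝ => (x : ℂ) ^ (-s)) MeasureTheory.volume (N : ℝ) M := by
    intro s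
    refine ContinuousOn.intervalIntegrable fun x hx => ?_
    rw [Set.uIcc_of_le (by exact_mod_cast hM)] at hx
    have : (1 : ℝ) ≤ x := le_trans (by exact_mod_cast hN) hx.1
    exact (hasDerivAt_ofReal_cpow_neg this s).continuousAt.continuousWithinAt
  have := norm_sum_Ico_sub_integral_le (h := fun x : ℝ => (x : ℂ) ^ (-s₁) - (x : ℂ) ^ (-s₂))
    hN hM (B := ‖s₁ - s₂‖ * (1 + 2 * ‖s₂‖)) (by positivity)
    (fun x hx => (hasDerivAt_ofReal_cpow_neg hx s₁).sub (hasDerivAt_ofReal_cpow_neg hx s₂))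
    (fun x hx => norm_hasDerivAt_cpow_sub_bound hx h₁ h₂)
  rw [intervalIntegral.integral_sub (hi _) (hi _), Finset.sum_sub_distrib] at this
  refine le_of_eq_of_le ?_ this
  congr 1
  ring

theorem sum_Ico_one_inv_le (N : ℕ) :
    ∑ i ∈ Finset.Ico 1 N, (1 / (i : ℝ)) ≤ 1 + Real.log N := by
  have h := harmonic_le_one_add_log N
  rw [harmonic_eq_sum_Icc] at h
  push_cast at h
  refine le_trans ?_ h
  simp only [one_div]
  refine Finset.sum_le_sum_of_subset_of_nonneg ?_ (fun i _ _ => by positivity)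
  intro i; simp; omega

/-- Points `1 + w` with real part of `w` in `(0, K]` at height at least one. -/
theorem norm_riemannZeta_bounds_high (K : ℝ) (hK : 0 < K) :
    ∃ C : ℝ, 1 ≤ C ∧ ∀ t u v : ℝ, 1 ≤ |t| → 0 < u → u ≤ K → 0 < v → v ≤ K →
      ‖riemannZeta (1 + u + Complex.I * t)‖ ≤ C * (1 + Real.log |t|) ∧
      ‖riemannZeta (1 + u + Complex.I * t) - riemannZeta (1 + v + Complex.I * t)‖ ≤
        C * (1 + Real.log |t|) ^ 2 * |u - v| := by
  refine ⟨100 * (K + 3), by linarith, fun t u v ht hu huK hv hvK => ?_⟩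
  set N : ℕ := ⌈t ^ 2⌉₊ with hNdef
  have ht2 : 1 ≤ t ^ 2 := by rw [← sq_abs]; nlinarith
  have hNt : t ^ 2 ≤ N := Nat.le_ceil _
  have hN1 : 1 ≤ N := by
    have : (1 : ℝ) ≤ N := ht2.trans hNt
    exact_mod_cast this
  have hN1' : (1 : ℝ) ≤ N := by exact_mod_cast hN1
  have hNle : (N : ℝ) ≤ 2 * |t| ^ 2 := by
    have := (Nat.ceil_lt_add_one (by positivity : 0 ≤ t ^ 2)).le
    rw [← hNdef] at this
    rw [sq_abs]; linarith
  set l := 1 + Real.log |t| with hl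
  have hl1 : 1 ≤ l := by have := Real.log_nonneg ht; linarith
  have hlogN : Real.log N ≤ 2 * l := by
    have := Real.log_le_log (by linarith) hNle
    rw [Real.log_mul (by norm_num) (by positivity), Real.log_pow] at this
    have h2 := Real.log_two_lt_d9
    push_cast at this; linarith
  have hlogN0 : 0 ≤ Real.log N := Real.log_nonneg hN1'
  have hsq : |t| ≤ √(N : ℝ) := by
    apply Real.le_sqrt_of_sq_le; rw [sq_abs]; exact hNt
  have hnorm : ∀ w : ℝ, 0 < w → w ≤ K → ‖(1 + w + Complex.I * t : ℂ)‖ ≤ (K + 2) * |t| := by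
    intro w hw hwK
    have h1 : ‖(1 + w + Complex.I * t : ℂ)‖ ≤ ‖(1 : ℂ)‖ + ‖(w : ℂ)‖ + ‖Complex.I * t‖ :=
      norm_add₃_le
    simp only [norm_one, Complex.norm_real, Real.norm_eq_abs, norm_mul, Complex.norm_I, one_mul,
      abs_of_pos hw] at h1
    nlinarith
  have hden : ∀ w : ℝ, 1 ≤ ‖(1 + w + Complex.I * t : ℂ) - 1‖ := by
    intro w
    refine ht.trans ?_
    have := Complex.abs_im_le_norm ((1 + w + Complex.I * t : ℂ) - 1)
    simpa using this
  have hre : ∀ w : ℝ, (1 + w + Complex.I * t : ℂ).re = 1 + w := by intro w; simp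
  have hterm : ∀ w : ℝ, 0 < w → ∀ i ∈ Finset.Ico 1 N,
      ‖((i : ℝ) : ℂ) ^ (-(1 + w + Complex.I * t : ℂ))‖ ≤ 1 / (i : ℝ) := by
    intro w hw i hi
    have hi1 : (1 : ℝ) ≤ i := by exact_mod_cast (Finset.mem_Ico.1 hi).1
    rw [Complex.norm_cpow_eq_rpow_re_of_pos (by linarith), one_div, ← Real.rpow_neg_one]
    apply Real.rpow_le_rpow_of_exponent_le hi1
    rw [Complex.neg_re, hre]; linarith
  have hpole : ∀ w : ℝ, 0 < w → ‖((N : ℝ) : ℂ) ^ (1 - (1 + w + Complex.I * t : ℂ))‖ ≤ 1 := by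
    intro w hw
    rw [Complex.norm_cpow_eq_rpow_re_of_pos (by linarith)]
    apply Real.rpow_le_one_of_one_le_of_nonpos hN1'
    rw [Complex.sub_re, hre]; simp; linarith
  have hharm := sum_Ico_one_inv_le N
  set s₁ : ℂ := 1 + u + Complex.I * t with hs1
  set s₂ : ℂ := 1 + v + Complex.I * t with hs2
  have hdiff : ‖s₁ - s₂‖ = |u - v| := by
    have : s₁ - s₂ = ((u - v : ℝ) : ℂ) := by rw [hs1, hs2]; push_cast; ring
    rw [this, Complex.norm_real, Real.norm_eq_abs]
  have hr1 : 1 < s₁.re := by rw [hre]; linarith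
  have hr2 : 1 < s₂.re := by rw [hre]; linarith
  constructor
  · have h1 := norm_riemannZeta_sub_zetaApprox_le hN1 hr1
    have h2 : 4 * ‖s₁‖ / √(N : ℝ) ≤ 4 * (K + 2) := by
      rw [div_le_iff₀ (by linarith)]
      have := hnorm u hu huK
      nlinarith
    have h3 : ‖zetaApprox N s₁‖ ≤ (1 + 2 * l) + 1 := by
      rw [zetaApprox]
      refine (norm_add_le _ _).trans (add_le_add ?_ ?_)
      · refine (norm_sum_le_of_le _ (hterm u hu)).trans ?_
        linarith
      · rw [norm_div]
        exact div_le_one_of_le₀ ((hpole u hu).trans (hden u)) (norm_nonneg _)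
    have h4 : ‖riemannZeta s₁‖ ≤ ‖riemannZeta s₁ - zetaApprox N s₁‖ + ‖zetaApprox N s₁‖ := by
      simpa using norm_add_le (riemannZeta s₁ - zetaApprox N s₁) (zetaApprox N s₁)
    nlinarith
  · have h1 := norm_riemannZeta_sub_zetaApprox_sub_le hN1 hr1 hr2
    have hd0 : 0 ≤ |u - v| := abs_nonneg _
    have h2 : 4 * (‖s₁ - s₂‖ * (1 + 2 * ‖s₂‖)) / √(N : ℝ) ≤ 4 * (2 * K + 5) * |u - v| := by
      rw [div_le_iff₀ (by linarith), hdiff]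
      have := hnorm v hv hvK
      have h5 : 1 + 2 * ‖s₂‖ ≤ (2 * K + 5) * √(N : ℝ) := by nlinarith
      have := mul_le_mul_of_nonneg_left h5 hd0
      nlinarith
    have h3 : ‖zetaApprox N s₁ - zetaApprox N s₂‖ ≤ (2 * l * (1 + 2 * l) + (2 * l + 1)) * |u - v| :=
        by
      have e : zetaApprox N s₁ - zetaApprox N s₂ =
          ∑ i ∈ Finset.Ico 1 N, (((i : ℝ) : ℂ) ^ (-s₁) - ((i : ℝ) : ℂ) ^ (-s₂)) +
          ((((N : ℝ) : ℂ) ^ (1 - s₁) - ((N : ℝ) : ℂ) ^ (1 - s₂)) / (s₁ - 1) +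
            ((N : ℝ) : ℂ) ^ (1 - s₂) * (s₂ - s₁) / ((s₁ - 1) * (s₂ - 1))) := by
        have n1 : s₁ - 1 ≠ 0 := norm_pos_iff.1 (by linarith [hden u])
        have n2 : s₂ - 1 ≠ 0 := norm_pos_iff.1 (by linarith [hden v])
        rw [zetaApprox, zetaApprox, Finset.sum_sub_distrib]
        field_simp
        ring
      rw [e, add_mul]
      refine (norm_add_le _ _).trans (add_le_add ?_ ((norm_add_le _ _).trans ?_))
      · have : ∀ i ∈ Finset.Ico 1 N, ‖((i : ℝ) : ℂ) ^ (-s₁) - ((i : ℝ) : ℂ) ^ (-s₂)‖ ≤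
            (2 * l * |u - v|) * (1 / (i : ℝ)) := by
          intro i hi
          have hi1 : (1 : ℝ) ≤ i := by exact_mod_cast (Finset.mem_Ico.1 hi).1
          have hiN : (i : ℝ) ≤ N := by exact_mod_cast (Finset.mem_Ico.1 hi).2.le
          refine (norm_ofReal_cpow_neg_sub_le hi1 hr1.le hr2.le).trans ?_
          have hli : Real.log i ≤ 2 * l := (Real.log_le_log (by linarith) hiN).trans hlogN
          rw [hdiff, Real.rpow_neg_one, ← one_div]
          have : 0 ≤ 1 / (i : ℝ) * |u - v| := by positivity
          nlinarith
        refine (norm_sum_le_of_le _ this).trans ?_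
        rw [← Finset.mul_sum]
        have h6 : ∑ i ∈ Finset.Ico 1 N, (1 / (i : ℝ)) ≤ 1 + 2 * l := by linarith
        have := mul_le_mul_of_nonneg_left h6 (by positivity : 0 ≤ 2 * l * |u - v|)
        linarith
      · rw [add_mul]
        refine add_le_add ?_ ?_
        · rw [norm_div]
          have hA := norm_ofReal_cpow_neg_sub_le hN1' (c := 0) (s₁ := s₁ - 1) (s₂ := s₂ - 1)
            (by simp; linarith) (by simp; linarith)
          rw [neg_sub, neg_sub, sub_sub_sub_cancel_right, hdiff, neg_zero, Real.rpow_zero,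
            mul_one] at hA
          refine (div_le_self (norm_nonneg _) (hden u)).trans (hA.trans ?_)
          gcongr
        · rw [norm_div, norm_mul, norm_mul, norm_sub_rev, hdiff]
          have : 1 ≤ ‖s₁ - 1‖ * ‖s₂ - 1‖ := one_le_mul_of_one_le_of_one_le (hden u) (hden v)
          refine (div_le_self (by positivity) this).trans ?_
          have := mul_le_mul_of_nonneg_right (hpole v hv) hd0
          linarith
    have h4 : ‖riemannZeta s₁ - riemannZeta s₂‖ ≤
        ‖(riemannZeta s₁ - zetaApprox N s₁) - (riemannZeta s₂ - zetaApprox N s₂)‖ +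
          ‖zetaApprox N s₁ - zetaApprox N s₂‖ := by
      refine le_of_eq_of_le ?_ (norm_add_le _ _)
      congr 1; ring
    refine h4.trans ((add_le_add (h1.trans h2) h3).trans ?_)
    rw [← add_mul]
    gcongr
    have q1 : l ≤ l ^ 2 := by nlinarith
    have q2 : 1 ≤ l ^ 2 := by nlinarith
    have q3 : K * 1 ≤ K * l ^ 2 := by gcongr
    linarith

theorem norm_riemannZeta_three_four_one {x : ℝ} (hx : 0 < x) (y : ℝ) :
    1 ≤ ‖riemannZeta (1 + x)‖ ^ 3 * ‖riemannZeta (1 + x + Complex.I * y)‖ ^ 4 *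
      ‖riemannZeta (1 + x + Complex.I * ((2 * y : ℝ) : ℂ))‖ := by
  have h := DirichletCharacter.norm_LSeries_product_ge_one (N := 1) 1 hx y
  have e : ∀ s : ℂ, 1 < s.re → LSeries (fun n : ℕ => (1 : DirichletCharacter ℂ 1) n) s =
      riemannZeta s := by
    intro s hs
    rw [← LSeries_one_eq_riemannZeta hs]
    congr 1
    ext n
    simp
    rw [Subsingleton.elim (n : ZMod 1) 1, map_one]
  simp only [one_pow] at h
  rw [e _ (by simp; linarith), e _ (by simp; linarith), e _ (by simp; linarith), norm_mul,
    norm_mul, norm_pow, norm_pow] at h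
  have e2 : Complex.I * ((2 * y : ℝ) : ℂ) = 2 * Complex.I * y := by push_cast; ring
  rw [e2]
  exact h

theorem abs_log_norm_riemannZeta₁_le (K : ℝ) :
    ∃ C : ℝ, 0 ≤ C ∧ ∀ w : ℂ, 0 ≤ w.re → w.re ≤ K → |w.im| ≤ 1 →
      |Real.log ‖riemannZeta₁ (1 + w)‖| ≤ C := by
  have hcomp : IsCompact (Set.Icc (0 : ℝ) K ×ℂ Set.Icc (-1 : ℝ) 1) :=
      isCompact_Icc.reProdIm isCompact_Icc
  have hne : ∀ w ∈ (Set.Icc (0 : ℝ) K ×ℂ Set.Icc (-1 : ℝ) 1), riemannZeta₁ (1 + w) ≠ 0 := by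
    intro w hw
    rw [Complex.mem_reProdIm] at hw
    by_cases h0 : w = 0
    · simp [h0]
    · intro h
      have h1 : (1 + w) ≠ 1 := by simpa using h0
      have := riemannZeta_eq_inv_sub_mul h1
      rw [h, mul_zero] at this
      exact riemannZeta_ne_zero_of_one_le_re (by simpa using hw.1.1) this
  have hcont : ContinuousOn (fun w : ℂ => Real.log ‖riemannZeta₁ (1 + w)‖)
      (Set.Icc (0 : ℝ) K ×ℂ Set.Icc (-1 : ℝ) 1) := by
    refine ContinuousOn.log ?_ (fun w hw => norm_ne_zero_iff.2 (hne w hw))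
    have := differentiable_riemannZeta₁.continuous
    fun_prop
  obtain ⟨C, hC⟩ := hcomp.exists_bound_of_continuousOn hcont
  refine ⟨max C 0, le_max_right _ _, fun w h1 h2 h3 => (hC w ?_).trans (le_max_left _ _)⟩
  rw [Complex.mem_reProdIm]
  exact ⟨⟨h1, h2⟩, abs_le.1 h3⟩

theorem norm_riemannZeta_one_add_real_le (K : ℝ) :
    ∃ C : ℝ, 1 ≤ C ∧ ∀ x : ℝ, 0 < x → x ≤ K → ‖riemannZeta (1 + x)‖ ≤ C / x := by
  obtain ⟨C, hC0, hC⟩ := abs_log_norm_riemannZeta₁_le K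
  refine ⟨Real.exp C, Real.one_le_exp hC0, fun x hx hxK => ?_⟩
  have h1 : (1 + (x : ℂ)) ≠ 1 := by simpa using hx.ne'
  have h2 := riemannZeta_eq_inv_sub_mul h1
  have h3 := hC x (by simpa using hx.le) (by simpa using hxK) (by simp)
  have h4 : ‖riemannZeta₁ (1 + x)‖ ≤ Real.exp C := by
    by_cases h0 : ‖riemannZeta₁ (1 + x)‖ = 0
    · rw [h0]; positivity
    · rw [← Real.log_le_iff_le_exp (lt_of_le_of_ne (norm_nonneg _) (Ne.symm h0))]
      exact (le_abs_self _).trans h3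
  rw [h2, norm_mul, norm_inv, add_sub_cancel_left, Complex.norm_real, Real.norm_of_nonneg hx.le]
  rw [div_eq_inv_mul]
  gcongr

theorem norm_riemannZeta_lower_high (K : ℝ) (hK : 0 < K) :
    ∃ c : ℝ, 0 < c ∧ ∀ t u : ℝ, 1 ≤ |t| → 0 < u → u ≤ K →
      c / (1 + Real.log |t|) ^ 7 ≤ ‖riemannZeta (1 + u + Complex.I * t)‖ := by
  obtain ⟨C₁, hC₁, h₁⟩ := norm_riemannZeta_bounds_high (K + 1) (by linarith)
  obtain ⟨C₂, hC₂, h₂⟩ := norm_riemannZeta_one_add_real_le (K + 1)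
  -- the lower bound from the 3-4-1 inequality
  have low : ∀ t u : ℝ, 1 ≤ |t| → 0 < u → u ≤ K + 1 →
      u ^ 3 ≤ C₂ ^ 3 * (2 * C₁ * (1 + Real.log |t|)) *
        ‖riemannZeta (1 + u + Complex.I * t)‖ ^ 4 := by
    intro t u ht hu huK
    have h := norm_riemannZeta_three_four_one hu t
    have ht2 : 1 ≤ |2 * t| := by rw [abs_mul, abs_two]; linarith
    have hb := (h₁ (2 * t) u u ht2 hu huK hu huK).1
    have hl0 : 0 ≤ Real.log |t| := Real.log_nonneg ht
    have hl : 1 + Real.log |2 * t| ≤ 2 * (1 + Real.log |t|) := by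
      rw [abs_mul, abs_two, Real.log_mul (by norm_num) (by positivity)]
      have := Real.log_two_lt_d9
      linarith
    have hb' : ‖riemannZeta (1 + u + Complex.I * ((2 * t : ℝ) : ℂ))‖ ≤
        2 * C₁ * (1 + Real.log |t|) := by
      refine hb.trans ?_
      have := mul_le_mul_of_nonneg_left hl (by linarith : 0 ≤ C₁)
      linarith
    have ha := h₂ u hu huK
    have ha3 : ‖riemannZeta (1 + u)‖ ^ 3 ≤ C₂ ^ 3 / u ^ 3 := by
      rw [← div_pow]; gcongr
    have : 1 ≤ C₂ ^ 3 / u ^ 3 * ‖riemannZeta (1 + u + Complex.I * t)‖ ^ 4 *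
        (2 * C₁ * (1 + Real.log |t|)) := by
      refine h.trans ?_
      gcongr
    have h5 := mul_le_mul_of_nonneg_left this (by positivity : 0 ≤ u ^ 3)
    have e : u ^ 3 * (C₂ ^ 3 / u ^ 3 * ‖riemannZeta (1 + u + Complex.I * t)‖ ^ 4 *
        (2 * C₁ * (1 + Real.log |t|)))
      = C₂ ^ 3 * (2 * C₁ * (1 + Real.log |t|)) * ‖riemannZeta (1 + u + Complex.I * t)‖ ^ 4 := by
      field_simp
    rw [e] at h5
    linarith
  set D := C₂ ^ 3 * (2 * C₁) with hD
  have hD1 : 1 ≤ D := by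
    have : 1 ≤ C₂ ^ 3 := one_le_pow₀ hC₂
    nlinarith
  -- the choice of the comparison point
  set b : ℝ := 1 / (16 * C₁ ^ 4 * D) with hb
  have hb0 : 0 < b := by positivity
  have hb1 : b ≤ 1 := by
    rw [hb, div_le_one (by positivity)]
    have : 1 ≤ C₁ ^ 4 := one_le_pow₀ hC₁
    nlinarith
  refine ⟨C₁ * b, by positivity, fun t u ht hu huK => ?_⟩
  have hl0 : 0 ≤ Real.log |t| := Real.log_nonneg ht
  have low' : ∀ v : ℝ, b / (1 + Real.log |t|) ^ 9 ≤ v → v ≤ K + 1 →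
      2 * C₁ * b / (1 + Real.log |t|) ^ 7 ≤ ‖riemannZeta (1 + v + Complex.I * t)‖ := by
    intro v hv hvK
    have hv0 : 0 < v := lt_of_lt_of_le (by positivity) hv
    have h := low t v ht hv0 hvK
    set l := 1 + Real.log |t| with hl
    have hlpos : 0 < l := by linarith
    have hz : 0 ≤ ‖riemannZeta (1 + v + Complex.I * t)‖ := norm_nonneg _
    refine le_of_pow_le_pow_left₀ (n := 4) (by norm_num) hz ?_
    have h3 : (b / l ^ 9) ^ 3 ≤ v ^ 3 := by gcongr
    have h4 : (b / l ^ 9) ^ 3 ≤ D * l * ‖riemannZeta (1 + v + Complex.I * t)‖ ^ 4 := by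
      refine h3.trans (h.trans (le_of_eq ?_)); rw [hD]; ring
    have e : (2 * C₁ * b / l ^ 7) ^ 4 = (b / l ^ 9) ^ 3 / (D * l) := by
      have hbD : 16 * C₁ ^ 4 * D * b = 1 := by rw [hb]; field_simp
      have : b / D * (1 / l ^ 28) * (16 * C₁ ^ 4 * D * b) * b ^ 2 = b / D * (1 / l ^ 28) * b ^ 2 :=
          by
        rw [hbD, mul_one]
      have e1 : (2 * C₁ * b / l ^ 7) ^ 4 = b / D * (1 / l ^ 28) * (16 * C₁ ^ 4 * D * b) * b ^ 2 :=
          by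
        field_simp; ring
      rw [e1, this]
      field_simp
    rw [e, div_le_iff₀ (by positivity)]
    linarith
  by_cases hcase : b / (1 + Real.log |t|) ^ 9 ≤ u
  · refine le_trans ?_ (low' u hcase (by linarith))
    have : 0 ≤ C₁ * b / (1 + Real.log |t|) ^ 7 := by positivity
    have e : 2 * C₁ * b / (1 + Real.log |t|) ^ 7 = 2 * (C₁ * b / (1 + Real.log |t|) ^ 7) := by ring
    linarith
  · push Not at hcase
    set v := b / (1 + Real.log |t|) ^ 9 with hv
    have hl1 : 1 ≤ (1 + Real.log |t|) ^ 9 := one_le_pow₀ (by linarith)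
    have hv1 : v ≤ 1 := (div_le_self hb0.le hl1).trans hb1
    have hL := low' v le_rfl (by linarith)
    have hdiff := (h₁ t v u ht (by positivity) (by linarith) hu (by linarith)).2
    have h6 : C₁ * (1 + Real.log |t|) ^ 2 * |v - u| ≤ C₁ * b / (1 + Real.log |t|) ^ 7 := by
      rw [abs_of_pos (by linarith : 0 < v - u)]
      calc C₁ * (1 + Real.log |t|) ^ 2 * (v - u) ≤ C₁ * (1 + Real.log |t|) ^ 2 * v := by
            gcongr; linarith
        _ = C₁ * b / (1 + Real.log |t|) ^ 7 := by rw [hv]; field_simp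
    have h7 : ‖riemannZeta (1 + v + Complex.I * t)‖ ≤ ‖riemannZeta (1 + u + Complex.I * t)‖ +
        ‖riemannZeta (1 + v + Complex.I * t) - riemannZeta (1 + u + Complex.I * t)‖ := by
      simpa using norm_add_le (riemannZeta (1 + u + Complex.I * t))
        (riemannZeta (1 + v + Complex.I * t) - riemannZeta (1 + u + Complex.I * t))
    have e : 2 * C₁ * b / (1 + Real.log |t|) ^ 7 = 2 * (C₁ * b / (1 + Real.log |t|) ^ 7) := by ring
    linarith

open Real in
theorem abs_log_norm_riemannZeta_sub_le (K : ℝ) (hK : 0 < K) :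
    ∃ C : ℝ, 0 ≤ C ∧ ∀ w : ℂ, 0 < w.re → w.re ≤ K →
      |Real.log ‖riemannZeta (1 + w)‖ - log⁺ (‖w‖⁻¹)| ≤ 7 * Real.log (1 + log⁺ ‖w‖) + C := by
  obtain ⟨C₁, hC₁, h₁⟩ := norm_riemannZeta_bounds_high K hK
  obtain ⟨c, hc, h₂⟩ := norm_riemannZeta_lower_high K hK
  obtain ⟨C₃, hC₃, h₃⟩ := abs_log_norm_riemannZeta₁_le K
  have hC₁l : 0 ≤ Real.log C₁ := Real.log_nonneg hC₁
  refine ⟨Real.log C₁ + |Real.log c| + C₃ + (K + 1), by positivity, fun w hw hwK => ?_⟩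
  have hw0 : 0 < ‖w‖ := norm_pos_iff.2 (by rintro rfl; simp at hw)
  have hp0 : 0 ≤ log⁺ ‖w‖ := posLog_nonneg
  have hlp : 0 ≤ Real.log (1 + log⁺ ‖w‖) := Real.log_nonneg (by linarith)
  by_cases him : 1 ≤ |w.im|
  · have hwn : 1 ≤ ‖w‖ := him.trans (Complex.abs_im_le_norm w)
    have hz : log⁺ (‖w‖⁻¹) = 0 := by
      rw [posLog_eq_zero_iff, abs_of_pos (by positivity)]; exact inv_le_one_of_one_le₀ hwn
    have e : (1 : ℂ) + w = 1 + (w.re : ℂ) + Complex.I * (w.im : ℂ) := by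
      rw [add_assoc, mul_comm Complex.I, Complex.re_add_im]
    have hup := (h₁ w.im w.re w.re him hw hwK hw hwK).1
    have hlow := h₂ w.im w.re him hw hwK
    rw [← e] at hup hlow
    have hl0 : 0 ≤ Real.log |w.im| := Real.log_nonneg him
    have hlle : Real.log (1 + Real.log |w.im|) ≤ Real.log (1 + log⁺ ‖w‖) := by
      apply Real.log_le_log (by linarith)
      rw [posLog_eq_log (by rwa [abs_of_pos hw0])]
      have := Real.log_le_log (by linarith) (Complex.abs_im_le_norm w)
      linarith
    have hzpos : 0 < ‖riemannZeta (1 + w)‖ := lt_of_lt_of_le (by positivity) hlow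
    have hu := Real.log_le_log hzpos hup
    have hd := Real.log_le_log (by positivity) hlow
    rw [Real.log_mul (by positivity) (by positivity)] at hu
    rw [Real.log_div (by positivity) (by positivity), Real.log_pow] at hd
    push_cast at hd
    rw [hz, sub_zero, abs_le]
    have := neg_abs_le (Real.log c)
    have := abs_nonneg (Real.log c)
    constructor <;> linarith
  · push Not at him
    have h1 : (1 + w) ≠ 1 := by simpa using norm_pos_iff.1 hw0
    have h2 := riemannZeta_eq_inv_sub_mul h1
    have hz : riemannZeta (1 + w) ≠ 0 := riemannZeta_ne_zero_of_one_le_re (by simp; linarith)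
    rw [add_sub_cancel_left] at h2
    have hn : riemannZeta₁ (1 + w) ≠ 0 := by
      intro h; rw [h, mul_zero] at h2; exact hz h2
    have h4 := h₃ w hw.le hwK him.le
    have hwle : ‖w‖ ≤ K + 1 := by
      refine (Complex.norm_le_abs_re_add_abs_im w).trans ?_
      rw [abs_of_pos hw]; linarith
    have hpl : log⁺ ‖w‖ ≤ K + 1 := by
      refine max_le (by linarith) ((Real.log_le_sub_one_of_pos hw0).trans (by linarith))
    have e := posLog_sub_posLog_inv (x := ‖w‖)
    rw [h2, norm_mul, norm_inv, Real.log_mul (by positivity) (norm_ne_zero_iff.2 hn), Real.log_inv]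
    rw [abs_le] at h4 ⊢
    have := abs_nonneg (Real.log c)
    constructor <;> linarith

/-- The multiplicative function supported by its values `w p` at the primes dividing `n`. -/
noncomputable def primeWeight (w : ℕ → ℝ) (n : ℕ) : ℝ := ∏ p ∈ n.primeFactors, w p

theorem primeWeight_nonneg {w : ℕ → ℝ} (hw : ∀ p, 0 ≤ w p) (n : ℕ) : 0 ≤ primeWeight w n :=
  Finset.prod_nonneg fun p _ => hw p

theorem primeWeight_one (w : ℕ → ℝ) : primeWeight w 1 = 1 := by simp [primeWeight]

theorem primeWeight_mul {w : ℕ → ℝ} {m n : ℕ} (h : m.Coprime n) :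
    primeWeight w (m * n) = primeWeight w m * primeWeight w n := by
  rw [primeWeight, h.primeFactors_mul, Finset.prod_union h.disjoint_primeFactors]
  rfl

theorem primeWeight_prime_pow {w : ℕ → ℝ} {p n : ℕ} (hp : p.Prime) (hn : n ≠ 0) :
    primeWeight w (p ^ n) = w p := by
  rw [primeWeight, Nat.primeFactors_prime_pow hn hp, Finset.prod_singleton]

theorem hasSum_primeWeight_prime_pow {w : ℕ → ℝ} {p : ℕ} (hp : p.Prime) {τ : ℝ}
    (hτ : 1 < τ) :
    HasSum (fun n : ℕ => primeWeight w (p ^ n) * ((p ^ n : ℕ) : ℝ) ^ (-τ))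
      (1 + w p * ((p : ℝ) ^ (-τ) / (1 - (p : ℝ) ^ (-τ)))) := by
  set q := (p : ℝ) ^ (-τ) with hq
  have hp1 : (1 : ℝ) < p := by exact_mod_cast hp.one_lt
  have hq0 : 0 ≤ q := by positivity
  have hq1 : q < 1 := Real.rpow_lt_one_of_one_lt_of_neg hp1 (by linarith)
  have e : ∀ n : ℕ, ((p ^ n : ℕ) : ℝ) ^ (-τ) = q ^ n := by
    intro n
    push_cast
    rw [hq, ← Real.rpow_natCast, ← Real.rpow_mul (by linarith), ← Real.rpow_natCast,
      ← Real.rpow_mul (by linarith), mul_comm]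
  simp only [e]
  have h2 : HasSum (fun n : ℕ => primeWeight w (p ^ n) * q ^ n)
      (primeWeight w (p ^ 0) * q ^ 0 + w p * q * (1 - q)⁻¹) := by
    have h1 : HasSum (fun n : ℕ => primeWeight w (p ^ (n + 1)) * q ^ (n + 1))
        (w p * q * (1 - q)⁻¹) := by
      have h0 := (hasSum_geometric_of_lt_one hq0 hq1).mul_left (w p * q)
      have e2 : (fun n : ℕ => primeWeight w (p ^ (n + 1)) * q ^ (n + 1)) =
          fun n : ℕ => w p * q * q ^ n := by
        ext n
        rw [primeWeight_prime_pow hp (Nat.succ_ne_zero n)]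
        ring
      rw [e2]
      exact h0
    have := (hasSum_nat_add_iff (f := fun n : ℕ => primeWeight w (p ^ n) * q ^ n) 1).1 h1
    simpa [add_comm] using this
  convert h2 using 1
  simp [primeWeight_one]
  ring

theorem sum_primeWeight_div_le (W : ℝ) (hW : 0 ≤ W) :
    ∃ C : ℝ, 0 < C ∧ ∀ w : ℕ → ℝ, (∀ p, 0 ≤ w p) → (∀ p, w p ≤ W) → ∀ x : ℝ, 2 ≤ x →
      ∑ m ∈ Finset.Icc 1 ⌊x⌋₊, primeWeight w m / m ≤
        C * Real.exp (∑' p : Nat.Primes, w p * (p : ℝ) ^ (-(1 + 1 / Real.log x))) := by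
  refine ⟨Real.exp 1 * Real.exp (2 * W * ∑' n : ℕ, 1 / (n : ℝ) ^ 2), by positivity,
    fun w hw0 hwW x hx => ?_⟩
  have hlog : 0 < Real.log x := Real.log_pos (by linarith)
  set τ := 1 + 1 / Real.log x with hτ
  have hτ1 : 1 < τ := by rw [hτ]; have : 0 < 1 / Real.log x := by positivity
                         linarith
  set N := ⌊x⌋₊ + 1 with hN
  set f : ℕ → ℝ := fun n => primeWeight w n * (n : ℝ) ^ (-τ) with hf
  have hf0 : ∀ n, 0 ≤ f n := fun n => mul_nonneg (primeWeight_nonneg hw0 n) (by positivity)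
  have hfmul : ∀ {m n : ℕ}, m.Coprime n → f (m * n) = f m * f n := by
    intro m n h
    simp only [hf]
    rw [primeWeight_mul h, Nat.cast_mul, Real.mul_rpow (by positivity) (by positivity)]
    ring
  have heul := EulerProduct.summable_and_hasSum_smoothNumbers_prod_primesBelow_tsum (f := f)
    (by simp [hf, primeWeight_one]) hfmul
    (fun {p} hp => by
      have := (hasSum_primeWeight_prime_pow (w := w) hp hτ1).summable
      refine this.congr fun n => ?_
      rw [Real.norm_of_nonneg (hf0 _)]) N
  have hrankin : ∑ m ∈ Finset.Icc 1 ⌊x⌋₊, primeWeight w m / m ≤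
      Real.exp 1 * ∑ m ∈ Finset.Icc 1 ⌊x⌋₊, f m := by
    rw [Finset.mul_sum]
    refine Finset.sum_le_sum fun m hm => ?_
    rw [Finset.mem_Icc] at hm
    have hm1 : (1 : ℝ) ≤ m := by exact_mod_cast hm.1
    have hmx : (m : ℝ) ≤ x := (Nat.le_floor_iff (by linarith)).1 hm.2
    have e : (m : ℝ) ^ (-τ) = (1 / m) * Real.exp (-(Real.log m / Real.log x)) := by
      rw [Real.rpow_def_of_pos (by linarith), hτ,
        show Real.log m * -(1 + 1 / Real.log x) = -Real.log m + -(Real.log m / Real.log x) by ring,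
        Real.exp_add, Real.exp_neg, Real.exp_log (by linarith), one_div]
    have h1 : 1 ≤ Real.exp 1 * Real.exp (-(Real.log m / Real.log x)) := by
      rw [← Real.exp_add]
      apply Real.one_le_exp
      have : Real.log m / Real.log x ≤ 1 := by
        rw [div_le_one hlog]; exact Real.log_le_log (by linarith) hmx
      linarith
    have h2 : 0 ≤ primeWeight w m / m := div_nonneg (primeWeight_nonneg hw0 m) (by linarith)
    simp only [hf, e]
    calc primeWeight w m / m = primeWeight w m / m * 1 := by ring
      _ ≤ primeWeight w m / m * (Real.exp 1 * Real.exp (-(Real.log m / Real.log x))) := by gcongr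
      _ = _ := by ring
  have heuler : ∑ m ∈ Finset.Icc 1 ⌊x⌋₊, f m ≤ ∏ p ∈ N.primesBelow, ∑' n : ℕ, f (p ^ n) := by
    rw [← heul.2.tsum_eq]
    have hmem : ∀ m ∈ Finset.Icc 1 ⌊x⌋₊, m ∈ N.smoothNumbers := by
      intro m hm
      rw [Finset.mem_Icc] at hm
      exact Nat.mem_smoothNumbers_of_lt hm.1 (by omega)
    rw [← Finset.sum_subtype_of_mem f hmem]
    exact heul.2.summable.sum_le_tsum _ (fun i _ => hf0 _)
  have hlocal : ∏ p ∈ N.primesBelow, ∑' n : ℕ, f (p ^ n) ≤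
      ∏ p ∈ N.primesBelow, Real.exp (w p * (p : ℝ) ^ (-τ) + 2 * W * (1 / (p : ℝ) ^ 2)) := by
    refine Finset.prod_le_prod (fun p _ => tsum_nonneg fun n => hf0 _) fun p hp => ?_
    have hpp := Nat.prime_of_mem_primesBelow hp
    rw [(hasSum_primeWeight_prime_pow (w := w) hpp hτ1).tsum_eq]
    have hp2 : (2 : ℝ) ≤ p := by exact_mod_cast hpp.two_le
    have hqle : (p : ℝ) ^ (-τ) ≤ 1 / p := by
      rw [one_div, ← Real.rpow_neg_one]
      exact Real.rpow_le_rpow_of_exponent_le (by linarith) (by linarith)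
    set q := (p : ℝ) ^ (-τ) with hq
    have hq0 : 0 ≤ q := by positivity
    have hq2 : q ≤ 1 / 2 := hqle.trans (one_div_le_one_div_of_le (by norm_num) hp2)
    have h1 : q / (1 - q) ≤ q + 2 * q ^ 2 := by
      rw [div_le_iff₀ (by linarith)]; nlinarith [mul_nonneg hq0 hq0]
    have h2 : q ^ 2 ≤ 1 / (p : ℝ) ^ 2 := by
      rw [← one_div_pow]; gcongr
    refine le_trans ?_ (Real.add_one_le_exp _)
    have h3 : w p * (q / (1 - q)) ≤ w p * (q + 2 * q ^ 2) :=
      mul_le_mul_of_nonneg_left h1 (hw0 p)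
    have h4 : w p * q ^ 2 ≤ W * (1 / (p : ℝ) ^ 2) := mul_le_mul (hwW p) h2 (by positivity) hW
    linarith
  have hsum : Summable fun p : Nat.Primes => w p * (p : ℝ) ^ (-τ) := by
    refine Summable.of_nonneg_of_le (fun p => mul_nonneg (hw0 _) (by positivity))
      (fun p => mul_le_mul_of_nonneg_right (hwW p) (by positivity))
      ((Nat.Primes.summable_rpow.2 (by linarith)).mul_left W)
  have hexp_prod : ∏ p ∈ N.primesBelow,
      Real.exp (w p * (p : ℝ) ^ (-τ) + 2 * W * (1 / (p : ℝ) ^ 2)) ≤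
      Real.exp (2 * W * ∑' n : ℕ, 1 / (n : ℝ) ^ 2) *
        Real.exp (∑' p : Nat.Primes, w p * (p : ℝ) ^ (-τ)) := by
    rw [← Real.exp_sum, ← Real.exp_add, Real.exp_le_exp, Finset.sum_add_distrib, add_comm]
    refine add_le_add ?_ ?_
    · rw [← Finset.mul_sum]
      refine mul_le_mul_of_nonneg_left ?_ (by linarith)
      exact (Real.summable_one_div_nat_pow.2 (by norm_num)).sum_le_tsum _ (fun i _ => by positivity)
    · rw [← Finset.sum_subtype_of_mem (p := Nat.Prime) (fun p : ℕ => w p * (p : ℝ) ^ (-τ))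
        (fun p hp => Nat.prime_of_mem_primesBelow hp)]
      exact Summable.sum_le_tsum (ι := Nat.Primes) _
        (fun i _ => mul_nonneg (hw0 _) (by positivity)) hsum
  calc _ ≤ _ := hrankin
    _ ≤ Real.exp 1 * (Real.exp (2 * W * ∑' n : ℕ, 1 / (n : ℝ) ^ 2) *
        Real.exp (∑' p : Nat.Primes, w p * (p : ℝ) ^ (-τ))) := by
          gcongr
          exact heuler.trans (hlocal.trans hexp_prod)
    _ = _ := by ring

theorem sum_Ioc_sum_divisorsAntidiagonal (X : ℕ) (g : ℕ → ℕ → ℝ) :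
    ∑ n ∈ Finset.Ioc 0 X, ∑ z ∈ n.divisorsAntidiagonal, g z.1 z.2 =
      ∑ m ∈ Finset.Ioc 0 X, ∑ d ∈ Finset.Ioc 0 (X / m), g d m := by
  rw [Finset.sum_sigma', Finset.sum_sigma']
  refine Finset.sum_nbij' (fun a => ⟨a.2.2, a.2.1⟩) (fun b => ⟨b.2 * b.1, (b.2, b.1)⟩)
    ?_ ?_ ?_ ?_ ?_
  · rintro ⟨n, d, m⟩ h
    simp only [Finset.mem_sigma, Finset.mem_Ioc, Nat.mem_divisorsAntidiagonal] at h ⊢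
    obtain ⟨⟨h1, h2⟩, h3, h4⟩ := h
    have hd : 0 < d := Nat.pos_of_ne_zero (by rintro rfl; simp at h3; omega)
    have hm : 0 < m := Nat.pos_of_ne_zero (by rintro rfl; simp at h3; omega)
    refine ⟨⟨hm, ?_⟩, hd, ?_⟩
    · calc m ≤ d * m := Nat.le_mul_of_pos_left m hd
        _ ≤ X := by omega
    · rw [Nat.le_div_iff_mul_le hm]; omega
  · rintro ⟨m, d⟩ h
    simp only [Finset.mem_sigma, Finset.mem_Ioc, Nat.mem_divisorsAntidiagonal] at h ⊢
    obtain ⟨⟨h1, h2⟩, h3, h4⟩ := h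
    rw [Nat.le_div_iff_mul_le h1] at h4
    have : 0 < d * m := Nat.mul_pos h3 h1
    exact ⟨⟨this, h4⟩, trivial, this.ne'⟩
  · rintro ⟨n, d, m⟩ h
    simp only [Finset.mem_sigma, Finset.mem_Ioc, Nat.mem_divisorsAntidiagonal] at h ⊢
    obtain ⟨_, rfl, _⟩ := h
    rfl
  · rintro ⟨m, d⟩ h
    rfl
  · rintro ⟨n, d, m⟩ h
    rfl

theorem primeWeight_prime_mul_le {w : ℕ → ℝ} (hw : ∀ p, 0 ≤ w p) {p m : ℕ} (hp : p.Prime) :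
    primeWeight w (p * m) ≤ w p * primeWeight w m + if p ∣ m then primeWeight w m else 0 := by
  by_cases hm : m = 0
  · subst hm
    have := hw p
    simp [primeWeight]; exact this
  by_cases h : p ∣ m
  · rw [if_pos h]
    have e : (p * m).primeFactors = m.primeFactors := by
      rw [Nat.primeFactors_mul hp.ne_zero hm, hp.primeFactors, Finset.union_eq_right,
        Finset.singleton_subset_iff, Nat.mem_primeFactors]
      exact ⟨hp, h, hm⟩
    have h2 : primeWeight w (p * m) = primeWeight w m := by rw [primeWeight, e]; rfl
    rw [h2]
    have := mul_nonneg (hw p) (primeWeight_nonneg hw m)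
    linarith
  · rw [if_neg h, primeWeight_mul ((Nat.Prime.coprime_iff_not_dvd hp).2 h)]
    have := primeWeight_prime_pow (w := w) hp one_ne_zero
    rw [pow_one] at this
    rw [this]; simp

/-- The restriction of `primeWeight w` to the integers with a prime factor at most `Y`. -/
noncomputable def smallPrimeWeight (w : ℕ → ℝ) (Y n : ℕ) : ℝ :=
  if ∃ p : ℕ, p.Prime ∧ p ∣ n ∧ p ≤ Y then primeWeight w n else 0

theorem smallPrimeWeight_nonneg {w : ℕ → ℝ} (hw : ∀ p, 0 ≤ w p) (Y n : ℕ) :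
    0 ≤ smallPrimeWeight w Y n := by
  rw [smallPrimeWeight]; split_ifs
  · exact primeWeight_nonneg hw n
  · exact le_rfl

theorem smallPrimeWeight_prime_pow_mul_le {w : ℕ → ℝ} {W J : ℝ} {Y : ℕ} (hw : ∀ p, 0 ≤ w p)
    (hW : ∀ p, w p ≤ W) (hJ0 : 0 ≤ J) (hJ : ∀ p ≤ Y, p.Prime → w p ≤ J) {p j m : ℕ}
    (hp : p.Prime) (hj : j ≠ 0) (hm : m ≠ 0) :
    smallPrimeWeight w Y (p ^ j * m) ≤ (1 + W) * smallPrimeWeight w Y m + J * primeWeight w m := by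
  have h0 := primeWeight_nonneg hw m
  have hW0 : 0 ≤ W := (hw 0).trans (hW 0)
  have hF := smallPrimeWeight_nonneg hw Y m
  have hrhs : 0 ≤ (1 + W) * smallPrimeWeight w Y m + J * primeWeight w m := by positivity
  have hval : primeWeight w (p ^ j * m) ≤ w p * primeWeight w m +
      if p ∣ m then primeWeight w m else 0 := by
    have e : primeWeight w (p ^ j * m) = primeWeight w (p * m) := by
      rw [primeWeight, primeWeight, Nat.primeFactors_mul (pow_ne_zero _ hp.ne_zero) hm,
        Nat.primeFactors_mul hp.ne_zero hm, Nat.primeFactors_prime_pow hj hp, hp.primeFactors]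
    rw [e]; exact primeWeight_prime_mul_le hw hp
  by_cases hms : ∃ q : ℕ, q.Prime ∧ q ∣ m ∧ q ≤ Y
  · have e1 : smallPrimeWeight w Y m = primeWeight w m := if_pos hms
    have e2 : smallPrimeWeight w Y (p ^ j * m) ≤ primeWeight w (p ^ j * m) := by
      rw [smallPrimeWeight]; split_ifs
      · exact le_rfl
      · exact primeWeight_nonneg hw _
    rw [e1]
    have h3 : w p * primeWeight w m ≤ W * primeWeight w m := mul_le_mul_of_nonneg_right (hW p) h0
    have h4 : (if p ∣ m then primeWeight w m else 0) ≤ primeWeight w m := by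
      split_ifs
      · exact le_rfl
      · exact h0
    have h5 : 0 ≤ J * primeWeight w m := by positivity
    linarith
  · by_cases hn : ∃ q : ℕ, q.Prime ∧ q ∣ p ^ j * m ∧ q ≤ Y
    · obtain ⟨q, hq, hqd, hqY⟩ := hn
      have hqp : q = p := by
        rcases (Nat.Prime.dvd_mul hq).1 hqd with h | h
        · exact (Nat.prime_dvd_prime_iff_eq hq hp).1 (hq.dvd_of_dvd_pow h)
        · exact absurd ⟨q, hq, h, hqY⟩ hms
      subst hqp
      have hnd : ¬ q ∣ m := fun h => hms ⟨q, hq, h, hqY⟩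
      rw [if_neg hnd, add_zero] at hval
      have e2 : smallPrimeWeight w Y (q ^ j * m) = primeWeight w (q ^ j * m) :=
        if_pos ⟨q, hq, hqd, hqY⟩
      rw [e2]
      have h3 : w q * primeWeight w m ≤ J * primeWeight w m :=
        mul_le_mul_of_nonneg_right (hJ q hqY hq) h0
      have h5 : 0 ≤ (1 + W) * smallPrimeWeight w Y m := by positivity
      linarith
    · have e2 : smallPrimeWeight w Y (p ^ j * m) = 0 := if_neg hn
      rw [e2]; exact hrhs

theorem sum_primeWeight_div_dvd_le {w : ℕ → ℝ} (hw : ∀ p, 0 ≤ w p) (X : ℕ) {p : ℕ}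
    (hp : p.Prime) :
    ∑ m ∈ (Finset.Ioc 0 X).filter (fun m => p ∣ m), primeWeight w m / m ≤
      2 * (w p / p) * ∑ m ∈ Finset.Ioc 0 X, primeWeight w m / m := by
  set S := ∑ m ∈ (Finset.Ioc 0 X).filter (fun m => p ∣ m), primeWeight w m / m with hS
  set H := ∑ m ∈ Finset.Ioc 0 X, primeWeight w m / m with hH
  have hp2 : (2 : ℝ) ≤ p := by exact_mod_cast hp.two_le
  have hnn : ∀ m : ℕ, 0 ≤ primeWeight w m / m := fun m =>
    div_nonneg (primeWeight_nonneg hw m) (by positivity)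
  have h1 : S ≤ ∑ m ∈ Finset.Ioc 0 X, primeWeight w (p * m) / ((p : ℝ) * m) := by
    have e : S = ∑ m ∈ Finset.Ioc 0 (X / p), primeWeight w (p * m) / ((p : ℝ) * m) := by
      refine Finset.sum_nbij' (fun m => m / p) (fun m => p * m) ?_ ?_ ?_ ?_ ?_
      · intro m hm
        simp only [Finset.mem_filter, Finset.mem_Ioc] at hm ⊢
        exact ⟨Nat.div_pos (Nat.le_of_dvd hm.1.1 hm.2) hp.pos, Nat.div_le_div_right hm.1.2⟩
      · intro m hm
        simp only [Finset.mem_filter, Finset.mem_Ioc] at hm ⊢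
        refine ⟨⟨Nat.mul_pos hp.pos hm.1, ?_⟩, dvd_mul_right p m⟩
        have := (Nat.le_div_iff_mul_le hp.pos).1 hm.2
        rwa [mul_comm]
      · intro m hm
        simp only [Finset.mem_filter] at hm
        exact Nat.mul_div_cancel' hm.2
      · intro m hm
        exact Nat.mul_div_cancel_left m hp.pos
      · intro m hm
        simp only [Finset.mem_filter] at hm
        rw [Nat.mul_div_cancel' hm.2, ← Nat.cast_mul, Nat.mul_div_cancel' hm.2]
    rw [e]
    refine Finset.sum_le_sum_of_subset_of_nonneg ?_ fun m _ _ =>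
      div_nonneg (primeWeight_nonneg hw _) (by positivity)
    exact Finset.Ioc_subset_Ioc_right (Nat.div_le_self X p)
  have h2 : ∑ m ∈ Finset.Ioc 0 X, primeWeight w (p * m) / ((p : ℝ) * m) ≤
      (w p / p) * H + (1 / p) * S := by
    rw [hS, hH, Finset.sum_filter, Finset.mul_sum, Finset.mul_sum, ← Finset.sum_add_distrib]
    refine Finset.sum_le_sum fun m hm => ?_
    have hm0 : (0 : ℝ) < m := by exact_mod_cast (Finset.mem_Ioc.1 hm).1
    have := primeWeight_prime_mul_le hw (m := m) hp
    calc primeWeight w (p * m) / ((p : ℝ) * m)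
        ≤ (w p * primeWeight w m + if p ∣ m then primeWeight w m else 0) / ((p : ℝ) * m) := by
            gcongr
      _ = _ := by
        split_ifs
        · field_simp
        · field_simp
          ring
  have hS0 : 0 ≤ S := Finset.sum_nonneg fun m _ => hnn m
  have h3 : (1 / (p : ℝ)) * S ≤ 1 / 2 * S := by
    gcongr
  linarith

theorem sum_smallPrimeWeight_le (W : ℝ) (hW0 : 0 ≤ W) :
    ∃ C : ℝ, 0 < C ∧ ∀ w : ℕ → ℝ, (∀ p, 0 ≤ w p) → (∀ p, w p ≤ W) → ∀ (Y : ℕ) (J : ℝ), 0 ≤ J →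
      (∀ p ≤ Y, p.Prime → w p ≤ J) → ∀ x : ℝ, 2 ≤ x →
      ∑ n ∈ Finset.Icc 1 ⌊x⌋₊, smallPrimeWeight w Y n ≤
        C * (x / Real.log x) * (J + ∑ p ∈ (Finset.Icc 1 Y).filter Nat.Prime, w p / p) *
          ∑ m ∈ Finset.Icc 1 ⌊x⌋₊, primeWeight w m / m := by
  set c := Real.log 4 + 4 with hc
  have hc0 : 0 < c := by
    have : 0 < Real.log 4 := Real.log_pos (by norm_num)
    linarith
  refine ⟨2 * (c * (1 + W) + 1) + c, by positivity, fun w hw hW Y J hJ0 hJ x hx => ?_⟩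
  set X := ⌊x⌋₊ with hX
  have hIcc : Finset.Icc 1 X = Finset.Ioc 0 X := by ext; simp [Nat.succ_le_iff]
  rw [hIcc]
  have hlog : 0 < Real.log x := Real.log_pos (by linarith)
  set F := smallPrimeWeight w Y with hF
  set h := primeWeight w with hh
  have hF0 : ∀ n, 0 ≤ F n := smallPrimeWeight_nonneg hw Y
  have hh0 : ∀ n, 0 ≤ h n := primeWeight_nonneg hw
  set H := ∑ m ∈ Finset.Ioc 0 X, h m / m with hH
  have hH0 : 0 ≤ H := Finset.sum_nonneg fun m _ => div_nonneg (hh0 m) (by positivity)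
  set P := ∑ p ∈ (Finset.Icc 1 Y).filter Nat.Prime, w p / p with hP
  have hP0 : 0 ≤ P := Finset.sum_nonneg fun m _ => div_nonneg (hw m) (by positivity)
  have hG : ∑ m ∈ Finset.Ioc 0 X, F m / m ≤ 2 * P * H := by
    have h1 : ∀ m ∈ Finset.Ioc 0 X, F m / m ≤
        ∑ p ∈ (Finset.Icc 1 Y).filter Nat.Prime, if p ∣ m then h m / m else 0 := by
      intro m hm
      have hnn : 0 ≤ h m / m := div_nonneg (hh0 m) (by positivity)
      by_cases hs : ∃ q : ℕ, q.Prime ∧ q ∣ m ∧ q ≤ Y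
      · have e : F m = h m := if_pos hs
        obtain ⟨q, hq, hqm, hqY⟩ := hs
        rw [e]
        have := Finset.single_le_sum (s := (Finset.Icc 1 Y).filter Nat.Prime)
          (f := fun p => if p ∣ m then h m / m else 0) (fun p _ => by split_ifs <;> simp [hnn])
          (a := q) (by simp [hq, hqY, hq.one_le])
        simpa [hqm] using this
      · have e : F m = 0 := if_neg hs
        rw [e, zero_div]
        exact Finset.sum_nonneg fun p _ => by split_ifs <;> simp [hnn]
    refine (Finset.sum_le_sum h1).trans ?_
    have e : 2 * P * H = ∑ p ∈ (Finset.Icc 1 Y).filter Nat.Prime, 2 * (w p / p) * H := by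
      rw [← Finset.sum_mul, ← Finset.mul_sum]
    rw [Finset.sum_comm, e]
    refine Finset.sum_le_sum fun p hp => ?_
    rw [← Finset.sum_filter]
    exact sum_primeWeight_div_dvd_le hw X (Finset.mem_filter.1 hp).2
  have hlogsum : ∑ n ∈ Finset.Ioc 0 X, F n * Real.log n ≤
      c * x * ((1 + W) * ∑ m ∈ Finset.Ioc 0 X, F m / m + J * H) := by
    have e1 : ∀ n ∈ Finset.Ioc 0 X, F n * Real.log n =
        ∑ z ∈ n.divisorsAntidiagonal, ArithmeticFunction.vonMangoldt z.1 * F (z.1 * z.2) := by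
      intro n _
      rw [← ArithmeticFunction.vonMangoldt_sum, Finset.mul_sum, ← Nat.map_div_right_divisors,
        Finset.sum_map]
      refine Finset.sum_congr rfl fun d hd => ?_
      change _ = ArithmeticFunction.vonMangoldt d * F (d * (n / d))
      rw [Nat.mul_div_cancel' (Nat.dvd_of_mem_divisors hd), mul_comm]
    rw [Finset.sum_congr rfl e1, sum_Ioc_sum_divisorsAntidiagonal X
      (fun d m => ArithmeticFunction.vonMangoldt d * F (d * m)), hH, Finset.mul_sum, Finset.mul_sum,
      ← Finset.sum_add_distrib, Finset.mul_sum]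
    refine Finset.sum_le_sum fun m hm => ?_
    have hm0 : 0 < m := (Finset.mem_Ioc.1 hm).1
    have hmR : (0 : ℝ) < m := by exact_mod_cast hm0
    have h2 : ∀ d ∈ Finset.Ioc 0 (X / m), ArithmeticFunction.vonMangoldt d * F (d * m) ≤
        ArithmeticFunction.vonMangoldt d * ((1 + W) * F m + J * h m) := by
      intro d _
      by_cases hd : IsPrimePow d
      · obtain ⟨p, j, hp, hj, rfl⟩ := (isPrimePow_nat_iff d).1 hd
        refine mul_le_mul_of_nonneg_left ?_ ArithmeticFunction.vonMangoldt_nonneg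
        exact smallPrimeWeight_prime_pow_mul_le hw hW hJ0 hJ hp hj.ne' hm0.ne'
      · rw [ArithmeticFunction.vonMangoldt_eq_zero_iff.2 hd]; simp
    refine (Finset.sum_le_sum h2).trans ?_
    rw [← Finset.sum_mul]
    have h3 : ∑ d ∈ Finset.Ioc 0 (X / m), ArithmeticFunction.vonMangoldt d ≤ c * (x / m) := by
      have := Chebyshev.psi_le_const_mul_self (x := x / m) (by positivity)
      rw [Chebyshev.psi, Nat.floor_div_natCast] at this
      exact this
    have h4 : 0 ≤ (1 + W) * F m + J * h m := by
      have := hF0 m; have := hh0 m; positivity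
    refine (mul_le_mul_of_nonneg_right h3 h4).trans (le_of_eq ?_)
    field_simp
  have hmain : Real.log x * ∑ n ∈ Finset.Ioc 0 X, F n ≤
      ∑ n ∈ Finset.Ioc 0 X, F n * Real.log n + x * ∑ n ∈ Finset.Ioc 0 X, F n / n := by
    rw [Finset.mul_sum, Finset.mul_sum, ← Finset.sum_add_distrib]
    refine Finset.sum_le_sum fun n hn => ?_
    have hn0 : (0 : ℝ) < n := by exact_mod_cast (Finset.mem_Ioc.1 hn).1
    have h1 : Real.log x ≤ Real.log n + x / n := by
      have h2 := Real.log_le_sub_one_of_pos (x := x / n) (by positivity)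
      rw [Real.log_div (by linarith) hn0.ne'] at h2
      linarith
    calc Real.log x * F n ≤ (Real.log n + x / n) * F n := mul_le_mul_of_nonneg_right h1 (hF0 n)
      _ = _ := by ring
  have hx0 : 0 < x := by linarith
  have hfin : Real.log x * ∑ n ∈ Finset.Ioc 0 X, F n ≤
      (2 * (c * (1 + W) + 1) + c) * x * (J + P) * H := by
    have h1 : (c * x * (1 + W) + x) * ∑ m ∈ Finset.Ioc 0 X, F m / m ≤
        (c * x * (1 + W) + x) * (2 * P * H) := mul_le_mul_of_nonneg_left hG (by positivity)
    have h2 : 0 ≤ 2 * (c * (1 + W) + 1) * x * J * H := by positivity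
    have h3 : 0 ≤ c * x * P * H := by positivity
    linarith
  rw [show (2 * (c * (1 + W) + 1) + c) * (x / Real.log x) * (J + P) * H =
    (2 * (c * (1 + W) + 1) + c) * x * (J + P) * H / Real.log x by ring, le_div_iff₀ hlog]
  linarith

theorem summable_prime_cpow {s : ℂ} (hs : 1 < s.re) :
    Summable fun p : Nat.Primes => (p : ℂ) ^ (-s) := by
  rw [← summable_norm_iff]
  have h := Nat.Primes.summable_rpow.2 (show -s.re < -1 by linarith)
  refine h.congr fun p => ?_
  rw [← Complex.ofReal_natCast, Complex.norm_cpow_eq_rpow_re_of_pos (by exact_mod_cast p.2.pos)]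
  simp

theorem abs_re_tsum_prime_cpow_sub_le : ∃ C : ℝ, 0 ≤ C ∧ ∀ s : ℂ, 1 < s.re →
    |(∑' p : Nat.Primes, (p : ℂ) ^ (-s)).re - Real.log ‖riemannZeta s‖| ≤ C := by
  have h2 : Summable fun p : Nat.Primes => (p : ℝ) ^ (-2 : ℝ) :=
    Nat.Primes.summable_rpow.2 (by norm_num)
  refine ⟨∑' p : Nat.Primes, (p : ℝ) ^ (-2 : ℝ), tsum_nonneg fun p => by positivity,
    fun s hs => ?_⟩
  have hsum := summable_prime_cpow hs
  have hlog : Summable fun p : Nat.Primes => -Complex.log (1 - (p : ℂ) ^ (-s)) := by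
    have := DirichletCharacter.summable_neg_log_one_sub_mul_prime_cpow
        (1 : DirichletCharacter ℂ 1) hs
    refine this.congr fun p => ?_
    rw [MulChar.one_apply (isUnit_of_subsingleton _), one_mul]
  have hbound : ∀ p : Nat.Primes,
      ‖(p : ℂ) ^ (-s) - -Complex.log (1 - (p : ℂ) ^ (-s))‖ ≤ (p : ℝ) ^ (-2 : ℝ) := by
    intro p
    have hp2 : (2 : ℝ) ≤ p := by exact_mod_cast p.2.two_le
    set z := (p : ℂ) ^ (-s) with hz
    have hzn : ‖z‖ ≤ (p : ℝ)⁻¹ := by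
      rw [hz, ← Complex.ofReal_natCast,
        Complex.norm_cpow_eq_rpow_re_of_pos (by exact_mod_cast p.2.pos), ← Real.rpow_neg_one]
      exact Real.rpow_le_rpow_of_exponent_le (by linarith) (by simp; linarith)
    have hp' : (p : ℝ)⁻¹ ≤ 1 / 2 := by
      rw [← one_div]; exact one_div_le_one_div_of_le (by norm_num) hp2
    have h1 : ‖-z‖ < 1 := by rw [norm_neg]; linarith
    have := Complex.norm_log_one_add_sub_self_le h1
    rw [norm_neg] at this
    have e : z - -Complex.log (1 - z) = Complex.log (1 + -z) - -z := by
      rw [← sub_eq_add_neg]; ring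
    rw [e]
    refine this.trans ?_
    have h3 : (1 - ‖z‖)⁻¹ ≤ 2 := by
      rw [← inv_inv (2 : ℝ)]
      exact inv_anti₀ (by norm_num) (by norm_num; linarith)
    have h4 : (p : ℝ) ^ (-2 : ℝ) = (p : ℝ)⁻¹ ^ 2 := by
      rw [Real.rpow_neg (by positivity), inv_pow]; norm_num
    rw [h4]
    have h5 : ‖z‖ ^ 2 ≤ (p : ℝ)⁻¹ ^ 2 := by gcongr
    have h6 : ‖z‖ ^ 2 * (1 - ‖z‖)⁻¹ ≤ (p : ℝ)⁻¹ ^ 2 * 2 := by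
      apply mul_le_mul h5 h3 _ (by positivity)
      rw [inv_nonneg]; linarith
    linarith
  have he := riemannZeta_eulerProduct_exp_log hs
  rw [← he, Complex.norm_exp, Real.log_exp, ← Complex.sub_re, ← hsum.tsum_sub hlog]
  refine (Complex.abs_re_le_norm _).trans ?_
  exact tsum_of_norm_bounded h2.hasSum hbound

theorem log_one_add_le_mul_add {ε : ℝ} (hε : 0 < ε) :
    ∃ C : ℝ, 0 ≤ C ∧ ∀ t : ℝ, 0 ≤ t → Real.log (1 + t) ≤ ε * t + C := by
  refine ⟨ε + |Real.log ε|, by positivity, fun t ht => ?_⟩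
  have h := Real.log_le_sub_one_of_pos (x := ε * (1 + t)) (by positivity)
  rw [Real.log_mul hε.ne' (by positivity)] at h
  have := neg_abs_le (Real.log ε)
  linarith

open Real in
theorem abs_re_tsum_prime_cpow_sub_posLog_le (K : ℝ) (hK : 0 < K) {ε : ℝ} (hε : 0 < ε) :
    ∃ C : ℝ, 0 ≤ C ∧ ∀ w : ℂ, 0 < w.re → w.re ≤ K →
      |(∑' p : Nat.Primes, (p : ℂ) ^ (-(1 + w))).re - log⁺ (‖w‖⁻¹)| ≤ ε * log⁺ ‖w‖ + C := by
  obtain ⟨C1, h1, H1⟩ := abs_re_tsum_prime_cpow_sub_le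
  obtain ⟨C2, h2, H2⟩ := abs_log_norm_riemannZeta_sub_le K hK
  obtain ⟨C3, h3, H3⟩ := log_one_add_le_mul_add (show 0 < ε / 7 by positivity)
  refine ⟨C1 + C2 + 7 * C3, by positivity, fun w hw hwK => ?_⟩
  have a := H1 (1 + w) (by simpa using hw)
  have b := H2 w hw hwK
  have c := H3 (log⁺ ‖w‖) posLog_nonneg
  have d := abs_sub_le (∑' p : Nat.Primes, (p : ℂ) ^ (-(1 + w))).re
    (Real.log ‖riemannZeta (1 + w)‖) (log⁺ (‖w‖⁻¹))
  linarith

/-- The exponents `(i, j, i', j')` occurring in the expansion of `|1 - u|² |1 - v|^{2m}`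
in the monomials `u^i ū^j v^{i'} v̄^{j'}`. -/
def momentExponents (m : ℕ) : Finset (ℕ × ℕ × ℕ × ℕ) :=
  Finset.range 2 ×ˢ Finset.range 2 ×ˢ Finset.range (m + 1) ×ˢ Finset.range (m + 1)

/-- The coefficients in the expansion of `|1 - u|² |1 - v|^{2m}`. -/
def momentCoeff (m : ℕ) (h : ℕ × ℕ × ℕ × ℕ) : ℝ :=
  (-1) ^ (h.1 + h.2.1 + h.2.2.1 + h.2.2.2) * (m.choose h.2.2.1 * m.choose h.2.2.2)

theorem sum_momentExponents {M : Type*} [AddCommMonoid M] (m : ℕ) (F : ℕ × ℕ × ℕ × ℕ → M) :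
    ∑ h ∈ momentExponents m, F h = ∑ i ∈ Finset.range (m + 1), ∑ j ∈ Finset.range (m + 1),
      (F (0, 0, i, j) + F (0, 1, i, j) + F (1, 0, i, j) + F (1, 1, i, j)) := by
  simp only [momentExponents, Finset.sum_product, Finset.sum_range_succ _ 1, Finset.sum_range_one,
    show Finset.range 2 = Finset.range (1 + 1) from rfl, Finset.sum_add_distrib, add_assoc]

open scoped ComplexConjugate in
theorem norm_one_sub_sq_mul_norm_one_sub_pow (m : ℕ) (u v : ℂ) :
    ((‖1 - u‖ ^ 2 * ‖1 - v‖ ^ (2 * m) : ℝ) : ℂ) = ∑ h ∈ momentExponents m, momentCoeff m h *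
      (u ^ h.1 * conj u ^ h.2.1 * (v ^ h.2.2.1 * conj v ^ h.2.2.2)) := by
  have hv : ∀ z : ℂ, (1 - z) ^ m = ∑ i ∈ Finset.range (m + 1), (-1) ^ i * z ^ i * m.choose i := by
    intro z
    rw [sub_eq_neg_add, add_pow]
    refine Finset.sum_congr rfl fun i _ => ?_
    rw [neg_pow]; simp
  have e1 : ((‖1 - u‖ ^ 2 : ℝ) : ℂ) = (1 - u) * (1 - conj u) := by
    rw [Complex.sq_norm, ← Complex.mul_conj]; simp
  have e2 : ((‖1 - v‖ ^ (2 * m) : ℝ) : ℂ) = (1 - v) ^ m * (1 - conj v) ^ m := by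
    rw [pow_mul, Complex.sq_norm, Complex.ofReal_pow, ← Complex.mul_conj, mul_pow]; simp
  rw [Complex.ofReal_mul, e1, e2, hv, hv, sum_momentExponents, Finset.sum_mul_sum, Finset.mul_sum]
  refine Finset.sum_congr rfl fun i _ => ?_
  rw [Finset.mul_sum]
  refine Finset.sum_congr rfl fun j _ => ?_
  simp only [momentCoeff]
  push_cast
  ring

theorem sum_momentCoeff (m : ℕ) : ∑ h ∈ momentExponents m, momentCoeff m h = 0 := by
  have := norm_one_sub_sq_mul_norm_one_sub_pow m 1 1
  simp only [sub_self, norm_zero, map_one, one_pow, mul_one, ne_eq, OfNat.ofNat_ne_zero,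
    not_false_eq_true, zero_pow, zero_mul] at this
  exact_mod_cast this.symm

theorem sum_choose_mul_choose_succ (m : ℕ) :
    ∑ i ∈ Finset.range (m + 1), m.choose i * m.choose (i + 1) = (2 * m).choose (m + 1) := by
  rw [two_mul, Nat.add_choose_eq, Finset.Nat.sum_antidiagonal_eq_sum_range_succ
    (fun i j => m.choose i * m.choose j), Finset.sum_range_succ' _ (m + 1), Nat.sub_zero,
    Nat.choose_succ_self, mul_zero, add_zero]
  refine Finset.sum_congr rfl fun i hi => ?_
  have : i ≤ m := by simpa [Nat.lt_succ_iff] using hi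
  rw [Nat.succ_sub_succ, Nat.choose_symm this, mul_comm]

theorem sum_choose_mul_choose (m : ℕ) :
    ∑ i ∈ Finset.range (m + 1), m.choose i * m.choose i = (2 * m).choose m := by
  rw [← Nat.sum_range_choose_sq]
  simp [sq]

/-- The exponents whose four terms pair off. -/
def IsDiagonal (h : ℕ × ℕ × ℕ × ℕ) : Prop := h.1 = h.2.1 ∧ h.2.2.1 = h.2.2.2

/-- The exponents for which the imaginary part is that of a difference of the two frequencies. -/
def IsResonant (h : ℕ × ℕ × ℕ × ℕ) : Prop :=
  (h.1 = h.2.1 + 1 ∧ h.2.2.2 = h.2.2.1 + 1) ∨ (h.2.1 = h.1 + 1 ∧ h.2.2.1 = h.2.2.2 + 1)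

theorem sum_momentCoeff_diagonal (m : ℕ) :
    ∑ h ∈ momentExponents m, (if IsDiagonal h then momentCoeff m h else 0) =
      2 * (2 * m).choose m := by
  rw [sum_momentExponents, ← sum_choose_mul_choose, Nat.cast_sum, Finset.mul_sum]
  refine Finset.sum_congr rfl fun i hi => ?_
  rw [Finset.sum_eq_single_of_mem i hi]
  · simp [IsDiagonal, momentCoeff, ← two_mul, add_assoc]
    simp only [pow_mul, pow_add]
    norm_num
    ring
  · intro j _ hj
    simp [IsDiagonal, hj.symm]

theorem sum_momentCoeff_resonant (m : ℕ) :
    ∑ h ∈ momentExponents m, (if IsResonant h then momentCoeff m h else 0) =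
      2 * (2 * m).choose (m + 1) := by
  have h1 : ∀ i ∈ Finset.range (m + 1), ∑ j ∈ Finset.range (m + 1),
      (if j = i + 1 then (m.choose i * m.choose j : ℝ) else 0) = m.choose i * m.choose (i + 1) := by
    intro i hi
    rw [Finset.sum_ite_eq']
    split_ifs with h
    · rfl
    · have : i = m := by simp at h hi; omega
      simp [this]
  have h2 : ∑ i ∈ Finset.range (m + 1), ∑ j ∈ Finset.range (m + 1),
      (if j = i + 1 then (m.choose i * m.choose j : ℝ) else 0) = (2 * m).choose (m + 1) := by
    rw [Finset.sum_congr rfl h1, ← sum_choose_mul_choose_succ]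
    push_cast
    rfl
  have h3 : ∑ i ∈ Finset.range (m + 1), ∑ j ∈ Finset.range (m + 1),
      (if i = j + 1 then (m.choose i * m.choose j : ℝ) else 0) = (2 * m).choose (m + 1) := by
    rw [Finset.sum_comm, ← h2]
    simp only [mul_comm]
  rw [sum_momentExponents, two_mul, ← h2]
  nth_rw 2 [h2]
  rw [← h3, ← Finset.sum_add_distrib]
  refine Finset.sum_congr rfl fun i _ => ?_
  rw [← Finset.sum_add_distrib]
  refine Finset.sum_congr rfl fun j _ => ?_
  simp only [IsResonant, momentCoeff, zero_add]
  by_cases h4 : j = i + 1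
  · subst h4
    have h6 : ¬i = i + 1 + 1 := by omega
    simp [h6, ← two_mul, pow_add, ← mul_pow]
  · by_cases h5 : i = j + 1
    · subst h5
      simp [h4, ← two_mul, pow_add, ← mul_pow]
    · simp [h4, h5]

theorem two_mul_choose_add_two_mul_choose (m : ℕ) :
    2 * (2 * m).choose m + 2 * (2 * m).choose (m + 1) = (2 * (m + 1)).choose (m + 1) := by
  rw [show 2 * (m + 1) = 2 * m + 1 + 1 by ring, Nat.choose_succ_succ',
    ← Nat.choose_symm_half m, Nat.choose_succ_succ']
  have := Nat.choose_symm_half m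
  ring

section

open scoped ComplexConjugate

/-- The weight `|1 - p^{-s}|² |1 - p^{-s'}|^{2m}`. -/
noncomputable def eulerWeight (m : ℕ) (s s' : ℂ) (p : ℕ) : ℝ :=
  ‖1 - (p : ℂ) ^ (-s)‖ ^ 2 * ‖1 - (p : ℂ) ^ (-s')‖ ^ (2 * m)

theorem eulerWeight_nonneg (m : ℕ) (s s' : ℂ) (p : ℕ) : 0 ≤ eulerWeight m s s' p := by
  unfold eulerWeight; positivity

theorem norm_natCast_cpow_neg_le_one {s : ℂ} (hs : 0 < s.re) (p : ℕ) : ‖(p : ℂ) ^ (-s)‖ ≤ 1 := by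
  rcases Nat.eq_zero_or_pos p with rfl | hp
  · have : s ≠ 0 := by rintro rfl; simp at hs
    simp [Complex.zero_cpow (neg_ne_zero.2 this)]
  · rw [Complex.norm_natCast_cpow_of_pos hp]
    exact Real.rpow_le_one_of_one_le_of_nonpos (by exact_mod_cast hp) (by simpa using hs.le)

theorem eulerWeight_le (m : ℕ) {s s' : ℂ} (hs : 0 < s.re) (hs' : 0 < s'.re) (p : ℕ) :
    eulerWeight m s s' p ≤ 4 * 4 ^ m := by
  have h : ∀ {s : ℂ}, 0 < s.re → ‖1 - (p : ℂ) ^ (-s)‖ ≤ 2 := fun {s} hs => by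
    have := norm_sub_le 1 ((p : ℂ) ^ (-s))
    have := norm_natCast_cpow_neg_le_one hs p
    simp only [norm_one] at *
    linarith
  unfold eulerWeight
  calc _ ≤ (2 : ℝ) ^ 2 * 2 ^ (2 * m) := by
        have := h hs
        have := h hs'
        gcongr
    _ = _ := by rw [pow_mul]; norm_num

/-- The exponent of `p` in the monomial `u^i ū^j v^{i'} v̄^{j'}`, where `u = p^{-s}`, `v =
p^{-s'}`. -/
noncomputable def momentShift (s s' : ℂ) (h : ℕ × ℕ × ℕ × ℕ) : ℂ :=
  h.1 * s + h.2.1 * conj s + (h.2.2.1 * s' + h.2.2.2 * conj s')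

theorem eulerWeight_eq (m : ℕ) (s s' : ℂ) {p : ℕ} (hp : p ≠ 0) :
    (eulerWeight m s s' p : ℂ) =
      ∑ h ∈ momentExponents m, momentCoeff m h * (p : ℂ) ^ (-momentShift s s' h) := by
  have hp' : (p : ℂ) ≠ 0 := by exact_mod_cast hp
  have hc : ∀ z : ℂ, conj ((p : ℂ) ^ (-z)) = (p : ℂ) ^ (-conj z) := by
    intro z
    rw [← map_neg, Complex.cpow_conj _ _ (by rw [Complex.natCast_arg]; exact Real.pi_pos.ne)]
    simp
  rw [eulerWeight, norm_one_sub_sq_mul_norm_one_sub_pow]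
  refine Finset.sum_congr rfl fun h _ => ?_
  rw [hc, hc, ← Complex.cpow_nat_mul, ← Complex.cpow_nat_mul, ← Complex.cpow_nat_mul,
    ← Complex.cpow_nat_mul, ← Complex.cpow_add _ _ hp', ← Complex.cpow_add _ _ hp',
    ← Complex.cpow_add _ _ hp', momentShift]
  ring_nf

theorem re_momentShift_nonneg {s s' : ℂ} (hs : 0 < s.re) (hs' : 0 < s'.re)
    (h : ℕ × ℕ × ℕ × ℕ) : 0 ≤ (momentShift s s' h).re := by
  simp [momentShift]; positivity

theorem tsum_eulerWeight (m : ℕ) {s s' : ℂ} (hs : 0 < s.re) (hs' : 0 < s'.re) {σ : ℝ} (hσ : 0 < σ) :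
    ∑' p : Nat.Primes, eulerWeight m s s' p * (p : ℝ) ^ (-(1 + σ)) =
      ∑ h ∈ momentExponents m, momentCoeff m h *
        (∑' p : Nat.Primes, (p : ℂ) ^ (-(1 + (σ + momentShift s s' h)))).re := by
  have hsum : ∀ h, Summable fun p : Nat.Primes =>
      (p : ℂ) ^ (-(1 + (σ + momentShift s s' h))) := fun h =>
    summable_prime_cpow (by have := re_momentShift_nonneg hs hs' h; simp; linarith)
  have e : ∀ p : Nat.Primes, ((eulerWeight m s s' p * (p : ℝ) ^ (-(1 + σ)) : ℝ) : ℂ) =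
      ∑ h ∈ momentExponents m, momentCoeff m h *
        (p : ℂ) ^ (-(1 + (σ + momentShift s s' h))) := by
    intro p
    have hp' : (p : ℂ) ≠ 0 := by exact_mod_cast p.2.ne_zero
    rw [Complex.ofReal_mul, eulerWeight_eq _ _ _ p.2.ne_zero, Finset.sum_mul]
    refine Finset.sum_congr rfl fun h _ => ?_
    rw [Complex.ofReal_cpow (by positivity), mul_assoc, Complex.ofReal_natCast,
      ← Complex.cpow_add _ _ hp']
    congr 2
    push_cast
    ring
  have e2 : ((∑' p : Nat.Primes, eulerWeight m s s' p * (p : ℝ) ^ (-(1 + σ)) : ℝ) : ℂ) =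
      ∑ h ∈ momentExponents m, momentCoeff m h *
        ∑' p : Nat.Primes, (p : ℂ) ^ (-(1 + (σ + momentShift s s' h))) := by
    rw [Complex.ofReal_tsum, tsum_congr e, Summable.tsum_finsetSum fun h _ => (hsum h).mul_left _]
    exact Finset.sum_congr rfl fun h _ => tsum_mul_left
  have := congrArg Complex.re e2
  rw [Complex.ofReal_re] at this
  rw [this, Complex.re_sum]
  simp

end

section

open scoped ComplexConjugate
open Real (posLog posLog_nonneg)

/-- The point `(1 + 2πiξ) / L`. -/
noncomputable def fourierPoint (L ξ : ℝ) : ℂ := ⟨1 / L, 2 * Real.pi * ξ / L⟩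

theorem fourierPoint_re_pos {L : ℝ} (hL : 0 < L) (ξ : ℝ) : 0 < (fourierPoint L ξ).re := by
  simp [fourierPoint, hL]

theorem momentShift_fourierPoint_re (L ξ ξ' : ℝ) (h : ℕ × ℕ × ℕ × ℕ) :
    (momentShift (fourierPoint L ξ) (fourierPoint L ξ') h).re =
      (h.1 + h.2.1 + h.2.2.1 + h.2.2.2) / L := by
  simp [momentShift, fourierPoint]; ring

theorem momentShift_fourierPoint_im (L ξ ξ' : ℝ) (h : ℕ × ℕ × ℕ × ℕ) :
    (momentShift (fourierPoint L ξ) (fourierPoint L ξ') h).im =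
      2 * Real.pi / L * (((h.1 : ℝ) - h.2.1) * ξ + ((h.2.2.1 : ℝ) - h.2.2.2) * ξ') := by
  simp [momentShift, fourierPoint]; ring

theorem mem_momentExponents {m : ℕ} {h : ℕ × ℕ × ℕ × ℕ} : h ∈ momentExponents m ↔
    h.1 ≤ 1 ∧ h.2.1 ≤ 1 ∧ h.2.2.1 ≤ m ∧ h.2.2.2 ≤ m := by
  simp [momentExponents]

/-- A dyadic block of frequencies: `[T, 2T]`, or `[0, 2]` when `T = 1`. -/
def dyadicBlock (T : ℝ) : Set ℝ := {ξ | 0 ≤ ξ ∧ ξ ≤ 2 * T ∧ (T = 1 ∨ T ≤ ξ)}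

theorem norm_shift_le {m : ℕ} {h : ℕ × ℕ × ℕ × ℕ} (hh : h ∈ momentExponents m) {L T σ ξ ξ' : ℝ}
    (hL : 0 < L) (hT : 1 ≤ T) (hσ : 0 < σ) (hσL : σ ≤ 1 / L) (hξ : ξ ∈ dyadicBlock T)
    (hξ' : ξ' ∈ dyadicBlock T) :
    ‖(σ : ℂ) + momentShift (fourierPoint L ξ) (fourierPoint L ξ') h‖ ≤ 24 * (m + 1) * (T / L) := by
  obtain ⟨h1, h2, h3, h4⟩ := mem_momentExponents.1 hh
  have h1' : (h.1 : ℝ) ≤ 1 := by exact_mod_cast h1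
  have h2' : (h.2.1 : ℝ) ≤ 1 := by exact_mod_cast h2
  have h3' : (h.2.2.1 : ℝ) ≤ m := by exact_mod_cast h3
  have h4' : (h.2.2.2 : ℝ) ≤ m := by exact_mod_cast h4
  refine (Complex.norm_le_abs_re_add_abs_im _).trans ?_
  rw [Complex.add_re, Complex.add_im, momentShift_fourierPoint_re, momentShift_fourierPoint_im,
    Complex.ofReal_re, Complex.ofReal_im, zero_add]
  have hT' : 1 / L ≤ T / L := by gcongr
  have a1 : |σ + ((h.1 : ℝ) + h.2.1 + h.2.2.1 + h.2.2.2) / L| ≤ (3 + 2 * m) * (T / L) := by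
    rw [abs_of_nonneg (by positivity)]
    have : ((h.1 : ℝ) + h.2.1 + h.2.2.1 + h.2.2.2) / L ≤ (2 + 2 * m) / L :=
      div_le_div_of_nonneg_right (by linarith) hL.le
    calc _ ≤ 1 / L + (2 + 2 * m) / L := by linarith
      _ = (3 + 2 * m) * (1 / L) := by ring
      _ ≤ _ := by gcongr
  have a2 : |((h.1 : ℝ) - h.2.1) * ξ + ((h.2.2.1 : ℝ) - h.2.2.2) * ξ'| ≤ (2 + 2 * m) * T := by
    refine (abs_add_le _ _).trans ?_
    rw [abs_mul, abs_mul, abs_of_nonneg hξ.1, abs_of_nonneg hξ'.1]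
    have b1 : |(h.1 : ℝ) - h.2.1| ≤ 1 := by
      have := Nat.cast_nonneg (α := ℝ) h.1
      have := Nat.cast_nonneg (α := ℝ) h.2.1
      rw [abs_le]; constructor <;> linarith
    have b2 : |(h.2.2.1 : ℝ) - h.2.2.2| ≤ m := by
      have := Nat.cast_nonneg (α := ℝ) h.2.2.1
      have := Nat.cast_nonneg (α := ℝ) h.2.2.2
      rw [abs_le]; constructor <;> linarith
    calc _ ≤ 1 * (2 * T) + m * (2 * T) := by
          gcongr
          · exact hξ.1
          · exact hξ.2.1
          · exact hξ'.1
          · exact hξ'.2.1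
      _ = _ := by ring
  rw [abs_mul, abs_of_nonneg (show 0 ≤ 2 * Real.pi / L by positivity)]
  have hpi := Real.pi_le_four
  calc _ ≤ (3 + 2 * m) * (T / L) + 2 * 4 / L * ((2 + 2 * m) * T) := by gcongr
    _ = (19 + 18 * m) * (T / L) := by ring
    _ ≤ _ := by gcongr; linarith

theorem one_add_abs_le_norm_shift {h : ℕ × ℕ × ℕ × ℕ} (hh : h ≠ 0) {L σ : ℝ} (ξ ξ' : ℝ)
    (hL : 0 < L) (hσ : 0 < σ) :
    (1 + |((h.1 : ℝ) - h.2.1) * ξ + ((h.2.2.1 : ℝ) - h.2.2.2) * ξ'|) / (2 * L) ≤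
      ‖(σ : ℂ) + momentShift (fourierPoint L ξ) (fourierPoint L ξ') h‖ := by
  have hre := (le_abs_self _).trans (Complex.abs_re_le_norm
    ((σ : ℂ) + momentShift (fourierPoint L ξ) (fourierPoint L ξ') h))
  have him := Complex.abs_im_le_norm
    ((σ : ℂ) + momentShift (fourierPoint L ξ) (fourierPoint L ξ') h)
  rw [Complex.add_re, momentShift_fourierPoint_re, Complex.ofReal_re] at hre
  rw [Complex.add_im, momentShift_fourierPoint_im, Complex.ofReal_im, zero_add, abs_mul,
    abs_of_nonneg (show 0 ≤ 2 * Real.pi / L by positivity)] at him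
  have h1 : (1 : ℝ) ≤ (h.1 : ℝ) + h.2.1 + h.2.2.1 + h.2.2.2 := by
    have : 1 ≤ h.1 + h.2.1 + h.2.2.1 + h.2.2.2 := by
      by_contra h0
      obtain ⟨a, b, c, d⟩ := h
      apply hh
      simp only [Prod.mk_eq_zero] at h0 ⊢
      omega
    exact_mod_cast this
  have h2 : 1 / L ≤ ((h.1 : ℝ) + h.2.1 + h.2.2.1 + h.2.2.2) / L := by gcongr
  set M := |((h.1 : ℝ) - h.2.1) * ξ + ((h.2.2.1 : ℝ) - h.2.2.2) * ξ'|
  have h3 : M / L ≤ 2 * Real.pi / L * M := by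
    rw [div_mul_eq_mul_div]
    gcongr
    have := Real.pi_gt_three
    nlinarith [abs_nonneg (((h.1 : ℝ) - h.2.1) * ξ + ((h.2.2.1 : ℝ) - h.2.2.2) * ξ')]
  have h4 : (1 + M) / (2 * L) = (1 / L + M / L) / 2 := by field_simp
  rw [h4]
  linarith

theorem le_one_add_abs_of_even {m : ℕ} {h : ℕ × ℕ × ℕ × ℕ} (hh : h ∈ momentExponents m)
    (heven : Even (h.1 + h.2.1 + h.2.2.1 + h.2.2.2)) (hd : ¬IsDiagonal h) (hr : ¬IsResonant h)
    {T ξ ξ' : ℝ} (hξ : ξ ∈ dyadicBlock T) (hξ' : ξ' ∈ dyadicBlock T) :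
    T ≤ 1 + |((h.1 : ℝ) - h.2.1) * ξ + ((h.2.2.1 : ℝ) - h.2.2.2) * ξ'| := by
  obtain ⟨i, j, i', j'⟩ := h
  obtain ⟨h1, h2, -, -⟩ := mem_momentExponents.1 hh
  simp only [IsDiagonal, IsResonant] at *
  rcases hξ with ⟨p1, p2, p3 | p3⟩
  · have := abs_nonneg (((i : ℝ) - j) * ξ + ((i' : ℝ) - j') * ξ')
    linarith
  rcases hξ' with ⟨q1, q2, q3 | q3⟩
  · have := abs_nonneg (((i : ℝ) - j) * ξ + ((i' : ℝ) - j') * ξ')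
    linarith
  have hcase : (i = j ∧ (i' + 2 ≤ j' ∨ j' + 2 ≤ i')) ∨
      (i = j + 1 ∧ i = 1 ∧ (j' + 1 ≤ i' ∨ i' + 3 ≤ j')) ∨
      (j = i + 1 ∧ j = 1 ∧ (i' + 1 ≤ j' ∨ j' + 3 ≤ i')) := by
    rw [Nat.even_iff] at heven
    omega
  have hcast : ∀ a b c : ℕ, a + c ≤ b → (a : ℝ) + c ≤ b := fun a b c h => by exact_mod_cast h
  rcases hcase with ⟨rfl, h3 | h3⟩ | ⟨h4, h5, h3 | h3⟩ | ⟨h4, h5, h3 | h3⟩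
  · have h3 := hcast _ _ _ h3
    push_cast at h3
    have := neg_abs_le (((i : ℝ) - i) * ξ + ((i' : ℝ) - j') * ξ')
    nlinarith
  · have h3 := hcast _ _ _ h3
    push_cast at h3
    have := le_abs_self (((i : ℝ) - i) * ξ + ((i' : ℝ) - j') * ξ')
    nlinarith
  · obtain rfl : j = 0 := by omega
    subst h5
    have h3 := hcast _ _ _ h3
    have := le_abs_self (((1 : ℕ) - (0 : ℕ) : ℝ) * ξ + ((i' : ℝ) - j') * ξ')
    push_cast at *
    nlinarith
  · obtain rfl : j = 0 := by omega
    subst h5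
    have h3 := hcast _ _ _ h3
    have := neg_abs_le (((1 : ℕ) - (0 : ℕ) : ℝ) * ξ + ((i' : ℝ) - j') * ξ')
    push_cast at *
    nlinarith
  · obtain rfl : i = 0 := by omega
    subst h5
    have h3 := hcast _ _ _ h3
    have := neg_abs_le (((0 : ℕ) - (1 : ℕ) : ℝ) * ξ + ((i' : ℝ) - j') * ξ')
    push_cast at *
    nlinarith
  · obtain rfl : i = 0 := by omega
    subst h5
    have h3 := hcast _ _ _ h3
    have := le_abs_self (((0 : ℕ) - (1 : ℕ) : ℝ) * ξ + ((i' : ℝ) - j') * ξ')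
    push_cast at *
    nlinarith

end

section

open scoped ComplexConjugate
open Real

theorem posLog_le_log_add_log_two {u : ℝ} (hu : 1 / 2 ≤ u) : log⁺ u ≤ log u + log 2 := by
  have h := log_le_log (by norm_num) hu
  rw [one_div, log_inv] at h
  have := log_pos (one_lt_two)
  rw [posLog]
  exact max_le (by linarith) (by linarith)

theorem momentCoeff_mul_tsum_le (m : ℕ) {ε : ℝ} (hε : 0 < ε) (hε1 : ε ≤ 1) :
    ∃ C : ℝ, 0 ≤ C ∧ ∀ L T σ ξ ξ' : ℝ, log 2 ≤ L → 1 ≤ T → 0 < σ → σ ≤ 1 / L →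
      ξ ∈ dyadicBlock T → ξ' ∈ dyadicBlock T → ∀ h ∈ momentExponents m,
      momentCoeff m h * (∑' p : Nat.Primes,
        (p : ℂ) ^ (-(1 + (σ + momentShift (fourierPoint L ξ) (fourierPoint L ξ') h)))).re ≤
      momentCoeff m h * (log⁺ (L / T) + (if IsDiagonal h then log L - log⁺ (L / T) else 0) +
        (if h = 0 then log (1 / σ) - log L else 0) +
        (if IsResonant h then log T - log (1 + |ξ - ξ'|) else 0)) +
      |momentCoeff m h| * (ε * log⁺ (T / L) + C) := by
  have hl2 : 0 < log 2 := log_pos one_lt_two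
  have hl2' : 1 / 2 ≤ log 2 := by have := Real.log_two_gt_d9; linarith
  obtain ⟨C, hC, H⟩ := abs_re_tsum_prime_cpow_sub_posLog_le ((2 * m + 3) / log 2) (by positivity) hε
  set c := log⁺ (24 * ((m : ℝ) + 1)) with hc
  have hc0 : 0 ≤ c := posLog_nonneg
  refine ⟨C + 2 * c + 2 * log 2, by positivity, fun L T σ ξ ξ' hL hT hσ hσL hξ hξ' h hh => ?_⟩
  have hL0 : 0 < L := hl2.trans_le hL
  have hT0 : 0 < T := by linarith
  set w : ℂ := σ + momentShift (fourierPoint L ξ) (fourierPoint L ξ') h with hw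
  have hwre : 0 < w.re := by
    have := re_momentShift_nonneg (fourierPoint_re_pos hL0 ξ) (fourierPoint_re_pos hL0 ξ') h
    rw [hw, Complex.add_re, Complex.ofReal_re]
    linarith
  have hwK : w.re ≤ (2 * m + 3) / log 2 := by
    obtain ⟨h1, h2, h3, h4⟩ := mem_momentExponents.1 hh
    have h5 : (h.1 : ℝ) + h.2.1 + h.2.2.1 + h.2.2.2 ≤ 2 * m + 2 := by
      have : h.1 + h.2.1 + h.2.2.1 + h.2.2.2 ≤ 2 * m + 2 := by omega
      exact_mod_cast this
    rw [hw, Complex.add_re, momentShift_fourierPoint_re, Complex.ofReal_re]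
    have := div_le_div_of_nonneg_right h5 hL0.le
    calc _ ≤ 1 / L + (2 * m + 2) / L := by linarith
      _ = (2 * m + 3) / L := by ring
      _ ≤ _ := by gcongr
  have hw0 : 0 < ‖w‖ := norm_pos_iff.2 (by rintro h0; rw [h0] at hwre; simp at hwre)
  have hv := H w hwre hwK
  set v := (∑' p : Nat.Primes, (p : ℂ) ^ (-(1 + w))).re with hvdef
  have hwle := norm_shift_le hh hL0 hT hσ hσL hξ hξ'
  rw [← hw] at hwle
  have hup : log⁺ ‖w‖ ≤ c + log⁺ (T / L) :=
    (posLog_le_posLog (norm_nonneg _) hwle).trans posLog_mul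
  have hlow : log⁺ (L / T) ≤ c + log⁺ (‖w‖⁻¹) := by
    refine (posLog_le_posLog (by positivity) ?_).trans posLog_mul
    rw [← div_eq_mul_inv, le_div_iff₀ hw0, div_mul_eq_mul_div, div_le_iff₀ hT0]
    calc L * ‖w‖ ≤ L * (24 * (m + 1) * (T / L)) := by gcongr
      _ = _ := by field_simp
  have hupε : ε * log⁺ ‖w‖ ≤ ε * log⁺ (T / L) + c := by
    nlinarith
  rw [abs_le] at hv
  have hlam : 0 ≤ log⁺ (T / L) := posLog_nonneg
  have hτ : (Even (h.1 + h.2.1 + h.2.2.1 + h.2.2.2) → log⁺ (‖w‖⁻¹) ≤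
      log⁺ (L / T) + (if IsDiagonal h then log L - log⁺ (L / T) else 0) +
        (if h = 0 then log (1 / σ) - log L else 0) +
        (if IsResonant h then log T - log (1 + |ξ - ξ'|) else 0) + 2 * log 2) := by
    intro heven
    by_cases h0 : h = 0
    · have hd : IsDiagonal h := by rw [h0]; exact ⟨rfl, rfl⟩
      have hr : ¬IsResonant h := by rw [h0]; simp [IsResonant]
      rw [if_pos hd, if_pos h0, if_neg hr]
      have e : ‖w‖⁻¹ = 1 / σ := by
        rw [hw, h0]; simp [momentShift, abs_of_pos hσ]
      have : L ≤ 1 / σ := by rw [le_div_iff₀ hσ]; rwa [le_div_iff₀ hL0, mul_comm] at hσL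
      rw [e]
      linarith [posLog_le_log_add_log_two (u := 1 / σ) (by linarith)]
    have hge := one_add_abs_le_norm_shift h0 ξ ξ' hL0 hσ
    rw [← hw] at hge
    have hinv : ∀ u : ℝ, 0 < u →
        u ≤ 1 + |((h.1 : ℝ) - h.2.1) * ξ + ((h.2.2.1 : ℝ) - h.2.2.2) * ξ'| →
        log⁺ (‖w‖⁻¹) ≤ log⁺ (2 * (L / u)) := by
      intro u hu hu'
      apply posLog_le_posLog (by positivity)
      rw [inv_le_comm₀ hw0 (by positivity)]
      calc (2 * (L / u))⁻¹ = u / (2 * L) := by field_simp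
        _ ≤ _ := by gcongr
        _ ≤ _ := hge
    rw [if_neg h0]
    by_cases hd : IsDiagonal h
    · have hr : ¬IsResonant h := by
        rintro (hr | hr) <;> have := hd.1 <;> omega
      rw [if_pos hd, if_neg hr]
      have h1 := hinv 1 one_pos (by have := abs_nonneg (((h.1 : ℝ) - h.2.1) * ξ +
        ((h.2.2.1 : ℝ) - h.2.2.2) * ξ'); linarith)
      have h2 := posLog_le_log_add_log_two (u := 2 * (L / 1)) (by linarith)
      rw [log_mul two_ne_zero (by positivity)] at h2
      rw [div_one] at h1 h2
      linarith
    rw [if_neg hd]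
    by_cases hr : IsResonant h
    · rw [if_pos hr]
      have e : |((h.1 : ℝ) - h.2.1) * ξ + ((h.2.2.1 : ℝ) - h.2.2.2) * ξ'| = |ξ - ξ'| := by
        rcases hr with ⟨h1, h2⟩ | ⟨h1, h2⟩
        · rw [h1, h2]; push_cast; ring_nf
        · rw [h1, h2, ← abs_neg]; push_cast; ring_nf
      set D := 1 + |ξ - ξ'| with hD
      have hD0 : 0 < D := by positivity
      have hDT : D ≤ 3 * T := by
        have : |ξ - ξ'| ≤ 2 * T := by
          rw [abs_le]; constructor <;> linarith [hξ.1, hξ.2.1, hξ'.1, hξ'.2.1]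
        linarith
      have h1 := hinv D hD0 (by rw [e])
      have h2 : 2 * (L / D) = L / T * (2 * (T / D)) := by field_simp
      rw [h2] at h1
      have h3 := h1.trans posLog_mul
      have h4 := posLog_le_log_add_log_two (u := 2 * (T / D)) (by
        have : 1 / 3 ≤ T / D := by rw [div_le_div_iff₀ (by norm_num) hD0]; linarith
        linarith)
      rw [log_mul two_ne_zero (by positivity), log_div hT0.ne' hD0.ne'] at h4
      linarith
    · rw [if_neg hr]
      have h1 := hinv T hT0 (le_one_add_abs_of_even hh heven hd hr hξ hξ')
      have h2 := h1.trans posLog_mul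
      have h3 := posLog_le_log_add_log_two (u := 2) (by norm_num)
      linarith
  rcases Nat.even_or_odd (h.1 + h.2.1 + h.2.2.1 + h.2.2.2) with heven | hodd
  · have hpos : 0 ≤ momentCoeff m h := by
      rw [momentCoeff, heven.neg_one_pow]; positivity
    rw [abs_of_nonneg hpos, ← mul_add]
    apply mul_le_mul_of_nonneg_left _ hpos
    have := hτ heven
    linarith
  · have hneg : momentCoeff m h ≤ 0 := by
      rw [momentCoeff, hodd.neg_one_pow]
      have : 0 ≤ (m.choose h.2.2.1 * m.choose h.2.2.2 : ℝ) := by positivity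
      linarith
    rw [abs_of_nonpos hneg]
    have hd : ¬IsDiagonal h := by
      rintro ⟨h1, h2⟩
      rw [Nat.odd_iff] at hodd; omega
    have hr : ¬IsResonant h := by
      rintro (⟨h1, h2⟩ | ⟨h1, h2⟩) <;> rw [Nat.odd_iff] at hodd <;> omega
    have h0 : h ≠ 0 := by rintro rfl; exact hd ⟨rfl, rfl⟩
    rw [if_neg hd, if_neg hr, if_neg h0]
    have : log⁺ (L / T) - (ε * log⁺ (T / L) + (C + 2 * c + 2 * log 2)) ≤ v := by linarith
    nlinarith [mul_le_mul_of_nonneg_left this (neg_nonneg.2 hneg)]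

theorem tsum_eulerWeight_le (m : ℕ) : ∃ C : ℝ, 0 ≤ C ∧ ∀ L T σ ξ ξ' : ℝ, log 2 ≤ L → 1 ≤ T →
    0 < σ → σ ≤ 1 / L → ξ ∈ dyadicBlock T → ξ' ∈ dyadicBlock T →
    ∑' p : Nat.Primes, eulerWeight m (fourierPoint L ξ) (fourierPoint L ξ') p *
      (p : ℝ) ^ (-(1 + σ)) ≤
    log (1 / σ) - log L + (2 * (m + 1)).choose (m + 1) * log T -
      2 * (2 * m).choose (m + 1) * log (1 + |ξ - ξ'|) + C := by
  set S := ∑ h ∈ momentExponents m, |momentCoeff m h| with hS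
  have hS0 : 0 ≤ S := Finset.sum_nonneg fun _ _ => abs_nonneg _
  have hε : 0 < 1 / (S + 1) := by positivity
  obtain ⟨C, hC, H⟩ := momentCoeff_mul_tsum_le m hε (by rw [div_le_one (by positivity)]; linarith)
  refine ⟨S * C, by positivity, fun L T σ ξ ξ' hL hT hσ hσL hξ hξ' => ?_⟩
  have hL0 : 0 < L := (log_pos one_lt_two).trans_le hL
  have hT0 : 0 < T := by linarith
  rw [tsum_eulerWeight m (fourierPoint_re_pos hL0 ξ) (fourierPoint_re_pos hL0 ξ') hσ]
  refine (Finset.sum_le_sum (H L T σ ξ ξ' hL hT hσ hσL hξ hξ')).trans ?_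
  set ell := log⁺ (L / T) with hell
  set lam := log⁺ (T / L) with hlam
  have hlam0 : 0 ≤ lam := posLog_nonneg
  have hrel : lam - ell = log T - log L := by
    have := posLog_sub_posLog_inv (x := T / L)
    rwa [inv_div, log_div hT0.ne' hL0.ne'] at this
  rw [Finset.sum_add_distrib, ← Finset.sum_mul, ← hS]
  have e0 : ∑ h ∈ momentExponents m, (if h = 0 then momentCoeff m h else 0) = 1 := by
    rw [Finset.sum_ite_eq' , if_pos (by simp [momentExponents])]
    simp [momentCoeff]
  have e : ∑ h ∈ momentExponents m, momentCoeff m h *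
      (ell + (if IsDiagonal h then log L - ell else 0) +
        (if h = 0 then log (1 / σ) - log L else 0) +
        (if IsResonant h then log T - log (1 + |ξ - ξ'|) else 0)) =
      2 * (2 * m).choose m * (log L - ell) + (log (1 / σ) - log L) +
      2 * (2 * m).choose (m + 1) * (log T - log (1 + |ξ - ξ'|)) := by
    rw [← sum_momentCoeff_diagonal, ← sum_momentCoeff_resonant]
    calc _ = (∑ h ∈ momentExponents m, momentCoeff m h) * ell +
        (∑ h ∈ momentExponents m, if IsDiagonal h then momentCoeff m h else 0) * (log L - ell) +
        (∑ h ∈ momentExponents m, if h = 0 then momentCoeff m h else 0) * (log (1 / σ) - log L) +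
        (∑ h ∈ momentExponents m, if IsResonant h then momentCoeff m h else 0) *
          (log T - log (1 + |ξ - ξ'|)) := by
          rw [Finset.sum_mul, Finset.sum_mul, Finset.sum_mul, Finset.sum_mul,
            ← Finset.sum_add_distrib, ← Finset.sum_add_distrib, ← Finset.sum_add_distrib]
          refine Finset.sum_congr rfl fun h _ => ?_
          split_ifs <;> ring
      _ = _ := by rw [sum_momentCoeff, e0]; ring
  rw [e]
  have hSε : S * (1 / (S + 1) * lam + C) ≤ lam + S * C := by
    have : S * (1 / (S + 1)) ≤ 1 := by
      rw [mul_one_div, div_le_one (by positivity)]; linarith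
    nlinarith
  have hch : ((2 * (m + 1)).choose (m + 1) : ℝ) =
      2 * (2 * m).choose m + 2 * (2 * m).choose (m + 1) := by
    exact_mod_cast (two_mul_choose_add_two_mul_choose m).symm
  have h1 : (1 : ℝ) ≤ (2 * m).choose m := by
    exact_mod_cast Nat.choose_pos (by omega)
  have hfin : lam ≤ 2 * (2 * m).choose m * lam := by nlinarith
  rw [hch]
  have : log L - ell = log T - lam := by linarith
  rw [this]
  linarith

end

section

open Real

theorem sum_moebius_mul_cpow_eq_prod (s : ℂ) {n : ℕ} (hn : n ≠ 0) :
    ∑ d ∈ n.divisors, ((ArithmeticFunction.moebius d : ℤ) : ℂ) * (d : ℂ) ^ (-s) =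
      ∏ p ∈ n.primeFactors, (1 - (p : ℂ) ^ (-s)) := by
  set r := ∏ p ∈ n.primeFactors, p with hr
  have hr0 : r ≠ 0 :=
      Finset.prod_ne_zero_iff.2 fun p hp => (Nat.prime_of_mem_primeFactors hp).ne_zero
  have hrdvd : r ∣ n := Nat.prod_primeFactors_dvd n
  have hrpf : r.primeFactors = n.primeFactors :=
    Nat.primeFactors_prod fun p hp => Nat.prime_of_mem_primeFactors hp
  have hrsq : Squarefree r := by
    refine Finset.squarefree_prod_of_pairwise_isCoprime (fun p hp q hq hpq => ?_)
      fun p hp => (Nat.prime_of_mem_primeFactors hp).squarefree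
    exact Nat.coprime_iff_isRelPrime.1 ((Nat.coprime_primes (Nat.prime_of_mem_primeFactors hp)
      (Nat.prime_of_mem_primeFactors hq)).2 hpq)
  have h1 : ∑ d ∈ n.divisors, ((ArithmeticFunction.moebius d : ℤ) : ℂ) * (d : ℂ) ^ (-s) =
      ∑ d ∈ r.divisors, ((ArithmeticFunction.moebius d : ℤ) : ℂ) * (d : ℂ) ^ (-s) := by
    symm
    apply Finset.sum_subset (Nat.divisors_subset_of_dvd hn hrdvd)
    intro d hd hd'
    have : ¬Squarefree d := by
      intro hsq
      apply hd'
      rw [Nat.mem_divisors]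
      refine ⟨?_, hr0⟩
      rw [← Nat.prod_primeFactors_of_squarefree hsq]
      exact Finset.prod_dvd_prod_of_subset _ _ _
        (Nat.primeFactors_mono (Nat.dvd_of_mem_divisors hd) hn)
    rw [ArithmeticFunction.moebius_eq_zero_of_not_squarefree this]; simp
  let g : ArithmeticFunction ℂ := ⟨fun n => if n = 0 then 0 else (n : ℂ) ^ (-s), by simp⟩
  have hg : ∀ n : ℕ, n ≠ 0 → g n = (n : ℂ) ^ (-s) := fun n hn => if_neg hn
  have hgm : g.IsMultiplicative := by
    rw [ArithmeticFunction.IsMultiplicative.iff_ne_zero]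
    refine ⟨by rw [hg 1 one_ne_zero]; simp, fun {a b} ha hb _ => ?_⟩
    rw [hg _ (mul_ne_zero ha hb), hg a ha, hg b hb, Nat.cast_mul, Complex.natCast_mul_natCast_cpow]
  rw [h1, ← hrpf, Finset.prod_congr rfl fun p hp => by
      rw [← hg p (Nat.prime_of_mem_primeFactors hp).ne_zero],
    hgm.prodPrimeFactors_one_sub_of_squarefree g hrsq]
  exact Finset.sum_congr rfl fun d hd => by rw [hg d (Nat.pos_of_mem_divisors hd).ne']

theorem sum_primes_log_div_le (Y : ℕ) (hY : 1 ≤ Y) :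
    ∑ p ∈ (Finset.Icc 1 Y).filter Nat.Prime, log p / p ≤ log Y + (log 4 + 4) := by
  have hIcc : Finset.Icc 1 Y = Finset.Ioc 0 Y := by ext; simp [Nat.succ_le_iff]
  rw [hIcc]
  have hY0 : (0 : ℝ) < Y := by exact_mod_cast hY
  have h1 : ∑ p ∈ (Finset.Ioc 0 Y).filter Nat.Prime, log p / p ≤
      ∑ d ∈ Finset.Ioc 0 Y, ArithmeticFunction.vonMangoldt d / d := by
    rw [Finset.sum_filter]
    refine Finset.sum_le_sum fun d _ => ?_
    split_ifs with h
    · rw [ArithmeticFunction.vonMangoldt_apply_prime h]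
    · exact div_nonneg ArithmeticFunction.vonMangoldt_nonneg (by positivity)
  have h2 : ∑ d ∈ Finset.Ioc 0 Y, ArithmeticFunction.vonMangoldt d * (Y / d - 1) ≤ Y * log Y := by
    calc _ ≤ ∑ d ∈ Finset.Ioc 0 Y, ArithmeticFunction.vonMangoldt d * ((Y / d : ℕ) : ℝ) := by
          refine Finset.sum_le_sum fun d _ => ?_
          apply mul_le_mul_of_nonneg_left _ ArithmeticFunction.vonMangoldt_nonneg
          rw [← Nat.floor_div_eq_div (K := ℝ)]
          exact (Nat.sub_one_lt_floor _).le
      _ = ∑ n ∈ Finset.Ioc 0 Y, log n := by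
          have e : ∀ n ∈ Finset.Ioc 0 Y, log (n : ℝ) =
              ∑ z ∈ n.divisorsAntidiagonal, ArithmeticFunction.vonMangoldt z.2 := by
            intro n _
            rw [← ArithmeticFunction.vonMangoldt_sum, Nat.sum_divisorsAntidiagonal'
              (f := fun _ d => ArithmeticFunction.vonMangoldt d)]
          rw [Finset.sum_congr rfl e, sum_Ioc_sum_divisorsAntidiagonal Y
            (fun _ d => ArithmeticFunction.vonMangoldt d)]
          refine Finset.sum_congr rfl fun d _ => ?_
          simp [mul_comm]
      _ ≤ ∑ n ∈ Finset.Ioc 0 Y, log Y := by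
          refine Finset.sum_le_sum fun n hn => ?_
          rw [Finset.mem_Ioc] at hn
          exact log_le_log (by exact_mod_cast hn.1) (by exact_mod_cast hn.2)
      _ = _ := by simp
  have h3 : ∑ d ∈ Finset.Ioc 0 Y, ArithmeticFunction.vonMangoldt d * ((Y : ℝ) / d - 1) =
      Y * ∑ d ∈ Finset.Ioc 0 Y, ArithmeticFunction.vonMangoldt d / d -
        ∑ d ∈ Finset.Ioc 0 Y, ArithmeticFunction.vonMangoldt d := by
    rw [Finset.mul_sum, ← Finset.sum_sub_distrib]
    exact Finset.sum_congr rfl fun d _ => by ring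
  have h4 : ∑ d ∈ Finset.Ioc 0 Y, ArithmeticFunction.vonMangoldt d ≤ (log 4 + 4) * Y := by
    have := Chebyshev.psi_le_const_mul_self (x := Y) hY0.le
    rwa [Chebyshev.psi, Nat.floor_natCast] at this
  rw [h3] at h2
  refine h1.trans (le_of_mul_le_mul_left ?_ hY0)
  linarith

theorem sum_primes_sqrt_log_div_le : ∃ C : ℝ, 0 < C ∧ ∀ Y : ℕ,
    ∑ p ∈ (Finset.Icc 1 Y).filter Nat.Prime, √(log p) / p ≤ C * √(log Y) := by
  have hl2 : 0 < log 2 := log_pos one_lt_two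
  set c := 1 + (log 4 + 4) / log 2 with hc
  have hlog4 : 0 < log 4 := log_pos (by norm_num)
  have hc0 : 0 < c := by positivity
  refine ⟨8 * c, by positivity, fun Y => ?_⟩
  induction Y using Nat.strong_induction_on with
  | _ Y ih =>
  rcases Nat.lt_or_ge Y 2 with hY | hY
  · have : (Finset.Icc 1 Y).filter Nat.Prime = ∅ := by
      rw [Finset.filter_eq_empty_iff]
      intro p hp hpp
      have := hpp.two_le
      rw [Finset.mem_Icc] at hp
      omega
    rw [this, Finset.sum_empty]
    positivity
  set Z := Nat.sqrt Y with hZ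
  have hZY : Z < Y := Nat.sqrt_lt_self hY
  have hZ1 : 1 ≤ Z := Nat.sqrt_pos.2 (by omega)
  have hlogY : log 2 ≤ log Y := log_le_log two_pos (by exact_mod_cast hY)
  have hlogY0 : 0 < log Y := hl2.trans_le hlogY
  have hZlog : log Z ≤ log Y / 2 := by
    have : log ((Z : ℝ) * Z) ≤ log Y :=
      log_le_log (by positivity) (by exact_mod_cast Nat.sqrt_le Y)
    rw [log_mul (by positivity) (by positivity)] at this
    linarith
  have h1 := (ih Z hZY).trans (mul_le_mul_of_nonneg_left (sqrt_le_sqrt hZlog) (by positivity))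
  have hsplit : ∑ p ∈ (Finset.Icc 1 Y).filter Nat.Prime, √(log p) / p ≤
      ∑ p ∈ (Finset.Icc 1 Z).filter Nat.Prime, √(log p) / p +
        ∑ p ∈ (Finset.Icc 1 Y).filter Nat.Prime, (log p / p) / √(log Y / 2) := by
    have hnn : ∀ p : ℕ, 0 ≤ (log p / p) / √(log Y / 2) := fun p => by positivity
    rw [show (Finset.Icc 1 Z).filter Nat.Prime =
      ((Finset.Icc 1 Y).filter Nat.Prime).filter (fun p => p ≤ Z) by
        ext p; simp only [Finset.mem_filter, Finset.mem_Icc]; constructor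
        · rintro ⟨⟨a, b⟩, c⟩; exact ⟨⟨⟨a, by omega⟩, c⟩, b⟩
        · rintro ⟨⟨⟨a, b⟩, c⟩, d⟩; exact ⟨⟨a, d⟩, c⟩,
      Finset.sum_filter (fun p => p ≤ Z) (fun p : ℕ => √(log p) / p), ← Finset.sum_add_distrib]
    refine Finset.sum_le_sum fun p hp => ?_
    split_ifs with h
    · linarith [hnn p]
    · have hp0 : 0 < (p : ℝ) := by exact_mod_cast (Finset.mem_Icc.1 (Finset.mem_filter.1 hp).1).1
      have hpl : log Y / 2 ≤ log p := by
        have h5 : Y ≤ p * p := (Nat.sqrt_lt'.1 (not_le.1 h)).le.trans (by rw [sq])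
        have : log Y ≤ log ((p : ℝ) * p) := log_le_log (by positivity) (by exact_mod_cast h5)
        rw [log_mul hp0.ne' hp0.ne'] at this
        linarith
      rw [zero_add, div_right_comm]
      apply div_le_div_of_nonneg_right _ hp0.le
      rw [le_div_iff₀ (by positivity)]
      calc √(log p) * √(log Y / 2) ≤ √(log p) * √(log p) := by gcongr
        _ = log p := mul_self_sqrt (by linarith)
  rw [← Finset.sum_div] at hsplit
  have hM := sum_primes_log_div_le Y (by omega)
  have hM2 : log Y + (log 4 + 4) ≤ c * log Y := by
    rw [hc, add_mul, one_mul]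
    have : (log 4 + 4) / log 2 * log 2 ≤ (log 4 + 4) / log 2 * log Y := by gcongr
    rw [div_mul_cancel₀ _ hl2.ne'] at this
    linarith
  have hq : √(log Y / 2) * √(log Y / 2) = log Y / 2 := mul_self_sqrt (by positivity)
  have hq0 : 0 < √(log Y / 2) := by positivity
  have h6 : (∑ p ∈ (Finset.Icc 1 Y).filter Nat.Prime, log p / p) / √(log Y / 2) ≤
      2 * c * √(log Y / 2) := by
    rw [div_le_iff₀ hq0]
    nlinarith
  have h7 : √(log Y / 2) ≤ 4 / 5 * √(log Y) := by
    rw [show (4 : ℝ) / 5 = √((4 / 5) ^ 2) by rw [sqrt_sq (by norm_num)], ← sqrt_mul (by norm_num)]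
    apply sqrt_le_sqrt
    nlinarith
  nlinarith

end

section

open Real

/-- `Σ_{d | n} μ(d) d^{-s}`. -/
noncomputable def moebiusSum (s : ℂ) (n : ℕ) : ℂ :=
  ∑ d ∈ n.divisors, ((ArithmeticFunction.moebius d : ℤ) : ℂ) * (d : ℂ) ^ (-s)

theorem primeWeight_eulerWeight (m : ℕ) (s s' : ℂ) {n : ℕ} (hn : n ≠ 0) :
    primeWeight (eulerWeight m s s') n = ‖moebiusSum s n‖ ^ 2 * ‖moebiusSum s' n‖ ^ (2 * m) := by
  rw [moebiusSum, moebiusSum, sum_moebius_mul_cpow_eq_prod s hn,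
    sum_moebius_mul_cpow_eq_prod s' hn, norm_prod, norm_prod, ← Finset.prod_pow,
    ← Finset.prod_pow, ← Finset.prod_mul_distrib]
  rfl

theorem norm_fourierPoint_le {L T ξ : ℝ} (hL : 0 < L) (hT : 1 ≤ T) (hξ : ξ ∈ dyadicBlock T) :
    ‖fourierPoint L ξ‖ ≤ 17 * (T / L) := by
  refine (Complex.norm_le_abs_re_add_abs_im _).trans ?_
  have hξ0 := hξ.1
  simp only [fourierPoint]
  rw [abs_of_nonneg (by positivity), abs_of_nonneg (by positivity)]
  have := Real.pi_le_four
  calc 1 / L + 2 * π * ξ / L ≤ T / L + 2 * 4 * (2 * T) / L := by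
        gcongr
        exact hξ.2.1
    _ = _ := by ring

theorem norm_one_sub_cpow_le {s : ℂ} (hs : 0 < s.re) {p : ℕ} (hp : p.Prime) :
    ‖1 - (p : ℂ) ^ (-s)‖ ≤ 2 * (‖s‖ * log p) := by
  have hp0 : (p : ℂ) ≠ 0 := by exact_mod_cast hp.ne_zero
  have hlog : 0 ≤ log p := log_natCast_nonneg p
  have hn : ‖Complex.log p * -s‖ = ‖s‖ * log p := by
    rw [norm_mul, norm_neg, ← Complex.natCast_log, Complex.norm_real, norm_of_nonneg hlog, mul_comm]
  rw [norm_sub_rev]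
  rcases le_total (‖s‖ * log p) 1 with h | h
  · rw [Complex.cpow_def_of_ne_zero hp0, ← hn]
    exact Complex.norm_exp_sub_one_le (hn.trans_le h)
  · have := norm_sub_le ((p : ℂ) ^ (-s)) 1
    have := norm_natCast_cpow_neg_le_one hs p
    simp only [norm_one] at *
    linarith

theorem eulerWeight_le_min (m : ℕ) {L T ξ ξ' : ℝ} (hL : 0 < L) (hT : 1 ≤ T)
    (hξ : ξ ∈ dyadicBlock T) {p : ℕ} (hp : p.Prime) :
    eulerWeight m (fourierPoint L ξ) (fourierPoint L ξ') p ≤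
      1156 * 4 ^ m * min 1 ((T / L * log p) ^ 2) := by
  have hlog : 0 ≤ log p := log_natCast_nonneg p
  have hs := fourierPoint_re_pos hL ξ
  have hs' := fourierPoint_re_pos hL ξ'
  have h2 : ∀ {s : ℂ}, 0 < s.re → ‖1 - (p : ℂ) ^ (-s)‖ ≤ 2 := fun {s} hs => by
    have := norm_sub_le 1 ((p : ℂ) ^ (-s))
    have := norm_natCast_cpow_neg_le_one hs p
    simp only [norm_one] at *
    linarith
  have h3 : ‖1 - (p : ℂ) ^ (-fourierPoint L ξ')‖ ^ (2 * m) ≤ 4 ^ m := by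
    calc _ ≤ (2 : ℝ) ^ (2 * m) := by have := h2 hs'; gcongr
      _ = _ := by rw [pow_mul]; norm_num
  have h4 : ‖1 - (p : ℂ) ^ (-fourierPoint L ξ)‖ ≤ 34 * (T / L * log p) := by
    refine (norm_one_sub_cpow_le hs hp).trans ?_
    have := mul_le_mul_of_nonneg_right (norm_fourierPoint_le hL hT hξ) hlog
    linarith
  have h5 : ‖1 - (p : ℂ) ^ (-fourierPoint L ξ)‖ ^ 2 ≤ 1156 * min 1 ((T / L * log p) ^ 2) := by
    rw [mul_min_of_nonneg _ _ (by norm_num)]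
    refine le_min ?_ ?_
    · calc _ ≤ (2 : ℝ) ^ 2 := by have := h2 hs; gcongr
        _ ≤ _ := by norm_num
    · calc _ ≤ (34 * (T / L * log p)) ^ 2 := by gcongr
        _ = _ := by ring
  rw [eulerWeight]
  calc _ ≤ 1156 * min 1 ((T / L * log p) ^ 2) * 4 ^ m := by gcongr
    _ = _ := by ring

theorem min_one_sq_le_sqrt {u : ℝ} (hu : 0 ≤ u) : min 1 (u ^ 2) ≤ √u := by
  rcases le_total u 1 with h | h
  · refine (min_le_right _ _).trans (le_sqrt_of_sq_le ?_)
    calc (u ^ 2) ^ 2 = u * u ^ 3 := by ring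
      _ ≤ u * 1 := by gcongr; exact pow_le_one₀ hu h
      _ = u := mul_one u
  · exact (min_le_left _ _).trans (one_le_sqrt.2 h)

theorem sum_eulerWeight_div_le (m : ℕ) : ∃ C : ℝ, 0 < C ∧ ∀ L T η ξ ξ' : ℝ, ∀ Y : ℕ, 0 < L →
    1 ≤ T → ξ ∈ dyadicBlock T → 2 ≤ Y → log Y ≤ η * L →
    ∑ p ∈ (Finset.Icc 1 Y).filter Nat.Prime,
      eulerWeight m (fourierPoint L ξ) (fourierPoint L ξ') p / p ≤
        C * min ((η * T) ^ 2) √(η * T) := by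
  obtain ⟨C, hC, H⟩ := sum_primes_sqrt_log_div_le
  have hl2 : 0 < log 2 := log_pos one_lt_two
  set c := 1 + (log 4 + 4) / log 2 with hc
  have hlog4 : 0 < log 4 := log_pos (by norm_num)
  have hc0 : 0 < c := by positivity
  refine ⟨1156 * 4 ^ m * (c + C), by positivity, fun L T η ξ ξ' Y hL hT hξ hY hYL => ?_⟩
  have hlogY : log 2 ≤ log Y := log_le_log two_pos (by exact_mod_cast hY)
  have hlogY0 : 0 < log Y := hl2.trans_le hlogY
  have hηL : 0 < η * L := hlogY0.trans_le hYL
  have hη : 0 < η := pos_of_mul_pos_left hηL hL.le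
  have hM := sum_primes_log_div_le Y (by omega)
  have hM2 : log Y + (log 4 + 4) ≤ c * (η * L) := by
    rw [hc, add_mul, one_mul]
    have : (log 4 + 4) / log 2 * log 2 ≤ (log 4 + 4) / log 2 * (η * L) := by
      gcongr; exact hlogY.trans hYL
    rw [div_mul_cancel₀ _ hl2.ne'] at this
    linarith
  rw [mul_min_of_nonneg _ _ (by positivity)]
  have hw : ∀ p ∈ (Finset.Icc 1 Y).filter Nat.Prime,
      eulerWeight m (fourierPoint L ξ) (fourierPoint L ξ') p / p ≤
        1156 * 4 ^ m * min 1 ((T / L * log p) ^ 2) / p := fun p hp =>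
    div_le_div_of_nonneg_right (eulerWeight_le_min m hL hT hξ (Finset.mem_filter.1 hp).2)
      (by positivity)
  refine le_min ?_ ?_ <;> refine (Finset.sum_le_sum hw).trans ?_
  · calc _ ≤ ∑ p ∈ (Finset.Icc 1 Y).filter Nat.Prime,
          1156 * 4 ^ m * (T / L) ^ 2 * (η * L) * (log p / p) := by
          refine Finset.sum_le_sum fun p hp => ?_
          rw [Finset.mem_filter, Finset.mem_Icc] at hp
          have hp0 : (0 : ℝ) < p := by exact_mod_cast hp.1.1
          have hlog : 0 ≤ log p := log_natCast_nonneg p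
          have hlp : log p ≤ η * L :=
            (log_le_log hp0 (by exact_mod_cast hp.1.2)).trans hYL
          rw [← mul_div_assoc]
          apply div_le_div_of_nonneg_right _ hp0.le
          calc _ ≤ 1156 * 4 ^ m * ((T / L * log p) ^ 2) := by gcongr; exact min_le_right _ _
            _ = 1156 * 4 ^ m * (T / L) ^ 2 * log p * log p := by ring
            _ ≤ _ := by gcongr
      _ ≤ 1156 * 4 ^ m * (T / L) ^ 2 * (η * L) * (c * (η * L)) := by
          rw [← Finset.mul_sum]
          gcongr
          exact hM.trans hM2
      _ = 1156 * 4 ^ m * c * (η * T) ^ 2 := by field_simp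
      _ ≤ _ := by gcongr; linarith
  · calc _ ≤ ∑ p ∈ (Finset.Icc 1 Y).filter Nat.Prime,
          1156 * 4 ^ m * √(T / L) * (√(log p) / p) := by
          refine Finset.sum_le_sum fun p hp => ?_
          have hlog : 0 ≤ log p := log_natCast_nonneg p
          rw [← mul_div_assoc, mul_assoc _ (√(T / L)), ← sqrt_mul (by positivity)]
          apply div_le_div_of_nonneg_right _ (by positivity)
          gcongr
          exact min_one_sq_le_sqrt (by positivity)
      _ ≤ 1156 * 4 ^ m * √(T / L) * (C * √(η * L)) := by
          rw [← Finset.mul_sum]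
          gcongr
          exact (H Y).trans (by gcongr)
      _ = 1156 * 4 ^ m * C * √(η * T) := by
          have hsq : √(η * T) = √(T / L) * √(η * L) := by
            rw [← sqrt_mul (by positivity)]
            congr 1
            field_simp
          rw [hsq]
          ring
      _ ≤ _ := by gcongr; linarith

theorem sum_norm_moebiusSum_le (m : ℕ) : ∃ C : ℝ, 0 < C ∧ ∀ R x η T ξ ξ' : ℝ, 2 ≤ R → R ≤ x →
    log 2 / log R ≤ η → 1 ≤ T → ξ ∈ dyadicBlock T → ξ' ∈ dyadicBlock T →
    ∑ n ∈ (Finset.Icc 1 ⌊x⌋₊).filter (fun n : ℕ => ∃ p : ℕ, p.Prime ∧ p ∣ n ∧ (p : ℝ) ≤ R ^ η),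
      ‖moebiusSum (fourierPoint (log R) ξ) n‖ ^ 2 *
        ‖moebiusSum (fourierPoint (log R) ξ') n‖ ^ (2 * m) ≤
      C * (x / log R * min ((η * T) ^ 2) √(η * T) * T ^ (2 * (m + 1)).choose (m + 1) /
        (1 + |ξ - ξ'|) ^ (2 * (2 * m).choose (m + 1))) := by
  obtain ⟨C1, hC1, H1⟩ := sum_smallPrimeWeight_le (4 * 4 ^ m) (by positivity)
  obtain ⟨C2, hC2, H2⟩ := sum_primeWeight_div_le (4 * 4 ^ m) (by positivity)
  obtain ⟨C3, hC3, H3⟩ := tsum_eulerWeight_le m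
  obtain ⟨C4, hC4, H4⟩ := sum_eulerWeight_div_le m
  refine ⟨C1 * C2 * exp C3 * (1156 * 4 ^ m + C4), by positivity,
    fun R x η T ξ ξ' hR hRx hη hT hξ hξ' => ?_⟩
  have hl2 : 0 < log 2 := log_pos one_lt_two
  have hLlow : log 2 ≤ log R := log_le_log two_pos hR
  have hLx : log R ≤ log x := log_le_log (by linarith) hRx
  set L := log R with hL
  have hL0 : 0 < L := hl2.trans_le hLlow
  have hx0 : 0 < log x := hL0.trans_le hLx
  have hηL : log 2 ≤ η * L := by rwa [div_le_iff₀ hL0] at hη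
  have hη0 : 0 < η := pos_of_mul_pos_left (hl2.trans_le hηL) hL0.le
  set w := eulerWeight m (fourierPoint L ξ) (fourierPoint L ξ') with hw
  have hw0 : ∀ p, 0 ≤ w p := eulerWeight_nonneg _ _ _
  have hwW : ∀ p, w p ≤ 4 * 4 ^ m :=
    eulerWeight_le m (fourierPoint_re_pos hL0 ξ) (fourierPoint_re_pos hL0 ξ')
  set Y := ⌊R ^ η⌋₊ with hY
  have hRη : R ^ η = exp (η * L) := by rw [rpow_def_of_pos (by linarith), mul_comm]
  have hY2 : 2 ≤ Y := by
    rw [hY, Nat.le_floor_iff (by positivity), hRη]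
    calc ((2 : ℕ) : ℝ) = exp (log 2) := by rw [exp_log two_pos]; norm_num
      _ ≤ _ := exp_le_exp.2 hηL
  have hYL : log Y ≤ η * L := by
    rw [log_le_iff_le_exp (by positivity), ← hRη]
    exact Nat.floor_le (by positivity)
  set μ' := min ((η * T) ^ 2) √(η * T) with hμ
  have hμ0 : 0 ≤ μ' := by positivity
  have hJ : ∀ p ≤ Y, p.Prime → w p ≤ 1156 * 4 ^ m * μ' := by
    intro p hpY hp
    refine (eulerWeight_le_min m hL0 hT hξ hp).trans ?_
    have hlog : 0 ≤ log p := log_natCast_nonneg p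
    have hlp : log p ≤ η * L :=
      (log_le_log (by exact_mod_cast hp.pos) (by exact_mod_cast hpY)).trans hYL
    have hu : T / L * log p ≤ η * T := by
      calc _ ≤ T / L * (η * L) := by gcongr
        _ = _ := by field_simp
    gcongr
    refine le_min ((min_le_right _ _).trans (by gcongr)) ?_
    exact (min_one_sq_le_sqrt (by positivity)).trans (sqrt_le_sqrt hu)
  have h1 := H1 w hw0 hwW Y (1156 * 4 ^ m * μ') (by positivity) hJ x (by linarith)
  have h2 := H2 w hw0 hwW x (by linarith)
  have h3 := H3 L T (1 / log x) ξ ξ' hLlow hT (by positivity)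
    (one_div_le_one_div_of_le hL0 hLx) hξ hξ'
  have h4 := H4 L T η ξ ξ' Y hL0 hT hξ hY2 hYL
  set D := 1 + |ξ - ξ'| with hD
  have hD0 : 0 < D := by positivity
  have hT0 : 0 < T := by linarith
  have h5 : exp (∑' p : Nat.Primes, w p * (p : ℝ) ^ (-(1 + 1 / log x))) ≤
      log x / L * T ^ (2 * (m + 1)).choose (m + 1) / D ^ (2 * (2 * m).choose (m + 1)) * exp C3 := by
    refine (exp_le_exp.2 h3).trans (le_of_eq ?_)
    have hTpow : exp (((2 * (m + 1)).choose (m + 1) : ℕ) * log T) =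
        T ^ (2 * (m + 1)).choose (m + 1) := by
      rw [← log_pow, exp_log (by positivity)]
    have hDpow : exp (2 * ((2 * m).choose (m + 1) : ℕ) * log D) =
        D ^ (2 * (2 * m).choose (m + 1)) := by
      rw [show (2 : ℝ) * ((2 * m).choose (m + 1) : ℕ) * log D =
        ((2 * (2 * m).choose (m + 1) : ℕ) : ℝ) * log D by push_cast; ring, ← log_pow,
        exp_log (by positivity)]
    rw [one_div_one_div, exp_add, exp_sub, exp_add, exp_sub, exp_log hx0, exp_log hL0, hTpow,
      hDpow]
  have hsum : ∑ n ∈ (Finset.Icc 1 ⌊x⌋₊).filter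
      (fun n : ℕ => ∃ p : ℕ, p.Prime ∧ p ∣ n ∧ (p : ℝ) ≤ R ^ η),
      ‖moebiusSum (fourierPoint L ξ) n‖ ^ 2 * ‖moebiusSum (fourierPoint L ξ') n‖ ^ (2 * m) =
      ∑ n ∈ Finset.Icc 1 ⌊x⌋₊, smallPrimeWeight w Y n := by
    rw [Finset.sum_filter]
    refine Finset.sum_congr rfl fun n hn => ?_
    rw [smallPrimeWeight, ← primeWeight_eulerWeight m _ _
      (Nat.pos_of_ne_zero (by have := (Finset.mem_Icc.1 hn).1; omega)).ne']
    simp only [hY, Nat.le_floor_iff (show 0 ≤ R ^ η by positivity)]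
    split_ifs <;> rfl
  rw [hsum]
  refine h1.trans ?_
  calc _ ≤ C1 * (x / log x) * (1156 * 4 ^ m * μ' + C4 * μ') * (C2 * (log x / L *
        T ^ (2 * (m + 1)).choose (m + 1) / D ^ (2 * (2 * m).choose (m + 1)) * exp C3)) := by
        gcongr
        · exact Finset.sum_nonneg fun n _ => div_nonneg (primeWeight_nonneg hw0 n) (by positivity)
        · have : 0 ≤ x := by linarith
          positivity
        · have : 0 ≤ x := by linarith
          positivity
        · exact h2.trans (by gcongr)
    _ = _ := by field_simp

end

section

open MeasureTheory
open scoped FourierTransform SchwartzMap ContDiff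

theorem continuous_fourier_of_integrable {h : ℝ → ℂ} (hi : Integrable h) : Continuous (𝓕 h) :=
  VectorFourier.fourierIntegral_continuous Real.continuous_fourierChar continuous_inner hi

theorem memLp_two_fourier {h : ℝ → ℂ} (hi : Integrable h) (h2 : MemLp h 2 volume) :
    MemLp (𝓕 h) 2 volume := by
  set v : Lp ℂ 2 (volume : Measure ℝ) := 𝓕 (h2.toLp h) with hv
  have hcont : Continuous (𝓕 h) := continuous_fourier_of_integrable hi
  have hvL : MemLp (v : ℝ → ℂ) 2 := Lp.memLp v
  have key : ∀ᵐ x, (v : ℝ → ℂ) x = 𝓕 h x := by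
    refine ae_eq_of_integral_contDiff_smul_eq (hvL.locallyIntegrable (by norm_num))
      hcont.locallyIntegrable fun g hg hgs => ?_
    have hgc : HasCompactSupport (fun x => (g x : ℂ)) :=
      hgs.comp_left (g := fun y : ℝ => (y : ℂ)) (by simp)
    set ψ : 𝓢(ℝ, ℂ) := hgc.toSchwartzMap (Complex.ofRealCLM.contDiff.comp hg) with hψ
    have hψg : ∀ x, ψ x = (g x : ℂ) := fun x => rfl
    have e1 := DFunLike.congr_fun (Lp.fourier_toTemperedDistribution_eq (h2.toLp h)) ψ
    rw [TemperedDistribution.fourier_apply, Lp.toTemperedDistribution_apply,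
      Lp.toTemperedDistribution_apply, ← hv] at e1
    have e2 : ∫ x, (𝓕 ψ) x • (h2.toLp h : ℝ → ℂ) x = ∫ x, (𝓕 ψ) x • h x := by
      refine integral_congr_ae ?_
      filter_upwards [h2.coeFn_toLp] with x hx
      rw [hx]
    have e3 : ∫ x, (𝓕 ψ) x • h x = ∫ x, ψ x • 𝓕 h x := by
      have := VectorFourier.integral_fourierIntegral_smul_eq_flip (L := innerₗ ℝ)
        Real.continuous_fourierChar continuous_inner (ψ.integrable (μ := volume)) hi
      simpa using! this
    rw [e2, e3] at e1
    simpa [hψg] using e1.symm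
  exact hvL.ae_eq key

end

section

open MeasureTheory
open scoped FourierTransform ContDiff

theorem hasCompactSupport_iteratedDeriv {g : ℝ → ℂ} (hg : HasCompactSupport g) (n : ℕ) :
    HasCompactSupport (iteratedDeriv n g) := by
  induction n with
  | zero => simpa using hg
  | succ n ih => rw [iteratedDeriv_succ]; exact ih.deriv

theorem norm_fourier_le_integral (h : ℝ → ℂ) (ξ : ℝ) : ‖𝓕 h ξ‖ ≤ ∫ x, ‖h x‖ :=
  VectorFourier.norm_fourierIntegral_le_integral_norm _ _ _ _ _

theorem exists_norm_fourier_le {g : ℝ → ℂ} {A : ℕ} (hg : ContDiff ℝ A g)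
    (hgs : HasCompactSupport g) : ∃ ψ : ℝ → ℝ, Continuous ψ ∧ (∃ B, ∀ ξ, ψ ξ ≤ B) ∧
      MemLp ψ 2 volume ∧ ∀ ξ, (1 + |ξ| ^ A) * ‖𝓕 g ξ‖ ≤ ψ ξ := by
  have hci : ∀ n : ℕ, n ≤ A → Continuous (iteratedDeriv n g) := fun n hn =>
    hg.continuous_iteratedDeriv n (by exact_mod_cast hn)
  have hintegrable : ∀ n : ℕ, n ≤ A → Integrable (iteratedDeriv n g) := fun n hn =>
    (hci n hn).integrable_of_hasCompactSupport (hasCompactSupport_iteratedDeriv hgs n)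
  have hmem : ∀ n : ℕ, n ≤ A → MemLp (iteratedDeriv n g) 2 volume := fun n hn =>
    (hci n hn).memLp_of_hasCompactSupport (hasCompactSupport_iteratedDeriv hgs n)
  have hF := Real.fourier_iteratedDeriv (N := A) (n := A) (by exact_mod_cast hg)
    (fun n hn => hintegrable n (by exact_mod_cast hn)) le_rfl
  have hg0 : iteratedDeriv 0 g = g := iteratedDeriv_zero
  have h0 : Integrable g := hg0 ▸ hintegrable 0 (Nat.zero_le _)
  have h02 : MemLp g 2 volume := hg0 ▸ hmem 0 (Nat.zero_le _)
  refine ⟨fun ξ => ‖𝓕 g ξ‖ + ‖𝓕 (iteratedDeriv A g) ξ‖,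
    (continuous_fourier_of_integrable h0).norm.add
      (continuous_fourier_of_integrable (hintegrable A le_rfl)).norm,
    ⟨(∫ x, ‖g x‖) + ∫ x, ‖iteratedDeriv A g x‖, fun ξ => ?_⟩,
    (memLp_two_fourier h0 h02).norm.add
      (memLp_two_fourier (hintegrable A le_rfl) (hmem A le_rfl)).norm,
    fun ξ => ?_⟩
  · exact add_le_add (norm_fourier_le_integral g ξ) (norm_fourier_le_integral _ ξ)
  · rw [hF]
    simp only [norm_smul, norm_pow, norm_mul, Complex.norm_ofNat, Complex.norm_real,
      Complex.norm_I, mul_one, Real.norm_eq_abs]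
    rw [add_mul, one_mul]
    gcongr
    have := Real.pi_gt_three
    rw [abs_of_pos Real.pi_pos]
    nlinarith [abs_nonneg ξ]

theorem integrable_fourier {g : ℝ → ℂ} {A : ℕ} (hA : 2 ≤ A) (hg : ContDiff ℝ A g)
    (hgs : HasCompactSupport g) : Integrable (𝓕 g) := by
  obtain ⟨ψ, -, ⟨B, hB⟩, -, hψ⟩ := exists_norm_fourier_le hg hgs
  have hcont : Continuous (𝓕 g) := continuous_fourier_of_integrable
    (hg.continuous.integrable_of_hasCompactSupport hgs)
  refine ((integrable_inv_one_add_sq).const_mul (2 * B)).mono'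
    hcont.aestronglyMeasurable (Filter.Eventually.of_forall fun ξ => ?_)
  rw [← div_eq_mul_inv, le_div_iff₀ (by positivity)]
  have h1 : 1 + ξ ^ 2 ≤ 2 * (1 + |ξ| ^ A) := by
    rw [← sq_abs]
    rcases le_total |ξ| 1 with h | h
    · have := pow_le_one₀ (n := 2) (abs_nonneg ξ) h
      have : 0 ≤ |ξ| ^ A := by positivity
      linarith
    · have := pow_le_pow_right₀ h hA
      have : 0 ≤ |ξ| ^ A := by positivity
      linarith
  calc ‖𝓕 g ξ‖ * (1 + ξ ^ 2) ≤ ‖𝓕 g ξ‖ * (2 * (1 + |ξ| ^ A)) := by gcongr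
    _ = 2 * ((1 + |ξ| ^ A) * ‖𝓕 g ξ‖) := by ring
    _ ≤ 2 * B := by gcongr; exact (hψ ξ).trans (hB ξ)

/-- A compactly supported `g` with `f t = e^{-t} g t` for `t ≥ 0`. -/
theorem exists_hasCompactSupport_eq_exp_neg_mul {f : ℝ → ℝ} {A : ℕ} (hf : ContDiff ℝ A f)
    (hsupp : ∀ t : ℝ, 1 < t → f t = 0) : ∃ g : ℝ → ℂ, ContDiff ℝ A g ∧ HasCompactSupport g ∧
      ∀ t, 0 ≤ t → (f t : ℂ) = Real.exp (-t) * g t := by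
  set χ : ContDiffBump (0 : ℝ) := ⟨2, 3, by norm_num, by norm_num⟩ with hχ
  refine ⟨fun t => ((Real.exp t * f t * χ t : ℝ) : ℂ), ?_, ?_, fun t ht => ?_⟩
  · exact Complex.ofRealCLM.contDiff.comp ((Real.contDiff_exp.mul hf).mul χ.contDiff)
  · exact (HasCompactSupport.mul_left χ.hasCompactSupport).comp_left
      (g := fun y : ℝ => (y : ℂ)) (by simp)
  · rw [← Complex.ofReal_mul]
    congr 1
    rcases le_or_gt t 1 with h1 | h1
    · rw [χ.one_of_mem_closedBall, mul_one, ← mul_assoc, ← Real.exp_add]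
      · simp
      · rw [Metric.mem_closedBall, dist_zero_right, Real.norm_eq_abs, abs_of_nonneg ht]
        exact h1.trans (by norm_num)
    · simp [hsupp t h1]

end

section

open MeasureTheory Set
open scoped FourierTransform ContDiff ComplexConjugate

theorem lintegral_eq_setLIntegral_Ioi_add {F : ℝ → ENNReal} (hF : Measurable F) :
    ∫⁻ ξ, F ξ = ∫⁻ ξ in Ioi 0, (F ξ + F (-ξ)) := by
  have h1 := (Measure.measurePreserving_neg (volume : Measure ℝ)).setLIntegral_comp_preimage
    (measurableSet_Iic (a := (0 : ℝ))) hF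
  rw [neg_preimage, neg_Iic, neg_zero, ← setLIntegral_congr Ioi_ae_eq_Ici] at h1
  rw [lintegral_add_left hF, h1, ← compl_Ioi, lintegral_add_compl _ measurableSet_Ioi]

theorem norm_moebiusSum_conj (s : ℂ) (n : ℕ) : ‖moebiusSum (conj s) n‖ = ‖moebiusSum s n‖ := by
  rw [← RCLike.norm_conj (moebiusSum s n)]
  congr 1
  simp only [moebiusSum, map_sum, map_mul, map_intCast]
  refine Finset.sum_congr rfl fun d _ => ?_
  rw [← map_neg, Complex.cpow_conj]
  · simp
  · rw [Complex.natCast_arg]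
    exact Real.pi_pos.ne

theorem norm_moebiusSum_fourierPoint_neg (L ξ : ℝ) (n : ℕ) :
    ‖moebiusSum (fourierPoint L (-ξ)) n‖ = ‖moebiusSum (fourierPoint L ξ) n‖ := by
  rw [← norm_moebiusSum_conj]
  congr 2
  apply Complex.ext <;> simp [fourierPoint, neg_div]

theorem exp_mul_exp_eq_cpow (L ξ : ℝ) {d : ℕ} (hd : d ≠ 0) :
    (Real.exp (-(Real.log d / L)) : ℂ) *
      Complex.exp ((2 * Real.pi * (ξ * (Real.log d / L)) : ℝ) * Complex.I) =
      (d : ℂ) ^ (-fourierPoint L (-ξ)) := by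
  rw [Complex.cpow_def_of_ne_zero (by exact_mod_cast hd), Complex.ofReal_exp, ← Complex.exp_add,
    ← Complex.natCast_log]
  congr 1
  apply Complex.ext <;> simp [fourierPoint] <;> ring

theorem continuous_moebiusSum_fourierPoint (L : ℝ) (n : ℕ) :
    Continuous fun ξ => moebiusSum (fourierPoint L ξ) n := by
  refine continuous_finsetSum _ fun d hd => continuous_const.mul ?_
  have hd0 : (d : ℂ) ≠ 0 := by
    exact_mod_cast (Nat.pos_of_mem_divisors hd).ne'
  refine Continuous.const_cpow ?_ (Or.inl hd0)
  refine Continuous.neg ?_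
  have : (fun ξ => fourierPoint L ξ) =
      fun ξ : ℝ => ((1 / L : ℝ) : ℂ) + ((2 * Real.pi * ξ / L : ℝ) : ℂ) * Complex.I := by
    funext ξ
    apply Complex.ext <;> simp [fourierPoint]
  change Continuous fun ξ => fourierPoint L ξ
  rw [this]
  fun_prop

theorem Mf_eq_integral {f : ℝ → ℝ} {g : ℝ → ℂ} (hg : Continuous g) (hgi : Integrable g)
    (hgF : Integrable (𝓕 g)) (hfg : ∀ t, 0 ≤ t → (f t : ℂ) = Real.exp (-t) * g t) (n : ℕ) {R : ℝ}
    (hR : 1 ≤ R) :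
    (Mf f n R : ℂ) = ∫ ξ, 𝓕 g ξ * moebiusSum (fourierPoint (Real.log R) (-ξ)) n := by
  set L := Real.log R with hL
  have hL0 : 0 ≤ L := Real.log_nonneg hR
  have hinv : ∀ t, g t = ∫ ξ : ℝ, Complex.exp ((2 * Real.pi * (ξ * t) : ℝ) * Complex.I) * 𝓕 g ξ :=
      by
    intro t
    conv_lhs => rw [← hg.fourierInv_fourier_eq hgi hgF, Real.fourierInv_eq']
    refine integral_congr_ae (Filter.Eventually.of_forall fun ξ => ?_)
    simp [mul_comm]
  have hterm : ∀ d ∈ n.divisors, (f (Real.log d / L) : ℂ) =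
      ∫ ξ, 𝓕 g ξ * (d : ℂ) ^ (-fourierPoint L (-ξ)) := by
    intro d hd
    have hd0 : d ≠ 0 := (Nat.pos_of_mem_divisors hd).ne'
    rw [hfg _ (div_nonneg (Real.log_natCast_nonneg d) hL0), hinv, ← integral_const_mul]
    refine integral_congr_ae (Filter.Eventually.of_forall fun ξ => ?_)
    dsimp only
    rw [← exp_mul_exp_eq_cpow L ξ hd0]
    ring
  have hbdd : ∀ d ∈ n.divisors, Integrable fun ξ =>
      ((ArithmeticFunction.moebius d : ℤ) : ℂ) * (𝓕 g ξ * (d : ℂ) ^ (-fourierPoint L (-ξ))) := by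
    intro d hd
    have hd0 : d ≠ 0 := (Nat.pos_of_mem_divisors hd).ne'
    refine Integrable.const_mul ?_ _
    have e : ∀ ξ, 𝓕 g ξ * (d : ℂ) ^ (-fourierPoint L (-ξ)) =
      (Real.exp (-(Real.log d / L)) : ℂ) *
      (Complex.exp ((2 * Real.pi * (ξ * (Real.log d / L)) : ℝ) * Complex.I) * 𝓕 g ξ) := fun ξ => by
      rw [← exp_mul_exp_eq_cpow L ξ hd0]
      ring
    simp only [e]
    refine Integrable.const_mul ?_ _
    refine hgF.bdd_mul (c := 1) (Continuous.aestronglyMeasurable (by fun_prop)) ?_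
    exact Filter.Eventually.of_forall fun ξ => by rw [Complex.norm_exp_ofReal_mul_I]
  rw [Mf]
  push_cast
  simp only [moebiusSum, Finset.mul_sum]
  have e2 : ∀ ξ, ∀ d : ℕ, 𝓕 g ξ * (((ArithmeticFunction.moebius d : ℤ) : ℂ) *
      (d : ℂ) ^ (-fourierPoint L (-ξ))) = ((ArithmeticFunction.moebius d : ℤ) : ℂ) *
      (𝓕 g ξ * (d : ℂ) ^ (-fourierPoint L (-ξ))) := fun ξ d => by ring
  simp only [e2]
  rw [integral_finsetSum _ hbdd]
  refine Finset.sum_congr rfl fun d hd => ?_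
  rw [integral_const_mul, ← hterm d hd]

end

section

open MeasureTheory Set
open scoped FourierTransform

theorem dyadicBlock_one : dyadicBlock 1 = Icc 0 2 := by
  ext ξ
  simp [dyadicBlock]

theorem dyadicBlock_of_one_lt {T : ℝ} (hT : 1 < T) : dyadicBlock T = Icc T (2 * T) := by
  ext ξ
  constructor
  · rintro ⟨-, h1, h2⟩
    exact ⟨h2.resolve_left hT.ne', h1⟩
  · rintro ⟨h1, h2⟩
    exact ⟨by linarith, h2, Or.inr h1⟩

theorem measurableSet_dyadicBlock {T : ℝ} (hT : 1 ≤ T) : MeasurableSet (dyadicBlock T) := by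
  rcases hT.eq_or_lt with rfl | h
  · rw [dyadicBlock_one]
    exact measurableSet_Icc
  · rw [dyadicBlock_of_one_lt h]
    exact measurableSet_Icc

theorem dyadicBlock_subset_Icc (T : ℝ) : dyadicBlock T ⊆ Icc 0 (2 * T) :=
  fun _ hξ => ⟨hξ.1, hξ.2.1⟩

theorem exists_majorant {f : ℝ → ℝ} {A : ℕ} (hA : 2 ≤ A) (hf : ContDiff ℝ A f)
    (hsupp : ∀ t : ℝ, 1 < t → f t = 0) :
    ∃ φ : ℝ → ℝ, Continuous φ ∧ (∀ ξ, 0 ≤ φ ξ) ∧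
      (∀ n R, 1 ≤ R → ENNReal.ofReal |Mf f n R| ≤ ∫⁻ ξ in Ioi 0,
        ENNReal.ofReal (φ ξ * ‖moebiusSum (fourierPoint (Real.log R) ξ) n‖)) ∧
      ∃ K : ℝ, 0 < K ∧ (∀ T, 1 ≤ T → ∀ ξ ∈ dyadicBlock T, φ ξ ≤ K / T ^ A) ∧
        ∀ T, 1 ≤ T → ∫⁻ ξ in dyadicBlock T, ENNReal.ofReal (φ ξ ^ 2) ≤
          ENNReal.ofReal (K / T ^ (2 * A)) := by
  obtain ⟨g, hg, hgs, hfg⟩ := exists_hasCompactSupport_eq_exp_neg_mul hf hsupp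
  obtain ⟨ψ, hψc, ⟨B, hB⟩, hψ2, hψ⟩ := exists_norm_fourier_le hg hgs
  have hgi : Integrable g := hg.continuous.integrable_of_hasCompactSupport hgs
  have hFc : Continuous (𝓕 g) := continuous_fourier_of_integrable hgi
  set φ : ℝ → ℝ := fun ξ => ‖𝓕 g ξ‖ + ‖𝓕 g (-ξ)‖ with hφ
  have hφ0 : ∀ ξ, 0 ≤ φ ξ := fun ξ => by positivity
  have hψ0 : ∀ ξ, 0 ≤ ψ ξ := fun ξ => le_trans (by positivity) (hψ ξ)
  set Ψ : ℝ → ℝ := fun ξ => ψ ξ + ψ (-ξ) with hΨ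
  have hΨ0 : ∀ ξ, 0 ≤ Ψ ξ := fun ξ => add_nonneg (hψ0 _) (hψ0 _)
  have hΨ2 : MemLp Ψ 2 volume :=
    hψ2.add (hψ2.comp_measurePreserving (Measure.measurePreserving_neg volume))
  have hblock : ∀ T, 1 ≤ T → ∀ ξ ∈ dyadicBlock T, φ ξ ≤ Ψ ξ / T ^ A := by
    intro T hT ξ hξ
    have hT0 : 0 < T := by linarith
    have hTξ : T ^ A ≤ 1 + |ξ| ^ A := by
      rcases hξ.2.2 with rfl | h
      · rw [one_pow]
        exact le_add_of_nonneg_right (by positivity)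
      · have := pow_le_pow_left₀ hT0.le (h.trans (le_abs_self ξ)) A
        linarith
    rw [le_div_iff₀ (by positivity)]
    calc φ ξ * T ^ A ≤ φ ξ * (1 + |ξ| ^ A) := mul_le_mul_of_nonneg_left hTξ (hφ0 ξ)
      _ = (1 + |ξ| ^ A) * ‖𝓕 g ξ‖ + (1 + |-ξ| ^ A) * ‖𝓕 g (-ξ)‖ := by rw [abs_neg]; ring
      _ ≤ _ := add_le_add (hψ ξ) (hψ (-ξ))
  set I : ℝ := ∫ ξ, Ψ ξ ^ 2 with hI
  have hIi : Integrable (fun ξ => Ψ ξ ^ 2) := hΨ2.integrable_sq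
  have hI0 : 0 ≤ I := integral_nonneg fun ξ => sq_nonneg _
  refine ⟨φ, by fun_prop, hφ0, fun n R hR => ?_, 2 * |B| + I + 1, by positivity,
    fun T hT ξ hξ => ?_, fun T hT => ?_⟩
  · set L := Real.log R
    set G : ℝ → ℝ := fun ξ => ‖moebiusSum (fourierPoint L ξ) n‖ with hG
    have hGc : Continuous G := (continuous_moebiusSum_fourierPoint L n).norm
    have h := Mf_eq_integral hg.continuous hgi (integrable_fourier hA hg hgs) hfg n hR
    calc ENNReal.ofReal |Mf f n R| = ‖(Mf f n R : ℂ)‖ₑ := by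
          rw [← ofReal_norm, Complex.norm_real, Real.norm_eq_abs]
      _ ≤ ∫⁻ ξ, ‖𝓕 g ξ * moebiusSum (fourierPoint L (-ξ)) n‖ₑ := by
          rw [h]; exact enorm_integral_le_lintegral_enorm _
      _ = ∫⁻ ξ, ENNReal.ofReal (‖𝓕 g ξ‖ * G ξ) := by
          refine lintegral_congr fun ξ => ?_
          rw [← ofReal_norm, norm_mul, norm_moebiusSum_fourierPoint_neg]
      _ = ∫⁻ ξ in Ioi 0, (ENNReal.ofReal (‖𝓕 g ξ‖ * G ξ) +
            ENNReal.ofReal (‖𝓕 g (-ξ)‖ * G (-ξ))) :=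
          lintegral_eq_setLIntegral_Ioi_add (by fun_prop)
      _ = _ := by
          refine lintegral_congr fun ξ => ?_
          rw [← ENNReal.ofReal_add (by positivity) (by positivity), hφ, add_mul]
          simp only [hG, norm_moebiusSum_fourierPoint_neg]
  · refine (hblock T hT ξ hξ).trans ?_
    gcongr
    have := hB ξ
    have := hB (-ξ)
    have := le_abs_self B
    simp only [hΨ]
    linarith
  · have hT0 : 0 < T := by linarith
    calc ∫⁻ ξ in dyadicBlock T, ENNReal.ofReal (φ ξ ^ 2)
        ≤ ∫⁻ ξ in dyadicBlock T, ENNReal.ofReal (Ψ ξ ^ 2 / T ^ (2 * A)) := by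
          refine setLIntegral_mono' (measurableSet_dyadicBlock hT) fun ξ hξ =>
            ENNReal.ofReal_le_ofReal ?_
          calc φ ξ ^ 2 ≤ (Ψ ξ / T ^ A) ^ 2 := pow_le_pow_left₀ (hφ0 ξ) (hblock T hT ξ hξ) 2
            _ = _ := by rw [div_pow, ← pow_mul, mul_comm A]
      _ ≤ ∫⁻ ξ, ENNReal.ofReal (Ψ ξ ^ 2 / T ^ (2 * A)) := setLIntegral_le_lintegral _ _
      _ = ENNReal.ofReal (I / T ^ (2 * A)) := by
          rw [← ofReal_integral_eq_lintegral_ofReal (hIi.div_const _)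
            (Filter.Eventually.of_forall fun ξ => by positivity), integral_div]
      _ ≤ _ := by
          refine ENNReal.ofReal_le_ofReal ?_
          gcongr
          have := abs_nonneg B
          linarith

end

section

open MeasureTheory Set
open scoped ENNReal

theorem lintegral_pow_succ_le {α : Type*} [MeasurableSpace α] (μ : Measure α) {f : α → ℝ≥0∞}
    (hf : AEMeasurable f μ) (n : ℕ) :
    (∫⁻ x, f x ∂μ) ^ (n + 1) ≤ μ univ ^ n * ∫⁻ x, f x ^ (n + 1) ∂μ := by
  rcases n.eq_zero_or_pos with rfl | hn
  · simp
  have hn1 : (1 : ℝ) < n + 1 := by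
    have : (0 : ℝ) < n := by exact_mod_cast hn
    linarith
  have hn0 : (0 : ℝ) < n + 1 := by linarith
  have hpq := Real.HolderConjugate.conjExponent hn1
  have h := ENNReal.lintegral_mul_le_Lp_mul_Lq μ hpq hf (aemeasurable_const (b := (1 : ℝ≥0∞)))
  simp only [Pi.mul_apply, mul_one, ENNReal.one_rpow, lintegral_const, one_mul] at h
  have h2 := ENNReal.rpow_le_rpow h hn0.le
  rw [ENNReal.mul_rpow_of_nonneg _ _ hn0.le, ← ENNReal.rpow_mul, ← ENNReal.rpow_mul] at h2
  have e1 : 1 / ((n : ℝ) + 1) * (n + 1) = 1 := by field_simp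
  have e2 : 1 / Real.conjExponent ((n : ℝ) + 1) * (n + 1) = n := by
    rw [Real.conjExponent]
    have : (n : ℝ) ≠ 0 := by exact_mod_cast hn.ne'
    field_simp
    ring
  rw [e1, e2, ENNReal.rpow_one, ENNReal.rpow_natCast] at h2
  have e3 : ∀ y : ℝ≥0∞, y ^ ((n : ℝ) + 1) = y ^ (n + 1) := fun y => by
    rw [← ENNReal.rpow_natCast]; push_cast; rfl
  simp only [e3] at h2
  rwa [mul_comm]

theorem lintegral_mul_pow_succ_le {α : Type*} [MeasurableSpace α] (μ : Measure α)
    {w f : α → ℝ≥0∞} (hw : Measurable w) (hf : Measurable f) (n : ℕ) :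
    (∫⁻ x, w x * f x ∂μ) ^ (n + 1) ≤ (∫⁻ x, w x ∂μ) ^ n * ∫⁻ x, w x * f x ^ (n + 1) ∂μ := by
  have h := lintegral_pow_succ_le (μ.withDensity w) hf.aemeasurable n
  rw [lintegral_withDensity_eq_lintegral_mul _ hw hf,
    lintegral_withDensity_eq_lintegral_mul _ hw (hf.pow_const _),
    withDensity_apply _ MeasurableSet.univ, Measure.restrict_univ] at h
  exact h

theorem lintegral_pow_le_lintegral_lintegral (m : ℕ) : ∃ C : ℝ≥0∞, C ≠ ⊤ ∧
    ∀ (S : Set ℝ) (a : ℝ → ℝ≥0∞), Measurable a → ∫⁻ ξ in S, a ξ ≠ ⊤ →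
      (∫⁻ ξ in S, a ξ) ^ (2 * (m + 1)) ≤ C * ∫⁻ ξ in S, ∫⁻ ξ' in S,
        a ξ ^ 2 * a ξ' ^ (2 * m) * ENNReal.ofReal (1 + |ξ - ξ'|) ^ (3 * m) := by
  set V : ℝ≥0∞ := ∫⁻ t : ℝ, ENNReal.ofReal ((1 + ‖t‖) ^ (-(3 / 2 : ℝ))) with hV
  have hVtop : V ≠ ⊤ := by
    refine (finite_integral_one_add_norm (E := ℝ) (μ := volume) (r := 3 / 2) ?_).ne
    norm_num
  refine ⟨2 ^ (2 * m + 1) * V ^ (2 * m), ENNReal.mul_ne_top (by finiteness) (by finiteness),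
    fun S a ha hX => ?_⟩
  set X := ∫⁻ ξ in S, a ξ with hXdef
  set N : ℝ → ℝ≥0∞ := fun ξ => ∫⁻ ξ' in S, min (a ξ) (a ξ') with hN
  have hmin : Measurable (fun z : ℝ × ℝ => min (a z.1) (a z.2)) :=
    (ha.comp measurable_fst).min (ha.comp measurable_snd)
  have hNm : Measurable N := hmin.lintegral_prod_right'
  have hX2 : X ^ 2 ≤ 2 * ∫⁻ ξ in S, a ξ * N ξ := by
    have e1 : ∫⁻ ξ in S, a ξ * N ξ = ∫⁻ ξ in S, ∫⁻ ξ' in S, a ξ * min (a ξ) (a ξ') := by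
      refine lintegral_congr fun ξ => ?_
      rw [hN, lintegral_const_mul _ (measurable_const.min ha)]
    have e2 : ∫⁻ ξ in S, a ξ * N ξ = ∫⁻ ξ in S, ∫⁻ ξ' in S, a ξ' * min (a ξ) (a ξ') := by
      rw [e1, lintegral_lintegral_swap]
      · simp only [min_comm]
      · exact ((ha.comp measurable_fst).mul hmin).aemeasurable
    rw [two_mul]
    nth_rewrite 1 [e1]
    rw [e2, ← lintegral_add_left]
    · rw [sq, hXdef, ← lintegral_mul_const _ ha]
      refine lintegral_mono fun ξ => ?_
      dsimp only
      rw [← lintegral_const_mul _ ha, ← lintegral_add_left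
        (f := fun ξ' => a ξ * min (a ξ) (a ξ')) (measurable_const.mul (measurable_const.min ha))]
      refine lintegral_mono fun ξ' => ?_
      dsimp only
      rcases le_total (a ξ) (a ξ') with h | h
      · rw [min_eq_left h, mul_comm]; exact le_add_self
      · rw [min_eq_right h]; exact le_self_add
    · exact ((ha.comp measurable_fst).mul hmin).lintegral_prod_right'
  have hholder : X ^ (2 * (m + 1)) ≤ 2 ^ (2 * m + 1) * ∫⁻ ξ in S, a ξ * N ξ ^ (2 * m + 1) := by
    by_cases h0 : X = 0
    · rw [h0, zero_pow (by omega)]; exact zero_le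
    have h := lintegral_mul_pow_succ_le (volume.restrict S) ha hNm (2 * m)
    rw [← hXdef] at h
    have h3 : X ^ (2 * m) * X ^ (2 * (m + 1)) ≤
        X ^ (2 * m) * (2 ^ (2 * m + 1) * ∫⁻ ξ in S, a ξ * N ξ ^ (2 * m + 1)) := by
      calc _ = (X ^ 2) ^ (2 * m + 1) := by ring
        _ ≤ (2 * ∫⁻ ξ in S, a ξ * N ξ) ^ (2 * m + 1) := by gcongr
        _ ≤ 2 ^ (2 * m + 1) *
            (X ^ (2 * m) * ∫⁻ ξ in S, a ξ * N ξ ^ (2 * m + 1)) := by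
          rw [mul_pow]; gcongr
        _ = _ := by ring
    exact (ENNReal.mul_le_mul_iff_right (pow_ne_zero _ h0) (by finiteness)).1 h3
  refine hholder.trans ?_
  rw [mul_assoc]
  gcongr
  have hD : Measurable fun z : ℝ × ℝ => ENNReal.ofReal ((1 + |z.1 - z.2|) ^ (-(3 / 2 : ℝ))) := by
    fun_prop
  rw [← lintegral_const_mul]
  swap
  · refine Measurable.lintegral_prod_right' (f := fun z : ℝ × ℝ =>
      a z.1 ^ 2 * a z.2 ^ (2 * m) * ENNReal.ofReal (1 + |z.1 - z.2|) ^ (3 * m)) ?_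
    have h1 : Measurable fun z : ℝ × ℝ => a z.1 := ha.comp measurable_fst
    have h2 : Measurable fun z : ℝ × ℝ => a z.2 := ha.comp measurable_snd
    fun_prop
  refine lintegral_mono fun ξ => ?_
  dsimp only
  set w : ℝ → ℝ≥0∞ := fun ξ' => ENNReal.ofReal ((1 + |ξ - ξ'|) ^ (-(3 / 2 : ℝ))) with hw
  have hwm : Measurable w := by fun_prop
  have hw0 : ∀ ξ', w ξ' ≠ 0 := fun ξ' => by
    have : 0 < (1 + |ξ - ξ'|) ^ (-(3 / 2 : ℝ)) := by positivity
    simpa [hw] using this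
  have hwV : ∫⁻ ξ' in S, w ξ' ≤ V := by
    refine (setLIntegral_le_lintegral _ _).trans (le_of_eq ?_)
    rw [hV,
      ← lintegral_sub_left_eq_self (fun t : ℝ => ENNReal.ofReal ((1 + ‖t‖) ^ (-(3 / 2 : ℝ)))) ξ]
    rfl
  have hwD : ∀ ξ', (w ξ')⁻¹ ^ (2 * m) = ENNReal.ofReal (1 + |ξ - ξ'|) ^ (3 * m) := fun ξ' => by
    have hpos : 0 < 1 + |ξ - ξ'| := by positivity
    rw [hw, ← ENNReal.ofReal_inv_of_pos (by positivity), ← ENNReal.ofReal_pow (by positivity),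
      ← ENNReal.ofReal_pow (by positivity), ← Real.rpow_neg hpos.le,
        ← Real.rpow_mul_natCast hpos.le,
      ← Real.rpow_natCast]
    congr 2
    push_cast
    ring
  have hNle : N ξ ^ (2 * m + 1) ≤ V ^ (2 * m) * ∫⁻ ξ' in S,
      ENNReal.ofReal (1 + |ξ - ξ'|) ^ (3 * m) * min (a ξ) (a ξ') ^ (2 * m + 1) := by
    have h := lintegral_mul_pow_succ_le (volume.restrict S) hwm
      (f := fun ξ' => (w ξ')⁻¹ * min (a ξ) (a ξ')) (hwm.inv.mul (measurable_const.min ha)) (2 * m)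
    have e1 : ∀ ξ', w ξ' * ((w ξ')⁻¹ * min (a ξ) (a ξ')) = min (a ξ) (a ξ') := fun ξ' => by
      rw [← mul_assoc, ENNReal.mul_inv_cancel (hw0 ξ') ENNReal.ofReal_ne_top, one_mul]
    have e2 : ∀ ξ', w ξ' * ((w ξ')⁻¹ * min (a ξ) (a ξ')) ^ (2 * m + 1) =
        ENNReal.ofReal (1 + |ξ - ξ'|) ^ (3 * m) * min (a ξ) (a ξ') ^ (2 * m + 1) := fun ξ' => by
      rw [mul_pow, ← mul_assoc, pow_succ (w ξ')⁻¹, mul_comm _ (w ξ')⁻¹, ← mul_assoc,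
        ENNReal.mul_inv_cancel (hw0 ξ') ENNReal.ofReal_ne_top, one_mul, hwD]
    simp only [e1, e2] at h
    refine h.trans ?_
    gcongr
  have hm1 : Measurable fun ξ' => ENNReal.ofReal (1 + |ξ - ξ'|) ^ (3 * m) *
      min (a ξ) (a ξ') ^ (2 * m + 1) :=
    Measurable.mul (by fun_prop) ((measurable_const.min ha).pow_const _)
  calc _ ≤ a ξ * (V ^ (2 * m) * ∫⁻ ξ' in S,
      ENNReal.ofReal (1 + |ξ - ξ'|) ^ (3 * m) * min (a ξ) (a ξ') ^ (2 * m + 1)) := by gcongr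
    _ = V ^ (2 * m) * ∫⁻ ξ' in S,
      a ξ * (ENNReal.ofReal (1 + |ξ - ξ'|) ^ (3 * m) * min (a ξ) (a ξ') ^ (2 * m + 1)) := by
      rw [lintegral_const_mul _ hm1]; ring
    _ ≤ _ := by
      refine mul_le_mul_right (lintegral_mono fun ξ' => ?_) _
      calc _ = a ξ * min (a ξ) (a ξ') * min (a ξ) (a ξ') ^ (2 * m) *
            ENNReal.ofReal (1 + |ξ - ξ'|) ^ (3 * m) := by ring
        _ ≤ a ξ * a ξ * a ξ' ^ (2 * m) * ENNReal.ofReal (1 + |ξ - ξ'|) ^ (3 * m) := by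
          gcongr
          · exact min_le_left _ _
          · exact min_le_right _ _
        _ = _ := by ring

end

section

open MeasureTheory Set
open scoped ENNReal

theorem three_mul_le_two_mul_choose (m : ℕ) :
    3 * m ≤ 2 * (2 * m).choose (m + 1) + min m 1 := by
  rcases m with _ | _ | _ | m
  · simp
  · decide
  · decide
  · have h1 : (m + 6).choose (m + 4) ≤ (2 * (m + 3)).choose (m + 3 + 1) :=
      Nat.choose_le_choose _ (by omega)
    have h2 : (m + 6).choose (m + 4) = (m + 6).choose 2 := by
      rw [← Nat.choose_symm (by omega)]
      congr 1
      omega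
    rw [h2, Nat.choose_two_right] at h1
    have h3 : (m + 6) * (m + 5) = 2 * ((m + 6) * (m + 6 - 1) / 2) :=
      (Nat.mul_div_cancel' (Nat.even_mul_pred_self (m + 6)).two_dvd).symm
    have h4 : (m + 6) * (m + 5) ≤ 2 * (2 * (m + 3)).choose (m + 3 + 1) :=
      h3.le.trans (Nat.mul_le_mul_left 2 h1)
    have h5 : 3 * (m + 3) ≤ (m + 6) * (m + 5) := by nlinarith
    exact (h5.trans h4).trans (Nat.le_add_right _ _)

/-- The distance between points of a block is controlled, up to one factor of the block length. -/
theorem one_add_abs_sub_pow_le (m : ℕ) {T ξ ξ' : ℝ} (hT : 1 ≤ T) (hξ : ξ ∈ dyadicBlock T)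
    (hξ' : ξ' ∈ dyadicBlock T) :
    (1 + |ξ - ξ'|) ^ (3 * m) / (1 + |ξ - ξ'|) ^ (2 * (2 * m).choose (m + 1)) ≤
      (3 * T) ^ (min m 1) := by
  set D := 1 + |ξ - ξ'| with hD
  have hD1 : 1 ≤ D := le_add_of_nonneg_right (abs_nonneg _)
  have hDT : D ≤ 3 * T := by
    have h1 := dyadicBlock_subset_Icc T hξ
    have h2 := dyadicBlock_subset_Icc T hξ'
    have : |ξ - ξ'| ≤ 2 * T := by
      rw [abs_le]
      constructor <;> linarith [h1.1, h1.2, h2.1, h2.2]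
    linarith
  rw [div_le_iff₀ (by positivity)]
  calc D ^ (3 * m) ≤ D ^ (2 * (2 * m).choose (m + 1) + min m 1) :=
        pow_le_pow_right₀ hD1 (three_mul_le_two_mul_choose m)
    _ = D ^ (min m 1) * D ^ (2 * (2 * m).choose (m + 1)) := by rw [pow_add, mul_comm]
    _ ≤ _ := by gcongr

theorem exists_lintegral_pow_le {φ : ℝ → ℝ} (hφ0 : ∀ ξ, 0 ≤ φ ξ) {A : ℕ}
    {K : ℝ} (hK : 0 < K) (hφ1 : ∀ T, 1 ≤ T → ∀ ξ ∈ dyadicBlock T, φ ξ ≤ K / T ^ A)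
    (hφ2 : ∀ T, 1 ≤ T → ∫⁻ ξ in dyadicBlock T, ENNReal.ofReal (φ ξ ^ 2) ≤
      ENNReal.ofReal (K / T ^ (2 * A))) (m : ℕ) : ∃ K' : ℝ, 0 < K' ∧ ∀ T, 1 ≤ T →
    ENNReal.ofReal ((3 * T) ^ (min m 1)) * ∫⁻ ξ in dyadicBlock T, ENNReal.ofReal (φ ξ ^ (2 * m)) ≤
      ENNReal.ofReal (K' * T / T ^ (2 * m * A)) := by
  rcases m with _ | m
  · refine ⟨2, two_pos, fun T hT => ?_⟩
    simp only [Nat.zero_min, pow_zero, ENNReal.ofReal_one, mul_zero, one_mul, zero_mul, div_one,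
      lintegral_const, Measure.restrict_apply MeasurableSet.univ, univ_inter]
    refine (measure_mono (dyadicBlock_subset_Icc T)).trans ?_
    rw [Real.volume_Icc, sub_zero]
  · refine ⟨3 * K ^ (2 * m) * K, by positivity, fun T hT => ?_⟩
    have hT0 : 0 < T := by linarith
    have h1 : min (m + 1) 1 = 1 := by simp
    rw [h1, pow_one]
    calc _ ≤ ENNReal.ofReal (3 * T) * ∫⁻ ξ in dyadicBlock T,
          ENNReal.ofReal ((K / T ^ A) ^ (2 * m)) * ENNReal.ofReal (φ ξ ^ 2) := by
          refine mul_le_mul_right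
            (setLIntegral_mono' (measurableSet_dyadicBlock hT) fun ξ hξ => ?_) _
          rw [← ENNReal.ofReal_mul (by positivity)]
          refine ENNReal.ofReal_le_ofReal ?_
          rw [show 2 * (m + 1) = 2 * m + 2 by ring, pow_add]
          gcongr
          · exact hφ0 ξ
          · exact hφ1 T hT ξ hξ
      _ = ENNReal.ofReal (3 * T) * (ENNReal.ofReal ((K / T ^ A) ^ (2 * m)) *
          ∫⁻ ξ in dyadicBlock T, ENNReal.ofReal (φ ξ ^ 2)) := by
          rw [lintegral_const_mul' _ _ ENNReal.ofReal_ne_top]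
      _ ≤ ENNReal.ofReal (3 * T) * (ENNReal.ofReal ((K / T ^ A) ^ (2 * m)) *
          ENNReal.ofReal (K / T ^ (2 * A))) := by
          gcongr
          exact hφ2 T hT
      _ = _ := by
          rw [← ENNReal.ofReal_mul (by positivity), ← ENNReal.ofReal_mul (by positivity)]
          congr 1
          rw [div_pow]
          field_simp
          ring

theorem exists_sum_block_le {A m : ℕ} (hA : (2 * (m + 1)).choose (m + 1) + 2 ≤ 2 * (m + 1) * A)
    {φ : ℝ → ℝ} (hφc : Continuous φ) (hφ0 : ∀ ξ, 0 ≤ φ ξ)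
    {K : ℝ} (hK : 0 < K) (hφ1 : ∀ T, 1 ≤ T → ∀ ξ ∈ dyadicBlock T, φ ξ ≤ K / T ^ A)
    (hφ2 : ∀ T, 1 ≤ T → ∫⁻ ξ in dyadicBlock T, ENNReal.ofReal (φ ξ ^ 2) ≤
      ENNReal.ofReal (K / T ^ (2 * A))) :
    ∃ C : ℝ, 0 < C ∧ ∀ R x η T : ℝ, 2 ≤ R → R ≤ x →
      Real.log 2 / Real.log R ≤ η → 1 ≤ T →
      ∑ n ∈ (Finset.Icc 1 ⌊x⌋₊).filter (fun n : ℕ => ∃ p : ℕ, p.Prime ∧ p ∣ n ∧ (p : ℝ) ≤ R ^ η),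
        (∫⁻ ξ in dyadicBlock T,
          ENNReal.ofReal (φ ξ * ‖moebiusSum (fourierPoint (Real.log R) ξ) n‖)) ^ (2 * (m + 1)) ≤
      ENNReal.ofReal (C * (x / Real.log R * min ((η * T) ^ 2) √(η * T) / T)) := by
  obtain ⟨C1, hC1, H1⟩ := sum_norm_moebiusSum_le m
  obtain ⟨C2, hC2, H2⟩ := lintegral_pow_le_lintegral_lintegral m
  obtain ⟨K', hK', H3⟩ := exists_lintegral_pow_le hφ0 hK hφ1 hφ2 m
  refine ⟨(C2.toReal + 1) * C1 * K * K', by positivity, fun R x η T hR hRx hη hT => ?_⟩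
  set L := Real.log R with hL
  have hL0 : 0 < L := Real.log_pos (by linarith)
  have hx0 : 0 < x := by linarith
  have hT0 : 0 < T := by linarith
  set F := (Finset.Icc 1 ⌊x⌋₊).filter (fun n : ℕ => ∃ p : ℕ, p.Prime ∧ p ∣ n ∧ (p : ℝ) ≤ R ^ η)
  set S := dyadicBlock T with hS
  have hSm : MeasurableSet S := measurableSet_dyadicBlock hT
  set G : ℕ → ℝ → ℝ := fun n ξ => ‖moebiusSum (fourierPoint L ξ) n‖ with hG
  have hGc : ∀ n, Continuous (G n) := fun n => (continuous_moebiusSum_fourierPoint L n).norm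
  have hG0 : ∀ n ξ, 0 ≤ G n ξ := fun n ξ => norm_nonneg _
  set μ' := min ((η * T) ^ 2) √(η * T) with hμ
  have hμ0 : 0 ≤ μ' := by positivity
  set b := (2 * (m + 1)).choose (m + 1) with hb
  set e := 2 * (2 * m).choose (m + 1) with he
  have hX : ∀ n, ∫⁻ ξ in S, ENNReal.ofReal (φ ξ * G n ξ) ≠ ⊤ := by
    intro n
    have hc : Continuous fun ξ => φ ξ * G n ξ := hφc.mul (hGc n)
    have hi : IntegrableOn (fun ξ => φ ξ * G n ξ) S :=
      (hc.continuousOn.integrableOn_compact isCompact_Icc).mono_set (dyadicBlock_subset_Icc T)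
    exact hi.lintegral_lt_top.ne
  set c := C1 * (x / L * μ' * T ^ b) with hc
  have hc0 : 0 ≤ c := by positivity
  set J : ℕ → ℝ → ℝ → ℝ≥0∞ := fun n ξ ξ' => ENNReal.ofReal (φ ξ * G n ξ) ^ 2 *
    ENNReal.ofReal (φ ξ' * G n ξ') ^ (2 * m) * ENNReal.ofReal (1 + |ξ - ξ'|) ^ (3 * m) with hJ
  have ham : ∀ n, Measurable fun ξ => ENNReal.ofReal (φ ξ * G n ξ) := fun n =>
    ENNReal.measurable_ofReal.comp (hφc.mul (hGc n)).measurable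
  have hJm : ∀ n, Measurable (Function.uncurry (J n)) := fun n => by
    refine ((((ham n).comp measurable_fst).pow_const 2).mul
      (((ham n).comp measurable_snd).pow_const (2 * m))).mul ?_
    fun_prop
  calc _ ≤ ∑ n ∈ F, C2 * ∫⁻ ξ in S, ∫⁻ ξ' in S, J n ξ ξ' := by
        refine Finset.sum_le_sum fun n _ => ?_
        exact H2 S _ (ham n) (hX n)
    _ = C2 * ∫⁻ ξ in S, ∫⁻ ξ' in S, ∑ n ∈ F, J n ξ ξ' := by
        rw [← Finset.mul_sum, ← lintegral_finsetSum]
        · congr 2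
          funext ξ
          rw [lintegral_finsetSum]
          exact fun n _ => (hJm n).of_uncurry_left
        · exact fun n _ => (hJm n).lintegral_prod_right'
    _ ≤ C2 * ∫⁻ ξ in S, ∫⁻ ξ' in S, ENNReal.ofReal c * ENNReal.ofReal ((3 * T) ^ (min m 1)) *
          ENNReal.ofReal (φ ξ ^ 2) * ENNReal.ofReal (φ ξ' ^ (2 * m)) := by
        refine mul_le_mul_right (setLIntegral_mono' hSm fun ξ hξ =>
          setLIntegral_mono' hSm fun ξ' hξ' => ?_) _
        set D := 1 + |ξ - ξ'| with hD
        have hD0 : 0 < D := by positivity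
        have e1 : ∀ n, J n ξ ξ' = ENNReal.ofReal (φ ξ ^ 2 * φ ξ' ^ (2 * m) * D ^ (3 * m) *
            (G n ξ ^ 2 * G n ξ' ^ (2 * m))) := fun n => by
          have := hφ0 ξ
          have := hφ0 ξ'
          have := hG0 n ξ
          have := hG0 n ξ'
          simp only [hJ]
          rw [← ENNReal.ofReal_pow (by positivity), ← ENNReal.ofReal_pow (by positivity),
            ← ENNReal.ofReal_pow (by positivity), ← ENNReal.ofReal_mul (by positivity),
            ← ENNReal.ofReal_mul (by positivity), mul_pow, mul_pow]
          congr 1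
          ring
        have h0 := hφ0 ξ
        have h0' := hφ0 ξ'
        simp only [e1]
        rw [← ENNReal.ofReal_sum_of_nonneg (fun n _ => by
            have := hG0 n ξ
            have := hG0 n ξ'
            positivity),
          ← ENNReal.ofReal_mul hc0, ← ENNReal.ofReal_mul (by positivity),
          ← ENNReal.ofReal_mul (by positivity), ← Finset.mul_sum]
        refine ENNReal.ofReal_le_ofReal ?_
        calc _ ≤ φ ξ ^ 2 * φ ξ' ^ (2 * m) * D ^ (3 * m) *
              (C1 * (x / L * μ' * T ^ b / D ^ e)) :=
              mul_le_mul_of_nonneg_left (H1 R x η T ξ ξ' hR hRx hη hT hξ hξ') (by positivity)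
          _ = c * (D ^ (3 * m) / D ^ e) * φ ξ ^ 2 * φ ξ' ^ (2 * m) := by rw [hc]; ring
          _ ≤ _ := by
              gcongr
              exact one_add_abs_sub_pow_le m hT hξ hξ'
    _ = C2 * ENNReal.ofReal c * (∫⁻ ξ in S, ENNReal.ofReal (φ ξ ^ 2)) *
        (ENNReal.ofReal ((3 * T) ^ (min m 1)) * ∫⁻ ξ' in S, ENNReal.ofReal (φ ξ' ^ (2 * m))) := by
        have e1 : ∀ ξ, ∫⁻ ξ' in S, ENNReal.ofReal c * ENNReal.ofReal ((3 * T) ^ (min m 1)) *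
          ENNReal.ofReal (φ ξ ^ 2) * ENNReal.ofReal (φ ξ' ^ (2 * m)) =
          ENNReal.ofReal (φ ξ ^ 2) * (ENNReal.ofReal c * ENNReal.ofReal ((3 * T) ^ (min m 1)) *
            ∫⁻ ξ' in S, ENNReal.ofReal (φ ξ' ^ (2 * m))) := fun ξ => by
          rw [lintegral_const_mul _ (by fun_prop)]
          ring
        simp only [e1]
        rw [lintegral_mul_const _ (by fun_prop)]
        ring
    _ ≤ C2 * ENNReal.ofReal c * ENNReal.ofReal (K / T ^ (2 * A)) *
        ENNReal.ofReal (K' * T / T ^ (2 * m * A)) :=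
        mul_le_mul' (mul_le_mul_right (hφ2 T hT) _) (H3 T hT)
    _ = ENNReal.ofReal (C2.toReal * c * (K / T ^ (2 * A)) * (K' * T / T ^ (2 * m * A))) := by
        have h1 : 0 ≤ C2.toReal * c := mul_nonneg ENNReal.toReal_nonneg hc0
        rw [ENNReal.ofReal_mul (mul_nonneg h1 (by positivity)), ENNReal.ofReal_mul h1,
          ENNReal.ofReal_mul (p := C2.toReal) ENNReal.toReal_nonneg, ENNReal.ofReal_toReal hC2]
    _ ≤ _ := by
        refine ENNReal.ofReal_le_ofReal ?_
        have hTb : T ^ b * T / T ^ (2 * (m + 1) * A) ≤ 1 / T := by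
          rw [div_le_div_iff₀ (by positivity) hT0, one_mul]
          calc T ^ b * T * T = T ^ (b + 2) := by ring
            _ ≤ _ := pow_le_pow_right₀ hT hA
        calc C2.toReal * c * (K / T ^ (2 * A)) * (K' * T / T ^ (2 * m * A))
            = C2.toReal * C1 * K * K' * (x / L * μ') * (T ^ b * T / T ^ (2 * (m + 1) * A)) := by
              rw [hc, show 2 * (m + 1) * A = 2 * A + 2 * m * A by ring, pow_add]
              field_simp
          _ ≤ (C2.toReal + 1) * C1 * K * K' * (x / L * μ') * (1 / T) := by
              gcongr
              linarith
          _ = _ := by ring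

end

section

open MeasureTheory Set
open scoped ENNReal

theorem tsum_mul_pow_succ_le (u f : ℕ → ℝ≥0∞) (n : ℕ) :
    (∑' j, u j * f j) ^ (n + 1) ≤ (∑' j, u j) ^ n * ∑' j, u j * f j ^ (n + 1) := by
  simpa only [lintegral_count] using lintegral_mul_pow_succ_le Measure.count
    (measurable_from_top (f := u)) (measurable_from_top (f := f)) n

theorem tsum_pow_natAbs_sub_le (b : ℝ≥0∞) (i : ℕ) :
    ∑' j : ℕ, b ^ ((j : ℤ) - i).natAbs ≤ ∑' l : ℤ, b ^ l.natAbs :=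
  ENNReal.tsum_comp_le_tsum_of_injective (f := fun j : ℕ => (j : ℤ) - i)
    (fun j j' h => by simpa using h) fun l : ℤ => b ^ l.natAbs

theorem tsum_pow_natAbs_ne_top {b : ℝ≥0∞} (hb : b < 1) : ∑' l : ℤ, b ^ l.natAbs ≠ ⊤ := by
  lift b to NNReal using hb.ne_top
  have hb1 : b < 1 := by exact_mod_cast hb
  have hs : Summable fun l : ℤ => b ^ l.natAbs := by
    have hgeom : Summable fun n : ℕ => (b : ℝ) ^ n :=
      summable_geometric_of_lt_one b.coe_nonneg (by exact_mod_cast hb1)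
    have hr : Summable fun l : ℤ => (b : ℝ) ^ l.natAbs :=
      Summable.of_nat_of_neg (by simpa using hgeom) (by simpa using hgeom)
    rw [← NNReal.summable_coe]
    simpa using hr
  simp only [← ENNReal.coe_pow]
  exact ENNReal.tsum_coe_ne_top_iff_summable.2 hs

theorem Ioi_subset_iUnion_dyadicBlock : Ioi (0 : ℝ) ⊆ ⋃ j : ℕ, dyadicBlock (2 ^ j) := by
  intro ξ hξ
  have h0 : 0 < ξ := hξ
  rw [mem_iUnion]
  rcases le_or_gt ξ 1 with h | h
  · exact ⟨0, h0.le, by norm_num; linarith, Or.inl (pow_zero _)⟩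
  · obtain ⟨j, hj1, hj2⟩ := exists_nat_pow_near h.le one_lt_two
    exact ⟨j, h0.le, by rw [pow_succ] at hj2; linarith, Or.inr hj1⟩

/-- With `2^{-i}` comparable to `η`, the block at height `2^j` contributes a geometrically small
amount in `|j - i|`. -/
theorem exists_min_sq_sqrt_le {η : ℝ} (hη0 : 0 < η) (hη1 : η ≤ 1) : ∃ i : ℕ, ∀ j : ℕ,
    min ((η * 2 ^ j) ^ 2) √(η * 2 ^ j) / 2 ^ j ≤ 2 * η * √(1 / 2) ^ ((j : ℤ) - i).natAbs := by
  obtain ⟨i, hi1, hi2⟩ := exists_nat_pow_near (one_le_one_div hη0 hη1) one_lt_two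
  rw [le_div_iff₀ hη0] at hi1
  rw [div_lt_iff₀ hη0, pow_succ] at hi2
  refine ⟨i, fun j => ?_⟩
  set c := √(1 / 2 : ℝ) with hc
  have hc0 : 0 < c := by positivity
  have hc2 : c ^ 2 = 1 / 2 := Real.sq_sqrt (by norm_num)
  have hc1 : c ≤ 1 := by nlinarith
  rw [div_le_iff₀ (by positivity)]
  rcases le_total j i with h | h
  · obtain ⟨n, rfl⟩ := Nat.exists_eq_add_of_le h
    have e1 : ((j : ℤ) - (j + n : ℕ)).natAbs = n := by push_cast; simp
    rw [e1]
    have h3 : η * 2 ^ j ≤ c ^ n := by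
      have : η * 2 ^ j * 2 ^ n ≤ 1 := by rw [pow_add] at hi1; linarith
      calc η * 2 ^ j = η * 2 ^ j * 2 ^ n * (1 / 2) ^ n := by
            rw [mul_assoc, ← mul_pow]; norm_num
        _ ≤ 1 * (1 / 2) ^ n := by gcongr
        _ = (c ^ n) ^ 2 := by rw [one_mul, ← hc2, ← pow_mul, ← pow_mul, mul_comm]
        _ ≤ c ^ n := by
          have h1 : c ^ n ≤ 1 := pow_le_one₀ hc0.le hc1
          have h2 : 0 ≤ c ^ n := by positivity
          nlinarith
    calc _ ≤ (η * 2 ^ j) ^ 2 := min_le_left _ _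
      _ = η * (η * 2 ^ j) * 2 ^ j := by ring
      _ ≤ η * c ^ n * 2 ^ j := by gcongr
      _ ≤ _ := by
        have : 0 ≤ η * c ^ n * 2 ^ j := by positivity
        linarith
  · obtain ⟨n, rfl⟩ := Nat.exists_eq_add_of_le h
    have e1 : (((i + n : ℕ) : ℤ) - i).natAbs = n := by push_cast; simp
    rw [e1]
    refine (min_le_right _ _).trans (Real.sqrt_le_iff.2 ⟨by positivity, ?_⟩)
    have h3 : (c ^ n) ^ 2 * 2 ^ n = 1 := by
      rw [← pow_mul, mul_comm n, pow_mul, hc2, ← mul_pow]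
      norm_num
    have h4 : 1 ≤ 4 * (η * 2 ^ i) := by linarith
    calc η * 2 ^ (i + n) ≤ η * 2 ^ (i + n) * (4 * (η * 2 ^ i)) :=
          le_mul_of_one_le_right (by positivity) h4
      _ = η * 2 ^ (i + n) * (4 * (η * 2 ^ i)) * ((c ^ n) ^ 2 * 2 ^ n) := by rw [h3, mul_one]
      _ = _ := by rw [pow_add]; ring

theorem sum_Mf_pow_le {f : ℝ → ℝ} {A m : ℕ} (hA2 : 2 ≤ A)
    (hA : (2 * (m + 1)).choose (m + 1) + 2 ≤ 2 * (m + 1) * A) (hf : ContDiff ℝ A f)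
    (hsupp : ∀ t : ℝ, 1 < t → f t = 0) :
    ∃ C : ℝ, 0 < C ∧ ∀ x R η : ℝ, 2 ≤ R → R ≤ x →
      Real.log 2 / Real.log R ≤ η → η ≤ 1 →
      ∑ n ∈ (Finset.Icc 1 ⌊x⌋₊).filter
          (fun n : ℕ => ∃ p : ℕ, p.Prime ∧ p ∣ n ∧ (p : ℝ) ≤ R ^ η),
        Mf f n R ^ (2 * (m + 1)) ≤ C * η * x / Real.log R := by
  obtain ⟨φ, hφc, hφ0, hMf, K, hK, hφ1, hφ2⟩ := exists_majorant hA2 hf hsupp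
  obtain ⟨C, hC, H⟩ := exists_sum_block_le hA hφc hφ0 hK hφ1 hφ2
  set r : ℝ := √(1 / 2) ^ (1 / (2 * (m + 1) : ℝ)) with hr
  have hs0 : 0 < √(1 / 2 : ℝ) := by positivity
  have hs1 : √(1 / 2 : ℝ) < 1 := by
    rw [Real.sqrt_lt' one_pos]
    norm_num
  have hr0 : 0 < r := by positivity
  have hr1 : r < 1 := Real.rpow_lt_one hs0.le hs1 (by positivity)
  have hrpow : r ^ (2 * (m + 1)) = √(1 / 2) := by
    rw [hr, ← Real.rpow_natCast, ← Real.rpow_mul hs0.le]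
    push_cast
    rw [one_div_mul_cancel (by positivity), Real.rpow_one]
  set b : ℝ≥0∞ := ENNReal.ofReal r with hb
  have hb1 : b < 1 := ENNReal.ofReal_lt_one.2 hr1
  have hb0 : b ≠ 0 := by simpa [hb] using hr0
  set U : ℝ≥0∞ := ∑' l : ℤ, b ^ l.natAbs with hU
  have hUtop : U ≠ ⊤ := tsum_pow_natAbs_ne_top hb1
  refine ⟨(U.toReal + 1) ^ (2 * (m + 1)) * (2 * C), by positivity,
    fun x R η hR hRx hη hη1 => ?_⟩
  set L := Real.log R with hL
  have hL0 : 0 < L := Real.log_pos (by linarith)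
  have hη0 : 0 < η := (div_pos (Real.log_pos one_lt_two) hL0).trans_le hη
  have hx0 : 0 < x := by linarith
  obtain ⟨i, hi⟩ := exists_min_sq_sqrt_le hη0 hη1
  set F := (Finset.Icc 1 ⌊x⌋₊).filter (fun n : ℕ => ∃ p : ℕ, p.Prime ∧ p ∣ n ∧ (p : ℝ) ≤ R ^ η)
  set X : ℕ → ℕ → ℝ≥0∞ := fun n j => ∫⁻ ξ in dyadicBlock (2 ^ j),
    ENNReal.ofReal (φ ξ * ‖moebiusSum (fourierPoint L ξ) n‖) with hX
  set u : ℕ → ℝ≥0∞ := fun j => b ^ ((j : ℤ) - i).natAbs with hu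
  have hu0 : ∀ j, u j ≠ 0 := fun j => pow_ne_zero _ hb0
  have hutop : ∀ j, u j ≠ ⊤ := fun j => ENNReal.pow_ne_top ENNReal.ofReal_ne_top
  have hM : ∀ n, ENNReal.ofReal |Mf f n R| ≤ ∑' j, u j * ((u j)⁻¹ * X n j) := by
    intro n
    calc _ ≤ ∫⁻ ξ in Ioi 0, ENNReal.ofReal (φ ξ * ‖moebiusSum (fourierPoint L ξ) n‖) :=
          hMf n R (by linarith)
      _ ≤ ∫⁻ ξ in ⋃ j : ℕ, dyadicBlock (2 ^ j),
          ENNReal.ofReal (φ ξ * ‖moebiusSum (fourierPoint L ξ) n‖) :=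
          lintegral_mono_set Ioi_subset_iUnion_dyadicBlock
      _ ≤ ∑' j, X n j := lintegral_iUnion_le _ _
      _ = _ := by
          refine tsum_congr fun j => ?_
          rw [← mul_assoc, ENNReal.mul_inv_cancel (hu0 j) (hutop j), one_mul]
  have hQ : ∀ j, ∑ n ∈ F, X n j ^ (2 * (m + 1)) ≤
      ENNReal.ofReal (2 * C * (η * x / L)) * u j ^ (2 * (m + 1)) := by
    intro j
    refine (H R x η (2 ^ j) hR hRx hη (one_le_pow₀ one_le_two)).trans ?_
    simp only [hu, hb]
    rw [← ENNReal.ofReal_pow hr0.le, ← ENNReal.ofReal_pow (by positivity),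
      ← ENNReal.ofReal_mul (by positivity), ← pow_mul, mul_comm _ (2 * (m + 1)), pow_mul, hrpow]
    refine ENNReal.ofReal_le_ofReal ?_
    calc _ = C * (x / L) * (min ((η * 2 ^ j) ^ 2) √(η * 2 ^ j) / 2 ^ j) := by ring
      _ ≤ C * (x / L) * (2 * η * √(1 / 2) ^ ((j : ℤ) - i).natAbs) := by
        gcongr
        exact hi j
      _ = _ := by ring
  have key : ENNReal.ofReal (∑ n ∈ F, Mf f n R ^ (2 * (m + 1))) ≤
      ENNReal.ofReal ((U.toReal + 1) ^ (2 * (m + 1)) * (2 * C) * η * x / L) := by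
    calc _ = ∑ n ∈ F, ENNReal.ofReal |Mf f n R| ^ (2 * (m + 1)) := by
          rw [ENNReal.ofReal_sum_of_nonneg fun n _ => (even_two_mul _).pow_nonneg _]
          refine Finset.sum_congr rfl fun n _ => ?_
          rw [← ENNReal.ofReal_pow (abs_nonneg _), (even_two_mul _).pow_abs]
      _ ≤ ∑ n ∈ F, U ^ (2 * m + 1) * ∑' j, u j * ((u j)⁻¹ * X n j) ^ (2 * (m + 1)) := by
          refine Finset.sum_le_sum fun n _ => ?_
          calc _ ≤ (∑' j, u j * ((u j)⁻¹ * X n j)) ^ (2 * (m + 1)) := by gcongr; exact hM n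
            _ ≤ (∑' j, u j) ^ (2 * m + 1) * ∑' j, u j * ((u j)⁻¹ * X n j) ^ (2 * (m + 1)) :=
              tsum_mul_pow_succ_le _ _ (2 * m + 1)
            _ ≤ _ := by gcongr; exact tsum_pow_natAbs_sub_le b i
      _ = U ^ (2 * m + 1) * ∑' j, u j * (u j)⁻¹ ^ (2 * (m + 1)) *
            ∑ n ∈ F, X n j ^ (2 * (m + 1)) := by
          rw [← Finset.mul_sum, ← Summable.tsum_finsetSum fun _ _ => ENNReal.summable]
          congr 2
          funext j
          rw [Finset.mul_sum]
          exact Finset.sum_congr rfl fun n _ => by ring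
      _ ≤ U ^ (2 * m + 1) * ∑' j, ENNReal.ofReal (2 * C * (η * x / L)) * u j := by
          refine mul_le_mul_right (ENNReal.tsum_le_tsum fun j => ?_) _
          calc _ ≤ u j * (u j)⁻¹ ^ (2 * (m + 1)) *
                (ENNReal.ofReal (2 * C * (η * x / L)) * u j ^ (2 * (m + 1))) :=
                mul_le_mul_right (hQ j) _
            _ = ENNReal.ofReal (2 * C * (η * x / L)) * u j * (u j * (u j)⁻¹) ^ (2 * (m + 1)) := by
                ring
            _ = _ := by rw [ENNReal.mul_inv_cancel (hu0 j) (hutop j), one_pow, mul_one]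
      _ ≤ U ^ (2 * m + 1) * (ENNReal.ofReal (2 * C * (η * x / L)) * U) := by
          rw [ENNReal.tsum_mul_left]
          gcongr
          exact tsum_pow_natAbs_sub_le b i
      _ = ENNReal.ofReal (U.toReal ^ (2 * (m + 1)) * (2 * C * (η * x / L))) := by
          rw [ENNReal.ofReal_mul (p := U.toReal ^ (2 * (m + 1))) (by positivity),
            ENNReal.ofReal_pow ENNReal.toReal_nonneg,
            ENNReal.ofReal_toReal hUtop]
          ring
      _ ≤ _ := by
          refine ENNReal.ofReal_le_ofReal ?_
          calc _ ≤ (U.toReal + 1) ^ (2 * (m + 1)) * (2 * C * (η * x / L)) := by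
                gcongr
                linarith
            _ = _ := by ring
  exact (ENNReal.ofReal_le_ofReal_iff (by positivity)).1 key

end

/-- Let `k ≥ 1` and `A ≥ 2` with `A > binom(2k,k)/(2k)`, and let `f` be supported on
`(−∞,1]`, of class `C^A` with `f, f′, …, f^{(A)}` uniformly bounded. Then there is
`C(k,f) > 0` such that for all `x ≥ R ≥ 2` and `log 2/log R ≤ η ≤ 1`,
`Σ_{n ≤ x : ∃ p | n, p ≤ R^η} M_f(n;R)^{2k} ≤ C(k,f)·η·x/log R`. -/
theorem moment_small_prime_factor_bound (k A : ℕ) (hk : 1 ≤ k) (hA2 : 2 ≤ A)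
    (hA : Nat.choose (2 * k) k < 2 * k * A)
    (f : ℝ → ℝ) (hsupp : ∀ t : ℝ, 1 < t → f t = 0)
    (hsmooth : ContDiff ℝ A f)
    (hbdd : ∀ i ≤ A, ∃ B : ℝ, ∀ x : ℝ, |iteratedDeriv i f x| ≤ B) :
    ∃ C : ℝ, 0 < C ∧ ∀ x R η : ℝ, 2 ≤ R → R ≤ x →
      Real.log 2 / Real.log R ≤ η → η ≤ 1 →
      ∑ n ∈ (Finset.Icc 1 ⌊x⌋₊).filter
          (fun n : ℕ => ∃ p : ℕ, p.Prime ∧ p ∣ n ∧ (p : ℝ) ≤ R ^ η),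
        Mf f n R ^ (2 * k) ≤ C * η * x / Real.log R := by
  have hc : 2 ∣ (2 * k).choose k := by
    rw [← Nat.centralBinom_eq_two_mul_choose]
    exact Nat.two_dvd_centralBinom_of_one_le hk
  obtain ⟨m, rfl⟩ := Nat.exists_eq_add_of_le' hk
  have hd : 2 ∣ 2 * (m + 1) * A := ⟨(m + 1) * A, by ring⟩
  exact sum_Mf_pow_le hA2 (by omega) hsmooth hsupp
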